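/- Let ψ be a smooth global 1-equivariant wave map of degree one (ψ(t,0⁺) = 0, ψ(t,∞) = π for all t) with E(ψ⃗) < 3E(Q) = 12. Then there exist a sequence t_n → ∞, scales λ_n > 0 with λ_n/t_n → 0, and λ₀ > 0 such that for all 0 < r₁ < r₂ < ∞, ∫₀¹ ∫_{r₁}^{r₂} [ (∂_rψ_n(t,r) − ∂_r(Q(r/λ₀)))² + (ψ_n(t,r) − Q(r/λ₀))²/r² ] r dr dt → 0 as n → ∞, where ψ_n(t,r) := ψ(t_n + λ_n t, λ_n r). -/

import Mathlib

open MeasureTheory Real Filter Set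

noncomputable section

/-- The ground state harmonic map `Q(r) = 2 arctan r`. -/
def Q (r : ℝ) : ℝ := 2 * Real.arctan r

/-- Time derivative `∂ₜψ(t,r)`. -/
def pT (ψ : ℝ → ℝ → ℝ) (t r : ℝ) : ℝ := deriv (fun s => ψ s r) t

/-- Radial derivative `∂ᵣψ(t,r)`. -/
def pR (ψ : ℝ → ℝ → ℝ) (t r : ℝ) : ℝ := deriv (fun ρ => ψ t ρ) r

/-- Energy density `((∂ₜψ)² + (∂ᵣψ)² + sin²ψ/r²) · r`. -/
def eDen (ψ : ℝ → ℝ → ℝ) (t r : ℝ) : ℝ :=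
  ((pT ψ t r) ^ 2 + (pR ψ t r) ^ 2 + (Real.sin (ψ t r)) ^ 2 / r ^ 2) * r

/-- Localized energy `E_{r₁}^{r₂}(ψ⃗(t))`. -/
def locE (ψ : ℝ → ℝ → ℝ) (t r₁ r₂ : ℝ) : ℝ := ∫ r in Set.Ioc r₁ r₂, eDen ψ t r

/-- Total energy `E(ψ⃗(t))`. -/
def totE (ψ : ℝ → ℝ → ℝ) (t : ℝ) : ℝ := ∫ r in Set.Ioi (0:ℝ), eDen ψ t r

/-- `ψ` is a smooth global 1-equivariant wave map on `[0,∞) × (0,∞)`. -/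
def IsWaveMap (ψ : ℝ → ℝ → ℝ) : Prop :=
  ContDiffOn ℝ (⊤ : ℕ∞) (fun p : ℝ × ℝ => ψ p.1 p.2) (Set.Ici (0:ℝ) ×ˢ Set.Ioi (0:ℝ)) ∧
  ∀ t r : ℝ, 0 ≤ t → 0 < r →
    deriv (fun s => pT ψ s r) t - deriv (fun ρ => pR ψ t ρ) r
      - (1 / r) * pR ψ t r + Real.sin (2 * ψ t r) / (2 * r ^ 2) = 0

/-- Finite energy: the energy density is integrable at each time `t ≥ 0`. -/
def FiniteEnergy (ψ : ℝ → ℝ → ℝ) : Prop :=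
  ∀ t : ℝ, 0 ≤ t → MeasureTheory.IntegrableOn (eDen ψ t) (Set.Ioi 0) volume

/-- The energy is conserved. -/
def EnergyConserved (ψ : ℝ → ℝ → ℝ) : Prop :=
  ∀ t : ℝ, 0 ≤ t → totE ψ t = totE ψ 0

/-- Squared `H × L²` norm density `(ψ₁² + (∂ᵣψ₀)² + ψ₀²/r²) · r`. -/
def hl2Den (f g : ℝ → ℝ) (r : ℝ) : ℝ :=
  ((g r) ^ 2 + (deriv f r) ^ 2 + (f r) ^ 2 / r ^ 2) * r

/-- Squared `H × L²` norm of the pair `(f, g)` over the set of radii `S`. -/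
def hl2Sq (f g : ℝ → ℝ) (S : Set ℝ) : ℝ := ∫ r in S, hl2Den f g r

/-- Squared `H` norm of `f` over the set of radii `S`. -/
def hSq (f : ℝ → ℝ) (S : Set ℝ) : ℝ :=
  ∫ r in S, ((deriv f r) ^ 2 + (f r) ^ 2 / r ^ 2) * r

/-- Squared (radial) `L²` norm. -/
def l2Sq (g : ℝ → ℝ) : ℝ := ∫ r in Set.Ioi (0:ℝ), (g r) ^ 2 * r

/-- Wave map energy of a pair of data `(f, g)`. -/
def pairE (f g : ℝ → ℝ) : ℝ :=
  ∫ r in Set.Ioi (0:ℝ), ((g r) ^ 2 + (deriv f r) ^ 2 + (Real.sin (f r)) ^ 2 / r ^ 2) * r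

/-- `φ` is a smooth solution of the linearized equation
`φ_tt − φ_rr − (1/r) φ_r + φ/r² = 0` on `ℝ × (0,∞)`. -/
def IsLinearWave (φ : ℝ → ℝ → ℝ) : Prop :=
  ContDiffOn ℝ (⊤ : ℕ∞) (fun p : ℝ × ℝ => φ p.1 p.2) (Set.univ ×ˢ Set.Ioi (0:ℝ)) ∧
  ∀ t r : ℝ, 0 < r →
    deriv (fun s => pT φ s r) t - deriv (fun ρ => pR φ t ρ) r
      - (1 / r) * pR φ t r + φ t r / r ^ 2 = 0

/-- A linear wave has finite energy: its `H × L²` density is integrable at each time. -/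
def LinFiniteEnergy (φ : ℝ → ℝ → ℝ) : Prop :=
  ∀ t : ℝ, MeasureTheory.IntegrableOn (hl2Den (φ t) (pT φ t)) (Set.Ioi 0) volume

/-- Degree one boundary conditions: `ψ(t,0⁺) = 0`, `ψ(t,∞) = π`. -/
def DegreeOneBC (ψ : ℝ → ℝ → ℝ) : Prop :=
  ∀ t : ℝ, 0 ≤ t →
    Filter.Tendsto (ψ t) (nhdsWithin 0 (Set.Ioi 0)) (nhds 0) ∧
    Filter.Tendsto (ψ t) Filter.atTop (nhds Real.pi)

/-- Degree zero boundary conditions: `φ(t,0⁺) = 0`, `φ(t,∞) = 0`. -/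
def DegreeZeroBC (φ : ℝ → ℝ → ℝ) : Prop :=
  ∀ t : ℝ, 0 ≤ t →
    Filter.Tendsto (φ t) (nhdsWithin 0 (Set.Ioi 0)) (nhds 0) ∧
    Filter.Tendsto (φ t) Filter.atTop (nhds 0)

section Calculus

variable {a b : ℝ}

lemma continuous_integral_param {g : ℝ → ℝ → ℝ} (hg : Continuous fun p : ℝ × ℝ => g p.1 p.2)
    (a b : ℝ) : Continuous fun x => ∫ t in a..b, g t x :=
  intervalIntegral.continuous_parametric_intervalIntegral_of_continuous'
    (f := fun x t => g t x) (hg.comp continuous_swap) a b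

lemma hasDerivAt_integral_param {g g' : ℝ → ℝ → ℝ} (hg : Continuous fun p : ℝ × ℝ => g p.1 p.2)
    (hg' : Continuous fun p : ℝ × ℝ => g' p.1 p.2)
    (h : ∀ t x, HasDerivAt (fun x => g t x) (g' t x) x) (x : ℝ) (a b : ℝ) :
    HasDerivAt (fun x => ∫ t in a..b, g t x) (∫ t in a..b, g' t x) x := by
  have hc : ∀ x, Continuous fun t => g t x := fun x => hg.comp (by fun_prop : Continuous fun t => (t, x))
  have hc' : ∀ x, Continuous fun t => g' t x :=
    fun x => hg'.comp (by fun_prop : Continuous fun t => (t, x))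
  obtain ⟨C, hC⟩ := ((isCompact_uIcc (a := a) (b := b)).prod
    (isCompact_Icc (a := x - 1) (b := x + 1))).exists_bound_of_continuousOn hg'.continuousOn
  refine (intervalIntegral.hasDerivAt_integral_of_dominated_loc_of_deriv_le
    (F := fun x t => g t x) (F' := fun x t => g' t x) (bound := fun _ => C)
    (s := Icc (x - 1) (x + 1)) (Icc_mem_nhds (by linarith) (by linarith))
    (Eventually.of_forall fun y => (hc y).aestronglyMeasurable)
    ((hc x).intervalIntegrable _ _) (hc' x).aestronglyMeasurable ?_ (by simp) ?_).2
  · exact Eventually.of_forall fun t ht y hy => hC (t, y) ⟨uIoc_subset_uIcc ht, hy⟩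
  · exact Eventually.of_forall fun t _ y _ => h t y

lemma integral_swap_of_continuous {g : ℝ → ℝ → ℝ} (hg : Continuous fun p : ℝ × ℝ => g p.1 p.2)
    {a b c d : ℝ} (hab : a ≤ b) (hcd : c ≤ d) :
    ∫ x in a..b, ∫ t in c..d, g t x = ∫ t in c..d, ∫ x in a..b, g t x := by
  simp only [intervalIntegral.integral_of_le hab, intervalIntegral.integral_of_le hcd]
  refine integral_integral_swap (f := fun x t => g t x) ?_
  rw [Measure.prod_restrict]
  exact ((hg.comp continuous_swap).continuousOn.integrableOn_compact
    (isCompact_Icc.prod isCompact_Icc)).mono_set (prod_mono Ioc_subset_Icc_self Ioc_subset_Icc_self)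

/-- A lower bound on the derivative integrates to an upper bound at the left end point. -/
lemma le_add_integral_of_neg_le_deriv {f f' g : ℝ → ℝ} (hab : a ≤ b)
    (hf : ∀ x ∈ Icc a b, HasDerivAt f (f' x) x) (hg : Continuous g)
    (h : ∀ x ∈ Icc a b, -g x ≤ f' x) : f a ≤ f b + ∫ x in a..b, g x := by
  have hG : ∀ x, HasDerivAt (fun x => ∫ y in a..x, g y) (g x) x := fun x =>
    intervalIntegral.integral_hasDerivAt_right (hg.intervalIntegrable _ _)
      (hg.stronglyMeasurableAtFilter _ _) hg.continuousAt
  have hm : MonotoneOn (fun x => f x + ∫ y in a..x, g y) (Icc a b) := by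
    refine monotoneOn_of_hasDerivWithinAt_nonneg (f' := fun x => f' x + g x) (convex_Icc a b)
      (fun x hx => ((hf x hx).add (hG x)).continuousAt.continuousWithinAt) ?_ ?_
    · intro x hx
      rw [interior_Icc] at hx
      exact ((hf x (Ioo_subset_Icc_self hx)).add (hG x)).hasDerivWithinAt
    · intro x hx
      rw [interior_Icc] at hx
      linarith [h x (Ioo_subset_Icc_self hx)]
  simpa using hm (left_mem_Icc.2 hab) (right_mem_Icc.2 hab) hab

/-- A control on the derivative integrates to a control on the increment. -/
lemma abs_sub_le_integral_of_abs_deriv_le {f f' g : ℝ → ℝ} (hab : a ≤ b)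
    (hf : ∀ x ∈ Icc a b, HasDerivAt f (f' x) x) (hg : Continuous g)
    (h : ∀ x ∈ Icc a b, |f' x| ≤ g x) : |f b - f a| ≤ ∫ x in a..b, g x := by
  have h1 := le_add_integral_of_neg_le_deriv hab hf hg fun x hx => (abs_le.1 (h x hx)).1
  have h2 := le_add_integral_of_neg_le_deriv (f := fun x => -f x) hab
    (fun x hx => (hf x hx).neg) hg fun x hx => by linarith [(abs_le.1 (h x hx)).2]
  rw [abs_le]
  constructor <;> linarith

lemma exists_mul_le_integral {g : ℝ → ℝ} (hg : Continuous g) (hab : a ≤ b) :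
    ∃ x ∈ Icc a b, g x * (b - a) ≤ ∫ y in a..b, g y := by
  obtain ⟨x, hx, hmin⟩ := isCompact_Icc.exists_isMinOn (nonempty_Icc.2 hab) hg.continuousOn
  refine ⟨x, hx, ?_⟩
  have := intervalIntegral.integral_mono_on hab (intervalIntegrable_const (c := g x) (μ := volume))
    (hg.intervalIntegrable _ _) fun y hy => hmin hy
  simpa [mul_comm] using this

lemma sq_integral_mul_le {f g : ℝ → ℝ} (hf : Continuous f) (hg : Continuous g) (hab : a ≤ b) :
    (∫ x in a..b, f x * g x) ^ 2 ≤ (∫ x in a..b, f x ^ 2) * ∫ x in a..b, g x ^ 2 := by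
  have hd := discrim_le_zero (a := ∫ x in a..b, f x ^ 2) (b := 2 * ∫ x in a..b, f x * g x)
    (c := ∫ x in a..b, g x ^ 2) fun τ => by
      have h0 : 0 ≤ ∫ x in a..b, (τ * f x + g x) ^ 2 :=
        intervalIntegral.integral_nonneg hab fun _ _ => sq_nonneg _
      have h1 : ∫ x in a..b, (τ * f x + g x) ^ 2 = ∫ x in a..b,
          (τ * τ * f x ^ 2 + 2 * τ * (f x * g x) + g x ^ 2) := by
        congr 1; ext x; ring
      rw [h1, intervalIntegral.integral_add, intervalIntegral.integral_add,
        intervalIntegral.integral_const_mul, intervalIntegral.integral_const_mul] at h0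
      · linarith
      all_goals exact Continuous.intervalIntegrable (by fun_prop) _ _
  rw [discrim] at hd
  linarith

end Calculus

/-- Integrating a conservation law `∂ₓY = ∂ₛX + Z` over a time interval. -/
lemma hasDerivAt_integral_of_conservation_law {X Y Z Xs Yx : ℝ → ℝ → ℝ} (L : ℝ)
    (hY : Continuous fun z : ℝ × ℝ => Y z.1 z.2) (hYx : Continuous fun z : ℝ × ℝ => Yx z.1 z.2)
    (hXs : Continuous fun z : ℝ × ℝ => Xs z.1 z.2) (hZ : Continuous fun z : ℝ × ℝ => Z z.1 z.2)
    (dY : ∀ s x, HasDerivAt (fun x => Y s x) (Yx s x) x)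
    (dX : ∀ s x, HasDerivAt (fun s => X s x) (Xs s x) s)
    (h : ∀ s x, Yx s x = Xs s x + Z s x) (x : ℝ) :
    HasDerivAt (fun x => ∫ s in (0 : ℝ)..L, Y s x)
      (X L x - X 0 x + ∫ s in (0 : ℝ)..L, Z s x) x := by
  have hl : Continuous fun s : ℝ => (s, x) := by fun_prop
  have hXc : Continuous fun s => Xs s x := hXs.comp hl
  have hZc : Continuous fun s => Z s x := hZ.comp hl
  have h1 := hasDerivAt_integral_param hY hYx dY x 0 L
  simp only [h] at h1
  rw [intervalIntegral.integral_add (hXc.intervalIntegrable _ _)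
    (hZc.intervalIntegrable _ _),
    intervalIntegral.integral_eq_sub_of_hasDerivAt (fun s _ => dX s x)
      (hXc.intervalIntegrable _ _)] at h1
  exact h1

/-- A finite energy wave map in the self-similar logarithmic coordinates `t = eˢ`, `r = eˢ⁺ˣ`:
`U = ψ`, `p = r ∂ₜψ`, `q = r ∂ᵣψ`, together with the partial derivatives of `p` and `q`. -/
structure SelfSimilarWave (U p q px ps qx qs : ℝ → ℝ → ℝ) (E : ℝ) : Prop where
  cont_U : Continuous fun z : ℝ × ℝ => U z.1 z.2
  cont_p : Continuous fun z : ℝ × ℝ => p z.1 z.2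
  cont_q : Continuous fun z : ℝ × ℝ => q z.1 z.2
  cont_px : Continuous fun z : ℝ × ℝ => px z.1 z.2
  cont_ps : Continuous fun z : ℝ × ℝ => ps z.1 z.2
  cont_qx : Continuous fun z : ℝ × ℝ => qx z.1 z.2
  cont_qs : Continuous fun z : ℝ × ℝ => qs z.1 z.2
  deriv_Us : ∀ s x, HasDerivAt (fun s => U s x) (exp (-x) * p s x + q s x) s
  deriv_Ux : ∀ s x, HasDerivAt (fun x => U s x) (q s x) x
  deriv_ps : ∀ s x, HasDerivAt (fun s => p s x) (ps s x) s
  deriv_px : ∀ s x, HasDerivAt (fun x => p s x) (px s x) x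
  deriv_qs : ∀ s x, HasDerivAt (fun s => q s x) (qs s x) s
  deriv_qx : ∀ s x, HasDerivAt (fun x => q s x) (qx s x) x
  eq_ps : ∀ s x, ps s x = px s x + exp (-x) * (qx s x - sin (U s x) * cos (U s x))
  eq_qs : ∀ s x, qs s x = qx s x + exp (-x) * (px s x - p s x)
  energy_le : ∀ s a b, a ≤ b →
    ∫ x in a..b, (p s x ^ 2 + q s x ^ 2 + sin (U s x) ^ 2) ≤ E
  tendsto_pi : ∀ s, Tendsto (U s) atTop (nhds π)

namespace SelfSimilarWave

variable {U p q px ps qx qs : ℝ → ℝ → ℝ} {E : ℝ}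

lemma energy_nonneg (h : SelfSimilarWave U p q px ps qx qs E) : 0 ≤ E := by
  simpa using h.energy_le 0 0 0 le_rfl

lemma cont_energy (h : SelfSimilarWave U p q px ps qx qs E) :
    Continuous fun z : ℝ × ℝ => p z.1 z.2 ^ 2 + q z.1 z.2 ^ 2 + sin (U z.1 z.2) ^ 2 := by
  have := h.cont_U; have := h.cont_p; have := h.cont_q
  fun_prop

lemma cont_energy_slice (h : SelfSimilarWave U p q px ps qx qs E) (s : ℝ) :
    Continuous fun x => p s x ^ 2 + q s x ^ 2 + sin (U s x) ^ 2 :=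
  h.cont_energy.comp (by fun_prop : Continuous fun x : ℝ => (s, x))

lemma cont_integral_energy (h : SelfSimilarWave U p q px ps qx qs E) (L : ℝ) :
    Continuous fun x => ∫ s in (0 : ℝ)..L, (p s x ^ 2 + q s x ^ 2 + sin (U s x) ^ 2) :=
  continuous_integral_param (g := fun s x => p s x ^ 2 + q s x ^ 2 + sin (U s x) ^ 2)
    h.cont_energy 0 L

lemma integral_integral_energy_le (h : SelfSimilarWave U p q px ps qx qs E) {L : ℝ} (hL : 0 ≤ L)
    {a b : ℝ} (hab : a ≤ b) :
    ∫ x in a..b, ∫ s in (0 : ℝ)..L, (p s x ^ 2 + q s x ^ 2 + sin (U s x) ^ 2) ≤ L * E := by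
  rw [integral_swap_of_continuous (g := fun s x => p s x ^ 2 + q s x ^ 2 + sin (U s x) ^ 2)
    h.cont_energy hab hL]
  refine (intervalIntegral.integral_mono_on (g := fun _ => E) hL ?_ (by simp)
    fun s _ => h.energy_le s a b hab).trans (by simp)
  have := continuous_integral_param (g := fun x s => p s x ^ 2 + q s x ^ 2 + sin (U s x) ^ 2)
    (h.cont_energy.comp continuous_swap) a b
  exact this.intervalIntegrable _ _

/-- The energy averaged over a time interval is small somewhere on every long interval. -/
lemma exists_integral_energy_le (h : SelfSimilarWave U p q px ps qx qs E) {L : ℝ} (hL : 0 ≤ L)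
    {a b : ℝ} (hab : a ≤ b) : ∃ x ∈ Icc a b,
    (∫ s in (0 : ℝ)..L, (p s x ^ 2 + q s x ^ 2 + sin (U s x) ^ 2)) * (b - a) ≤ L * E := by
  obtain ⟨x, hx, hle⟩ := exists_mul_le_integral (h.cont_integral_energy L) hab
  exact ⟨x, hx, hle.trans (h.integral_integral_energy_le hL hab)⟩

lemma hasDerivAt_flux (h : SelfSimilarWave U p q px ps qx qs E) (L x : ℝ) :
    HasDerivAt (fun x => ∫ s in (0 : ℝ)..L, (p s x ^ 2 + q s x ^ 2 + sin (U s x) ^ 2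
      + 2 * exp (-x) * (p s x * q s x)))
      ((p L x ^ 2 + q L x ^ 2 + sin (U L x) ^ 2) - (p 0 x ^ 2 + q 0 x ^ 2 + sin (U 0 x) ^ 2)) x := by
  have h1 := h.cont_U; have h2 := h.cont_p; have h3 := h.cont_q
  have h4 := h.cont_px; have h5 := h.cont_qx; have h6 := h.cont_ps; have h7 := h.cont_qs
  have := hasDerivAt_integral_of_conservation_law L
    (Y := fun s x => p s x ^ 2 + q s x ^ 2 + sin (U s x) ^ 2 + 2 * exp (-x) * (p s x * q s x))
    (X := fun s x => p s x ^ 2 + q s x ^ 2 + sin (U s x) ^ 2) (Z := fun _ _ => 0)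
    (Yx := fun s x => 2 * p s x * px s x + 2 * q s x * qx s x
      + 2 * sin (U s x) * (cos (U s x) * q s x) + (2 * (exp (-x) * (-1)) * (p s x * q s x)
        + 2 * exp (-x) * (px s x * q s x + p s x * qx s x)))
    (Xs := fun s x => 2 * p s x * ps s x + 2 * q s x * qs s x
      + 2 * sin (U s x) * (cos (U s x) * (exp (-x) * p s x + q s x)))
    (by fun_prop) (by fun_prop) (by fun_prop) (by fun_prop)
    (fun s x => ?_) (fun s x => ?_) (fun s x => ?_) x
  · simpa using this
  · have := (((h.deriv_px s x).fun_pow 2).fun_add ((h.deriv_qx s x).fun_pow 2)).fun_add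
      ((h.deriv_Ux s x).sin.fun_pow 2)
    have := this.fun_add (((hasDerivAt_neg x).exp.const_mul 2).fun_mul
      ((h.deriv_px s x).fun_mul (h.deriv_qx s x)))
    simpa using this
  · have := (((h.deriv_ps s x).fun_pow 2).fun_add ((h.deriv_qs s x).fun_pow 2)).fun_add
      ((h.deriv_Us s x).sin.fun_pow 2)
    simpa using this
  · rw [h.eq_ps, h.eq_qs]; ring

lemma hasDerivAt_momentum (h : SelfSimilarWave U p q px ps qx qs E) (L x : ℝ) :
    HasDerivAt (fun x => ∫ s in (0 : ℝ)..L, (p s x ^ 2 + q s x ^ 2 - sin (U s x) ^ 2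
      + 2 * exp x * (p s x * q s x)))
      (2 * exp x * (p L x * q L x) - 2 * exp x * (p 0 x * q 0 x)
        + ∫ s in (0 : ℝ)..L, 2 * p s x * (p s x + exp x * q s x)) x := by
  have h1 := h.cont_U; have h2 := h.cont_p; have h3 := h.cont_q
  have h4 := h.cont_px; have h5 := h.cont_qx; have h6 := h.cont_ps; have h7 := h.cont_qs
  refine hasDerivAt_integral_of_conservation_law L
    (Y := fun s x => p s x ^ 2 + q s x ^ 2 - sin (U s x) ^ 2 + 2 * exp x * (p s x * q s x))
    (X := fun s x => 2 * exp x * (p s x * q s x))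
    (Z := fun s x => 2 * p s x * (p s x + exp x * q s x))
    (Yx := fun s x => 2 * p s x * px s x + 2 * q s x * qx s x
      - 2 * sin (U s x) * (cos (U s x) * q s x) + (2 * exp x * (p s x * q s x)
        + 2 * exp x * (px s x * q s x + p s x * qx s x)))
    (Xs := fun s x => 2 * exp x * (ps s x * q s x + p s x * qs s x))
    (by fun_prop) (by fun_prop) (by fun_prop) (by fun_prop)
    (fun s x => ?_) (fun s x => ?_) (fun s x => ?_) x
  · have := (((h.deriv_px s x).fun_pow 2).fun_add ((h.deriv_qx s x).fun_pow 2)).fun_sub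
      ((h.deriv_Ux s x).sin.fun_pow 2)
    have := this.fun_add (((hasDerivAt_exp x).const_mul 2).fun_mul
      ((h.deriv_px s x).fun_mul (h.deriv_qx s x)))
    simpa using this
  · exact ((h.deriv_ps s x).fun_mul (h.deriv_qs s x)).const_mul _
  · rw [h.eq_ps, h.eq_qs, exp_neg]
    field_simp
    ring

lemma hasDerivAt_outgoing (h : SelfSimilarWave U p q px ps qx qs E) (L x : ℝ) :
    HasDerivAt (fun x => ∫ s in (0 : ℝ)..L, (p s x + q s x) ^ 2)
      (exp x / (1 + exp x) * (p L x + q L x) ^ 2 - exp x / (1 + exp x) * (p 0 x + q 0 x) ^ 2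
        + ∫ s in (0 : ℝ)..L, 2 / (1 + exp x) *
          ((p s x + q s x) * (p s x + sin (U s x) * cos (U s x)))) x := by
  have h1 := h.cont_U; have h2 := h.cont_p; have h3 := h.cont_q
  have h4 := h.cont_px; have h5 := h.cont_qx; have h6 := h.cont_ps; have h7 := h.cont_qs
  have hne : ∀ x : ℝ, 1 + exp x ≠ 0 := fun x => by positivity
  refine hasDerivAt_integral_of_conservation_law L
    (Y := fun s x => (p s x + q s x) ^ 2)
    (X := fun s x => exp x / (1 + exp x) * (p s x + q s x) ^ 2)
    (Z := fun s x => 2 / (1 + exp x) * ((p s x + q s x) * (p s x + sin (U s x) * cos (U s x))))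
    (Yx := fun s x => 2 * (p s x + q s x) * (px s x + qx s x))
    (Xs := fun s x => exp x / (1 + exp x) * (2 * (p s x + q s x) * (ps s x + qs s x)))
    (by fun_prop) (by fun_prop) (by fun_prop (disch := simp [hne])) (by fun_prop (disch := simp [hne]))
    (fun s x => ?_) (fun s x => ?_) (fun s x => ?_) x
  · simpa using ((h.deriv_px s x).fun_add (h.deriv_qx s x)).fun_pow 2
  · simpa using (((h.deriv_ps s x).fun_add (h.deriv_qs s x)).fun_pow 2).const_mul (exp x / (1 + exp x))
  · rw [h.eq_ps, h.eq_qs, exp_neg]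
    have := hne x
    field_simp
    ring

end SelfSimilarWave

/-- A `C¹` potential vanishing at `π`, equal to `1 + cos z` on `[0, ∞)` and constant for `z ≤ 0`. -/
def potW (z : ℝ) : ℝ := 1 + cos (max z 0)

lemma continuous_potW : Continuous potW := by
  unfold potW; fun_prop

lemma hasDerivAt_potW (z : ℝ) : HasDerivAt potW (-sin (max z 0)) z := by
  have key : ∀ y ≠ (0 : ℝ), HasDerivAt potW (-sin (max y 0)) y := by
    intro y hy
    rcases lt_or_gt_of_ne hy with h | h
    · rw [max_eq_right h.le, sin_zero, neg_zero]
      refine (hasDerivAt_const y (1 + cos 0)).congr_of_eventuallyEq ?_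
      filter_upwards [Iio_mem_nhds h] with w hw
      rw [potW, max_eq_right (le_of_lt hw)]
    · rw [max_eq_left h.le]
      refine ((hasDerivAt_cos y).const_add 1).congr_of_eventuallyEq ?_
      filter_upwards [Ioi_mem_nhds h] with w hw
      rw [potW, max_eq_left (le_of_lt hw)]
  by_cases h0 : z = 0
  · subst h0
    exact hasDerivAt_of_hasDerivAt_of_ne (g := fun y => -sin (max y 0)) key
      continuous_potW.continuousAt (by fun_prop)
  · exact key z h0

lemma potW_nonneg (z : ℝ) : 0 ≤ potW z := by
  rw [potW]; linarith [neg_one_le_cos (max z 0)]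

lemma potW_pi : potW π = 0 := by
  rw [potW, max_eq_left pi_pos.le, cos_pi]; norm_num

lemma sq_sin_max_le (z : ℝ) : sin (max z 0) ^ 2 ≤ 2 * potW z := by
  rw [potW, sin_sq]
  nlinarith [neg_one_le_cos (max z 0), cos_le_one (max z 0)]

lemma sq_sin_max_le_sq_sin (z : ℝ) : sin (max z 0) ^ 2 ≤ sin z ^ 2 := by
  rcases le_total z 0 with h | h
  · rw [max_eq_right h, sin_zero]; nlinarith [sq_nonneg (sin z)]
  · rw [max_eq_left h]

lemma sq_sin_le_potW (z : ℝ) : sin z ^ 2 ≤ 2 * potW z := by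
  rcases le_total z 0 with h | h
  · rw [potW, max_eq_right h, cos_zero]; nlinarith [sin_sq_le_one z]
  · rw [potW, sin_sq, max_eq_left h]
    nlinarith [neg_one_le_cos z, cos_le_one z]

lemma pi_div_two_lt_of_potW_lt_one {z : ℝ} (h : potW z < 1) : π / 2 < z := by
  by_contra! hz
  have : 0 ≤ cos (max z 0) := cos_nonneg_of_neg_pi_div_two_le_of_le
    (by linarith [le_max_right z 0, pi_pos]) (max_le hz (by positivity))
  rw [potW] at h
  linarith

namespace SelfSimilarWave

variable {U p q px ps qx qs : ℝ → ℝ → ℝ} {E : ℝ}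

lemma continuous_slice {g : ℝ → ℝ → ℝ} (hg : Continuous fun z : ℝ × ℝ => g z.1 z.2) (s : ℝ) :
    Continuous (g s) :=
  hg.comp (by fun_prop : Continuous fun x : ℝ => (s, x))

/-- The energy of the exterior of the light cone decays, uniformly in time. -/
lemma exists_tail_le (h : SelfSimilarWave U p q px ps qx qs E) {ε : ℝ} (hε : 0 < ε) :
    ∃ X, 1 ≤ X ∧ ∀ s, 0 ≤ s → ∀ x', X ≤ x' →
      ∫ x in X..x', (p s x ^ 2 + q s x ^ 2 + sin (U s x) ^ 2) ≤ ε := by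
  have hint : ∀ s a b, IntervalIntegrable
      (fun x => p s x ^ 2 + q s x ^ 2 + sin (U s x) ^ 2) volume a b :=
    fun s a b => (h.cont_energy_slice s).intervalIntegrable _ _
  have hmono : ∀ s X x' x'', X ≤ x' → x' ≤ x'' →
      ∫ x in X..x', (p s x ^ 2 + q s x ^ 2 + sin (U s x) ^ 2) ≤
        ∫ x in X..x'', (p s x ^ 2 + q s x ^ 2 + sin (U s x) ^ 2) := by
    intro s X x' x'' _ h2
    rw [← intervalIntegral.integral_add_adjacent_intervals (hint s X x') (hint s x' x'')]
    have : 0 ≤ ∫ x in x'..x'', (p s x ^ 2 + q s x ^ 2 + sin (U s x) ^ 2) :=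
      intervalIntegral.integral_nonneg h2 fun _ _ => by positivity
    linarith
  obtain ⟨X, hX, htail⟩ : ∃ X, 1 ≤ X ∧ ∀ x', X ≤ x' →
      ∫ x in X..x', (p 0 x ^ 2 + q 0 x ^ 2 + sin (U 0 x) ^ 2) ≤ ε / 2 := by
    set S := (fun x' => ∫ x in (1 : ℝ)..x', (p 0 x ^ 2 + q 0 x ^ 2 + sin (U 0 x) ^ 2)) '' Ici 1
    have hS : BddAbove S := ⟨E, by rintro _ ⟨x', hx', rfl⟩; exact h.energy_le 0 1 x' hx'⟩
    obtain ⟨_, ⟨X, hX, rfl⟩, hlt⟩ := exists_lt_of_lt_csSup (s := S) (b := sSup S - ε / 2)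
      ⟨_, 1, self_mem_Ici, rfl⟩ (by linarith)
    refine ⟨X, hX, fun x' hx' => ?_⟩
    have h1 := le_csSup hS ⟨x', (mem_Ici.1 hX).trans hx', rfl⟩
    have h2 := intervalIntegral.integral_add_adjacent_intervals (hint 0 1 X) (hint 0 X x')
    simp only at h1 hlt
    linarith
  refine ⟨X, hX, fun s hs x' hx' => ?_⟩
  obtain ⟨x'', hx'', hle⟩ := h.exists_integral_energy_le hs
    (le_add_of_nonneg_right (a := x') (b := 4 * s * E / ε + 1)
      (by have := h.energy_nonneg; positivity))
  have hF := intervalIntegral.integral_eq_sub_of_hasDerivAt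
    (fun x _ => h.hasDerivAt_flux s x) (((hint s X x'').sub (hint 0 X x'')))
  rw [intervalIntegral.integral_sub (hint s X x'') (hint 0 X x'')] at hF
  have hpos : ∀ x, 0 ≤ x → ∀ s, |2 * exp (-x) * (p s x * q s x)| ≤ p s x ^ 2 + q s x ^ 2 := by
    intro x hx s
    have h1 : exp (-x) ≤ 1 := exp_le_one_iff.2 (by linarith)
    have h2 : |p s x * q s x| * 2 ≤ p s x ^ 2 + q s x ^ 2 := by
      rw [abs_mul, ← sq_abs (p s x), ← sq_abs (q s x)]
      nlinarith [sq_nonneg (|p s x| - |q s x|)]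
    rw [abs_mul, abs_mul, abs_of_pos (exp_pos _), abs_two]
    nlinarith [abs_nonneg (p s x * q s x)]
  have hFX : 0 ≤ ∫ s in (0 : ℝ)..s, (p s X ^ 2 + q s X ^ 2 + sin (U s X) ^ 2
      + 2 * exp (-X) * (p s X * q s X)) := intervalIntegral.integral_nonneg hs fun σ _ => by
    nlinarith [abs_le.1 (hpos X (by linarith) σ), sq_nonneg (sin (U σ X))]
  have hcp := h.cont_p; have hcq := h.cont_q; have hcU := h.cont_U
  have hl : Continuous fun s : ℝ => (s, x'') := by fun_prop
  have hcp' : Continuous fun s => p s x'' := hcp.comp hl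
  have hcq' : Continuous fun s => q s x'' := hcq.comp hl
  have hcU' : Continuous fun s => U s x'' := hcU.comp hl
  have hFx : ∫ s in (0 : ℝ)..s, (p s x'' ^ 2 + q s x'' ^ 2 + sin (U s x'') ^ 2
      + 2 * exp (-x'') * (p s x'' * q s x'')) ≤
      2 * ∫ s in (0 : ℝ)..s, (p s x'' ^ 2 + q s x'' ^ 2 + sin (U s x'') ^ 2) := by
    rw [← intervalIntegral.integral_const_mul]
    refine intervalIntegral.integral_mono_on hs (Continuous.intervalIntegrable (by fun_prop) _ _)
      (Continuous.intervalIntegrable (by fun_prop) _ _) fun σ _ => ?_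
    nlinarith [abs_le.1 (hpos x'' (by linarith [hx''.1]) σ), sq_nonneg (sin (U σ x''))]
  have hsmall : 2 * ∫ s in (0 : ℝ)..s, (p s x'' ^ 2 + q s x'' ^ 2 + sin (U s x'') ^ 2) ≤ ε / 2 := by
    have hE := h.energy_nonneg
    set T := ∫ s in (0 : ℝ)..s, (p s x'' ^ 2 + q s x'' ^ 2 + sin (U s x'') ^ 2)
    rw [add_sub_cancel_left] at hle
    by_contra! hc
    have h1 : (ε / 4) * (4 * s * E / ε + 1) < T * (4 * s * E / ε + 1) :=
      mul_lt_mul_of_pos_right (by linarith) (by positivity)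
    have h2 : (ε / 4) * (4 * s * E / ε + 1) = s * E + ε / 4 := by field_simp
    linarith
  have := hmono s X x' x'' hx' hx''.1
  have := htail x'' (hx'.trans hx''.1)
  linarith

/-- Pointwise control of the potential by the energy to the right. -/
lemma potW_le_integral_add (h : SelfSimilarWave U p q px ps qx qs E) (s : ℝ) {x x' : ℝ}
    (hx : x ≤ x') : potW (U s x) ≤ potW (U s x') +
      ∫ y in x..x', (p s y ^ 2 + q s y ^ 2 + sin (U s y) ^ 2) := by
  refine le_add_integral_of_neg_le_deriv (f := fun x => potW (U s x)) hx
    (fun y _ => (hasDerivAt_potW (U s y)).comp y (h.deriv_Ux s y)) (h.cont_energy_slice s)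
    fun y _ => ?_
  have := sq_sin_max_le_sq_sin (U s y)
  nlinarith [sq_nonneg (p s y), sq_nonneg (sin (max (U s y) 0) - q s y)]

lemma potW_le_of_tail (h : SelfSimilarWave U p q px ps qx qs E) {s X ε : ℝ}
    (ht : ∀ x', X ≤ x' → ∫ x in X..x', (p s x ^ 2 + q s x ^ 2 + sin (U s x) ^ 2) ≤ ε) :
    potW (U s X) ≤ ε := by
  have hlim : Tendsto (fun x' => potW (U s x') + ε) atTop (nhds (0 + ε)) := by
    rw [← potW_pi]
    exact ((continuous_potW.tendsto π).comp (h.tendsto_pi s)).add_const ε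
  rw [zero_add] at hlim
  refine ge_of_tendsto hlim ?_
  filter_upwards [eventually_ge_atTop X] with x' hx'
  linarith [h.potW_le_integral_add s hx', ht x' hx']

lemma cont_potW (h : SelfSimilarWave U p q px ps qx qs E) :
    Continuous fun z : ℝ × ℝ => potW (U z.1 z.2) := continuous_potW.comp h.cont_U

/-- The potential averaged over a time interval is controlled outside the light cone. -/
lemma integral_potW_le (h : SelfSimilarWave U p q px ps qx qs E) {L δ X ε C : ℝ} (hL : 0 ≤ L)
    (hδ : δ ≤ X)
    (ht : ∀ s, 0 ≤ s → ∀ x', X ≤ x' →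
      ∫ x in X..x', (p s x ^ 2 + q s x ^ 2 + sin (U s x) ^ 2) ≤ ε)
    (hC : ∀ x, δ ≤ x → ∫ s in (0 : ℝ)..L, (p s x ^ 2 + q s x ^ 2 + sin (U s x) ^ 2) ≤ C) :
    ∫ s in (0 : ℝ)..L, potW (U s δ) ≤ L * ε + (X - δ) * C := by
  have hcont := continuous_integral_param
    (g := fun x s => p s x ^ 2 + q s x ^ 2 + sin (U s x) ^ 2)
    (h.cont_energy.comp continuous_swap) δ X
  have hcW : Continuous fun s => potW (U s δ) :=
    h.cont_potW.comp (by fun_prop : Continuous fun s : ℝ => (s, δ))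
  calc ∫ s in (0 : ℝ)..L, potW (U s δ)
      ≤ ∫ s in (0 : ℝ)..L, (ε + ∫ x in δ..X, (p s x ^ 2 + q s x ^ 2 + sin (U s x) ^ 2)) := by
        refine intervalIntegral.integral_mono_on hL (hcW.intervalIntegrable _ _)
          ((hcont.const_add ε).intervalIntegrable _ _) fun s hs => ?_
        linarith [h.potW_le_integral_add s hδ, h.potW_le_of_tail (ht s hs.1)]
    _ = L * ε + ∫ x in δ..X, ∫ s in (0 : ℝ)..L, (p s x ^ 2 + q s x ^ 2 + sin (U s x) ^ 2) := by
        rw [intervalIntegral.integral_add (by simp) (hcont.intervalIntegrable _ _),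
          integral_swap_of_continuous
            (g := fun s x => p s x ^ 2 + q s x ^ 2 + sin (U s x) ^ 2) h.cont_energy hδ hL]
        simp
    _ ≤ L * ε + (X - δ) * C := by
        gcongr
        refine (intervalIntegral.integral_mono_on (g := fun _ => C) hδ
          ((h.cont_integral_energy L).intervalIntegrable _ _) (by simp)
          fun x hx => hC x hx.1).trans (by simp)

end SelfSimilarWave

/-- The integral quantities of a self-similar wave map over a time slab of length `L`, as functions
of the logarithmic radius: `a = ∫ p²`, `b = ∫ q²`, `c = ∫ sin² U`, `m = ∫ p q`, `H = ∫ W(U)`,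
and `e₀`, `e₁` are the energy densities at both ends of the slab. -/
structure SlabBounds (a b c m H e₀ e₁ : ℝ → ℝ) (E L : ℝ) : Prop where
  cont_a : Continuous a
  cont_b : Continuous b
  cont_c : Continuous c
  cont_e₀ : Continuous e₀
  cont_e₁ : Continuous e₁
  quad_nonneg : ∀ τ x, 0 ≤ a x + 2 * τ * m x + τ ^ 2 * b x
  b_nonneg : ∀ x, 0 ≤ b x
  c_nonneg : ∀ x, 0 ≤ c x
  H_nonneg : ∀ x, 0 ≤ H x
  e₀_nonneg : ∀ x, 0 ≤ e₀ x
  e₁_nonneg : ∀ x, 0 ≤ e₁ x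
  c_le : ∀ x, c x ≤ 2 * H x
  integral_le : ∀ u v, u ≤ v → ∫ x in u..v, (a x + b x + c x) ≤ L * E
  integral_e₀_le : ∀ u v, u ≤ v → ∫ x in u..v, e₀ x ≤ E
  integral_e₁_le : ∀ u v, u ≤ v → ∫ x in u..v, e₁ x ≤ E
  deriv_flux : ∀ x, HasDerivAt (fun x => a x + b x + c x + 2 * exp (-x) * m x) (e₁ x - e₀ x) x
  deriv_momentum : ∀ x, ∃ D, |D| ≤ exp x * (e₁ x + e₀ x) ∧
    HasDerivAt (fun x => a x + b x - c x + 2 * exp x * m x) (D + 2 * a x + 2 * exp x * m x) x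
  deriv_outgoing : ∀ x, ∃ D, HasDerivAt (fun x => a x + b x + 2 * m x) D x ∧ ∀ τ, 0 < τ →
    -(2 * e₀ x + τ * (a x + b x + 2 * m x) + 2 / τ * (a x + b x + c x)) ≤ D
  deriv_H : ∀ x, ∃ D, HasDerivAt H D x ∧ ∀ α, 0 < α →
    |D| ≤ α * H x + b x / (2 * α) ∧ |D| ≤ (α * L + b x / α) / 2

namespace SlabBounds

variable {a b c m H e₀ e₁ : ℝ → ℝ} {E L : ℝ}

lemma a_nonneg (h : SlabBounds a b c m H e₀ e₁ E L) (x : ℝ) : 0 ≤ a x := by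
  simpa using h.quad_nonneg 0 x

lemma abs_two_mul_m_le (h : SlabBounds a b c m H e₀ e₁ E L) (x : ℝ) : |2 * m x| ≤ a x + b x := by
  have h1 := h.quad_nonneg 1 x
  have h2 := h.quad_nonneg (-1) x
  rw [abs_le]; constructor <;> linarith

lemma E_nonneg (h : SlabBounds a b c m H e₀ e₁ E L) : 0 ≤ E := by
  simpa using h.integral_e₀_le 0 0 le_rfl

lemma abs_flux_le (h : SlabBounds a b c m H e₀ e₁ E L) (hL : 0 < L) (x : ℝ) :
    |a x + b x + c x + 2 * exp (-x) * m x| ≤ 2 * E := by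
  have hc : Continuous fun x => a x + b x + c x := (h.cont_a.add h.cont_b).add h.cont_c
  obtain ⟨x', hx', hle⟩ := exists_mul_le_integral hc
    (show max x 0 ≤ max x 0 + 2 * L by linarith)
  have hle' := hle.trans (h.integral_le _ _ (by linarith))
  rw [add_sub_cancel_left] at hle'
  have hsmall : 2 * (a x' + b x' + c x') ≤ E := by
    by_contra! hcon
    nlinarith
  have h0 : 0 ≤ x' := (le_max_right x 0).trans hx'.1
  have hxx : x ≤ x' := (le_max_left x 0).trans hx'.1
  have hm := abs_le.1 (h.abs_two_mul_m_le x')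
  have hexp : exp (-x') ≤ 1 := exp_le_one_iff.2 (by linarith)
  have hpos := exp_pos (-x')
  have hF' : |a x' + b x' + c x' + 2 * exp (-x') * m x'| ≤ E := by
    have := h.c_nonneg x'; have := h.a_nonneg x'; have := h.b_nonneg x'
    rw [abs_le]; constructor <;> nlinarith
  have hint := intervalIntegral.integral_eq_sub_of_hasDerivAt (a := x) (b := x')
    (fun y _ => h.deriv_flux y) ((h.cont_e₁.sub h.cont_e₀).intervalIntegrable _ _)
  rw [intervalIntegral.integral_sub (h.cont_e₁.intervalIntegrable _ _)
    (h.cont_e₀.intervalIntegrable _ _)] at hint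
  have h1 := h.integral_e₀_le x x' hxx
  have h2 := h.integral_e₁_le x x' hxx
  have h3 : 0 ≤ ∫ y in x..x', e₀ y := intervalIntegral.integral_nonneg hxx fun y _ => h.e₀_nonneg y
  have h4 : 0 ≤ ∫ y in x..x', e₁ y := intervalIntegral.integral_nonneg hxx fun y _ => h.e₁_nonneg y
  rw [abs_le] at hF' ⊢
  constructor <;> linarith

lemma integral_energy_le (h : SlabBounds a b c m H e₀ e₁ E L) (hL : 0 < L) {δ : ℝ} (hδ : 0 < δ)
    {x : ℝ} (hx : δ ≤ x) : a x + b x + c x ≤ 2 * E / (1 - exp (-δ)) := by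
  have h1 : exp (-δ) < 1 := exp_lt_one_iff.2 (by linarith)
  have h2 : exp (-x) ≤ exp (-δ) := exp_le_exp.2 (by linarith)
  rw [le_div_iff₀ (by linarith)]
  have hF := (abs_le.1 (h.abs_flux_le hL x)).2
  have hm := abs_le.1 (h.abs_two_mul_m_le x)
  have := h.c_nonneg x; have := h.a_nonneg x; have := h.b_nonneg x
  have := exp_pos (-x)
  nlinarith

lemma H_neg_le (h : SlabBounds a b c m H e₀ e₁ E L) {δ α : ℝ} (hδ : 0 < δ) (hα : 0 < α) :
    H (-δ) ≤ H δ + (δ * α * L + L * E / (2 * α)) := by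
  choose D hD hDb using h.deriv_H
  have hc : Continuous fun x => a x + b x + c x := (h.cont_a.add h.cont_b).add h.cont_c
  have := le_add_integral_of_neg_le_deriv (show -δ ≤ δ by linarith) (fun x _ => hD x)
    (g := fun x => α * L / 2 + (2 * α)⁻¹ * (a x + b x + c x)) (by fun_prop) fun x _ => by
      have h1 := (abs_le.1 (hDb x α hα).2).1
      have h2 : b x / α ≤ (a x + b x + c x) / α := by
        gcongr
        linarith [h.a_nonneg x, h.c_nonneg x]
      have h3 : (2 * α)⁻¹ * (a x + b x + c x) = (a x + b x + c x) / α / 2 := by field_simp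
      linarith
  rw [intervalIntegral.integral_add (by simp) (Continuous.intervalIntegrable (by fun_prop) _ _),
    intervalIntegral.integral_const_mul] at this
  have h5 : (2 * α)⁻¹ * ∫ x in -δ..δ, (a x + b x + c x) ≤ (2 * α)⁻¹ * (L * E) := by
    gcongr; exact h.integral_le _ _ (by linarith)
  simp only [intervalIntegral.integral_const, smul_eq_mul] at this
  have h6 : (2 * α)⁻¹ * (L * E) = L * E / (2 * α) := by field_simp
  nlinarith

lemma outgoing_neg_le (h : SlabBounds a b c m H e₀ e₁ E L) (hL : 0 < L) {δ : ℝ} (hδ : 0 < δ) :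
    a (-δ) + b (-δ) + 2 * m (-δ) ≤ 12 * E + 6 * δ * L * E := by
  choose D hD hDb using h.deriv_outgoing
  have hexp : ∀ x, HasDerivAt (fun x => exp (δ⁻¹ * x)) (exp (δ⁻¹ * x) * δ⁻¹) x := fun x => by
    simpa using ((hasDerivAt_id x).const_mul δ⁻¹).exp
  have hc1 := h.cont_a; have hc2 := h.cont_b; have hc3 := h.cont_c; have hc4 := h.cont_e₀
  have := le_add_integral_of_neg_le_deriv (show -δ ≤ 0 by linarith)
    (fun x _ => (hD x).mul (hexp x))
    (g := fun x => 2 * e₀ x + 2 * δ * (a x + b x + c x)) (by fun_prop) fun x hx => by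
      have h1 := hDb x δ⁻¹ (inv_pos.2 hδ)
      have h2 : exp (δ⁻¹ * x) ≤ 1 := exp_le_one_iff.2
        (mul_nonpos_of_nonneg_of_nonpos (inv_nonneg.2 hδ.le) hx.2)
      have h3 := exp_pos (δ⁻¹ * x)
      rw [div_inv_eq_mul] at h1
      have h4 : 0 ≤ 2 * e₀ x + 2 * δ * (a x + b x + c x) := by
        have := h.e₀_nonneg x; have := h.a_nonneg x; have := h.b_nonneg x; have := h.c_nonneg x
        positivity
      nlinarith
  rw [intervalIntegral.integral_add (Continuous.intervalIntegrable (by fun_prop) _ _)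
    (Continuous.intervalIntegrable (by fun_prop) _ _), intervalIntegral.integral_const_mul,
    intervalIntegral.integral_const_mul] at this
  have i1 := h.integral_e₀_le (-δ) 0 (by linarith)
  have i2 := h.integral_le (-δ) 0 (by linarith)
  have hF := (abs_le.1 (h.abs_flux_le hL 0)).2
  have h0 := h.c_nonneg 0
  simp only [Pi.mul_apply, mul_neg, inv_mul_cancel₀ hδ.ne', mul_zero, exp_zero, mul_one,
    neg_zero] at this hF
  have hA : (a (-δ) + b (-δ) + 2 * m (-δ)) * exp (-1) ≤ 4 * E + 2 * δ * (L * E) := by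
    nlinarith
  have he : exp 1 ≤ 3 := by linarith [exp_one_lt_d9]
  have hE := h.E_nonneg
  calc a (-δ) + b (-δ) + 2 * m (-δ)
      = (a (-δ) + b (-δ) + 2 * m (-δ)) * exp (-1) * exp 1 := by
        rw [mul_assoc, ← exp_add]; simp
    _ ≤ (4 * E + 2 * δ * (L * E)) * 3 := by gcongr
    _ = _ := by ring

lemma anisotropy_neg_le (h : SlabBounds a b c m H e₀ e₁ E L) (hL : 0 < L) {δ : ℝ} (hδ : 0 < δ) :
    (1 - exp (-δ) ^ 2) * (a (-δ) + b (-δ)) - (1 + exp (-δ) ^ 2) * c (-δ) ≤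
      28 * E + 12 * δ * L * E := by
  have hA := h.outgoing_neg_le hL hδ
  have hF := abs_le.1 (h.abs_flux_le hL (-δ))
  have h0 := h.c_nonneg (-δ)
  have hA0 := abs_le.1 (h.abs_two_mul_m_le (-δ))
  have hy1 : exp (-δ) ≤ 1 := exp_le_one_iff.2 (by linarith)
  have hE := h.E_nonneg
  set y := exp (-δ)
  have hy0 : 0 < y := exp_pos _
  have hyy : exp (- -δ) = y⁻¹ := by rw [exp_neg]
  rw [hyy] at hF
  set F := a (-δ) + b (-δ) + c (-δ) + 2 * y⁻¹ * m (-δ)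
  have key : (1 - y ^ 2) * (a (-δ) + b (-δ)) - (1 + y ^ 2) * c (-δ) =
      (1 + y) * (a (-δ) + b (-δ) + 2 * m (-δ)) - (1 - y) * c (-δ) - y * (1 + y) * F := by
    simp only [F]; field_simp; ring
  rw [key]
  have h1 : -(y * (1 + y) * F) ≤ 2 * (2 * E) := by
    have : y * (1 + y) ≤ 2 := by nlinarith
    have : 0 ≤ y * (1 + y) := by positivity
    nlinarith
  nlinarith

lemma anisotropy_le (h : SlabBounds a b c m H e₀ e₁ E L) (hL : 0 < L) {δ x : ℝ} (hδ : 0 < δ)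
    (hx : x ≤ -δ) :
    (1 - exp x ^ 2) * (a x + b x) - (1 + exp x ^ 2) * c x ≤
      (28 * E + 12 * δ * L * E) / √(1 - exp (-δ) ^ 2)
        + (4 * E - 6 * E * x) / √(1 - exp (-δ) ^ 2) ^ 3 := by
  set B := fun x => (1 - exp x ^ 2) * (a x + b x) - (1 + exp x ^ 2) * c x
  choose D hDb hD using h.deriv_momentum
  have hE := h.E_nonneg
  set d := √(1 - exp (-δ) ^ 2)
  have hd : 0 < d := sqrt_pos.2 (by
    have : exp (-δ) < 1 := exp_lt_one_iff.2 (by linarith)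
    nlinarith [exp_pos (-δ)])
  have hB : ∀ x, HasDerivAt B (D x + 2 * a x + 2 * exp x * m x
      - (2 * exp x ^ 2 * (a x + b x + c x + 2 * exp (-x) * m x) + exp x ^ 2 * (e₁ x - e₀ x))) x := by
    intro x
    have h1 := (hD x).fun_sub (((hasDerivAt_exp x).fun_pow 2).fun_mul (h.deriv_flux x))
    refine (h1.congr_deriv ?_).congr_of_eventuallyEq (Eventually.of_forall fun z => ?_)
    · simp only [Nat.cast_ofNat, Nat.add_one_sub_one, pow_one]; ring
    · simp only [B, exp_neg]; field_simp; ring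
  have hdpos : ∀ x ≤ -δ, d ≤ √(1 - exp x ^ 2) := fun x hx => by
    refine sqrt_le_sqrt ?_
    have : exp x ≤ exp (-δ) := exp_le_exp.2 hx
    have := exp_pos x
    nlinarith
  have hg : ∀ z ∈ Icc x (-δ), HasDerivAt (fun x => B x / √(1 - exp x ^ 2))
      (((D z - exp z ^ 2 * (e₁ z - e₀ z)) * (1 - exp z ^ 2)
        - (3 - exp z ^ 2) * exp z ^ 2 * (a z + b z + c z + 2 * exp (-z) * m z)
        + 2 * (a z + 2 * exp z * m z + exp z ^ 2 * b z)) / √(1 - exp z ^ 2) ^ 3) z := by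
    intro x hx
    have hpos := hd.trans_le (hdpos x hx.2)
    have hpos' := sqrt_pos.1 hpos
    have h1 : HasDerivAt (fun x => √(1 - exp x ^ 2))
        (-(2 * exp x * exp x) / (2 * √(1 - exp x ^ 2))) x := by
      have := (((hasDerivAt_exp x).fun_pow 2).const_sub 1).sqrt hpos'.ne'
      simpa using this
    refine ((hB x).fun_div h1 hpos.ne').congr_deriv ?_
    have hsq : 1 - exp x ^ 2 = √(1 - exp x ^ 2) ^ 2 := (sq_sqrt hpos'.le).symm
    set w := √(1 - exp x ^ 2)
    have hy := exp_pos x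
    simp only [B, exp_neg]
    set y := exp x
    have hw : w ^ 2 = 1 - y ^ 2 := hsq.symm
    rw [div_eq_div_iff (by positivity) (by positivity)]
    field_simp
    ring_nf
    simp only [hw]
    ring
  have hc0 := h.cont_e₀; have hc1 := h.cont_e₁
  have hmain := le_add_integral_of_neg_le_deriv hx hg
    (g := fun x => (d ^ 3)⁻¹ * (2 * (e₁ x + e₀ x) + 6 * E)) (by fun_prop) fun x hx => by
      have hw := hdpos x hx.2
      have hpos := hd.trans_le hw
      have hpos' := sqrt_pos.1 hpos
      have hy := exp_pos x
      have hF := (abs_le.1 (h.abs_flux_le hL x))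
      have hq := h.quad_nonneg (exp x) x
      have hD' := (abs_le.1 (hDb x))
      have := h.e₀_nonneg x; have := h.e₁_nonneg x
      set F := a x + b x + c x + 2 * exp (-x) * m x
      have hy1 : exp x < 1 := by nlinarith
      set y := exp x
      have hy2 : y ^ 2 ≤ 1 := by linarith
      have g1 : -(2 * (e₁ x + e₀ x)) ≤ (D x - y ^ 2 * (e₁ x - e₀ x)) * (1 - y ^ 2) := by
        have : -(2 * (e₁ x + e₀ x)) ≤ D x - y ^ 2 * (e₁ x - e₀ x) := by nlinarith
        nlinarith [mul_nonneg (sq_nonneg y) (add_nonneg (h.e₁_nonneg x) (h.e₀_nonneg x))]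
      have g2 : (3 - y ^ 2) * y ^ 2 * F ≤ 6 * E := by
        have h3 : (3 - y ^ 2) * y ^ 2 ≤ 3 := by nlinarith [sq_nonneg y]
        have h4 : 0 ≤ (3 - y ^ 2) * y ^ 2 := mul_nonneg (by linarith) (sq_nonneg y)
        nlinarith
      rw [neg_le, ← neg_div]
      calc _ ≤ (2 * (e₁ x + e₀ x) + 6 * E) / √(1 - y ^ 2) ^ 3 := by gcongr; linarith
        _ ≤ (2 * (e₁ x + e₀ x) + 6 * E) / d ^ 3 := by gcongr
        _ = _ := by rw [div_eq_inv_mul]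
  rw [intervalIntegral.integral_const_mul, intervalIntegral.integral_add
    (Continuous.intervalIntegrable (by fun_prop) _ _) (by simp), intervalIntegral.integral_const_mul,
    intervalIntegral.integral_add (hc1.intervalIntegrable _ _) (hc0.intervalIntegrable _ _)] at hmain
  have i0 := h.integral_e₀_le x (-δ) hx
  have i1 := h.integral_e₁_le x (-δ) hx
  have hBd : B (-δ) ≤ 28 * E + 12 * δ * L * E := h.anisotropy_neg_le hL hδ
  have hw1 : √(1 - exp x ^ 2) ≤ 1 := sqrt_le_one.2 (by nlinarith [exp_pos x])
  have hw0 := hd.trans_le (hdpos x hx)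
  have hbound : B x / √(1 - exp x ^ 2) ≤ (28 * E + 12 * δ * L * E) / d
      + (4 * E - 6 * E * x) / d ^ 3 := by
    refine hmain.trans (add_le_add ?_ ?_)
    · gcongr
    · rw [div_eq_inv_mul]
      gcongr
      simp only [intervalIntegral.integral_const, smul_eq_mul]
      nlinarith
  have hnn : 0 ≤ (28 * E + 12 * δ * L * E) / d + (4 * E - 6 * E * x) / d ^ 3 := by
    have : 0 ≤ 4 * E - 6 * E * x := by nlinarith
    positivity
  rw [div_le_iff₀ hw0] at hbound
  exact hbound.trans (mul_le_of_le_one_right hnn hw1)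

/-- Gronwall argument for the potential inside the light cone. -/
lemma H_le_of_anisotropy_le (h : SlabBounds a b c m H e₀ e₁ E L) {δ x₀ R : ℝ} (hδ : 0 < δ)
    (hx₀ : x₀ ≤ -δ) (hR : 0 ≤ R) (hB : ∀ x ∈ Icc x₀ (-δ),
      (1 - exp x ^ 2) * (a x + b x) - (1 + exp x ^ 2) * c x ≤ R) :
    6 * H x₀ + R ≤ (6 * H (-δ) + R) * exp (6 * √(-x₀) / √(2 / (1 - 2 * x₀))) := by
  choose D hD hDb using h.deriv_H
  set K := √(2 / (1 - 2 * x₀))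
  have hK : 0 < K := sqrt_pos.2 (div_pos two_pos (by linarith))
  have hexp : ∀ x ∈ Icc x₀ (-δ), HasDerivAt (fun x => exp (-6 * √(-x) / K))
      (exp (-6 * √(-x) / K) * (3 / (K * √(-x)))) x := by
    intro x hx
    have h0 : 0 < -x := by linarith [hx.2]
    have := ((((hasDerivAt_neg x).sqrt h0.ne').const_mul (-6)).div_const K).exp
    refine this.congr_deriv ?_
    have := sqrt_pos.2 h0
    field_simp
    norm_num
  have hmain := le_add_integral_of_neg_le_deriv hx₀
    (fun x hx => (((hD x).const_mul 6).add_const R).mul (hexp x hx))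
    (g := fun _ => 0) continuous_const fun x hx => by
      have h0 : 0 < -x := by linarith [hx.2]
      have hs := sqrt_pos.2 h0
      have hy1 : exp x < 1 := exp_lt_one_iff.2 (by linarith)
      have hy := exp_pos x
      have hz : 0 < 1 - exp x ^ 2 := by nlinarith
      have hKs : K * √(-x) ≤ √(1 - exp x ^ 2) := by
        rw [← sqrt_mul (div_pos two_pos (by linarith [hx.1])).le]
        refine sqrt_le_sqrt ?_
        have h1 : exp x ^ 2 * (1 - 2 * x) ≤ 1 := by
          have h2 : 1 - 2 * x ≤ exp (-(2 * x)) := by linarith [add_one_le_exp (-(2 * x))]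
          calc exp x ^ 2 * (1 - 2 * x) ≤ exp x ^ 2 * exp (-(2 * x)) := by gcongr
            _ = 1 := by rw [sq, ← exp_add, ← exp_add]; ring_nf; simp
        have h2 : 0 < 1 - 2 * x := by linarith
        have h3 : 2 / (1 - 2 * x₀) ≤ 2 / (1 - 2 * x) := by
          gcongr
          · linarith [hx.1]
        calc 2 / (1 - 2 * x₀) * -x ≤ 2 / (1 - 2 * x) * -x := by gcongr
          _ = 1 - 1 / (1 - 2 * x) := by field_simp; ring
          _ ≤ 1 - exp x ^ 2 := by
            have : exp x ^ 2 ≤ 1 / (1 - 2 * x) := (le_div_iff₀ h2).2 h1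
            linarith
      set w := √(1 - exp x ^ 2)
      have hw : 0 < w := sqrt_pos.2 hz
      have hw2 : w ^ 2 = 1 - exp x ^ 2 := sq_sqrt hz.le
      have hb : w ^ 2 * b x ≤ R + 4 * H x := by
        have := hB x hx
        have := h.c_le x; have := h.c_nonneg x; have := h.a_nonneg x
        rw [hw2]
        nlinarith
      have hDx := (abs_le.1 (hDb x (1 / w) (by positivity)).1).1
      have hbw : b x / (2 * (1 / w)) ≤ (R + 4 * H x) / (2 * w) := by
        rw [le_div_iff₀ (by positivity)]
        calc b x / (2 * (1 / w)) * (2 * w) = w ^ 2 * b x := by field_simp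
          _ ≤ _ := hb
      have hDx' : -(6 * H x + R) / (2 * w) ≤ D x := by
        have : -(6 * H x + R) / (2 * w) = -(1 / w * H x + (R + 4 * H x) / (2 * w)) := by
          field_simp; ring
        rw [this]; linarith
      have hG : 0 ≤ 6 * H x + R := by linarith [h.H_nonneg x]
      have h3 : (6 * H x + R) * (3 / w) ≤ (6 * H x + R) * (3 / (K * √(-x))) := by gcongr
      have h4 : 6 * (-(6 * H x + R) / (2 * w)) = -((6 * H x + R) * (3 / w)) := by
        field_simp; ring
      have h5 : 0 ≤ 6 * D x + (6 * H x + R) * (3 / (K * √(-x))) := by linarith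
      have := mul_nonneg h5 (exp_pos (-6 * √(-x) / K)).le
      linarith
  simp only [Pi.mul_apply, intervalIntegral.integral_zero, add_zero] at hmain
  have h1 : exp (-6 * √(- -δ) / K) ≤ 1 := exp_le_one_iff.2
    (div_nonpos_of_nonpos_of_nonneg (by linarith [sqrt_nonneg (- -δ)]) hK.le)
  have h2 : 0 ≤ 6 * H (-δ) + R := by linarith [h.H_nonneg (-δ)]
  have h3 : (6 * H x₀ + R) * exp (-6 * √(-x₀) / K) ≤ 6 * H (-δ) + R :=
    hmain.trans (mul_le_of_le_one_right h2 h1)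
  calc 6 * H x₀ + R = (6 * H x₀ + R) * exp (-6 * √(-x₀) / K) * exp (6 * √(-x₀) / K) := by
        rw [mul_assoc, ← exp_add]; ring_nf; simp
    _ ≤ _ := by gcongr

end SlabBounds

namespace SlabBounds

variable {a b c m H e₀ e₁ : ℝ → ℝ} {E L : ℝ}

lemma integral_kinetic_le (h : SlabBounds a b c m H e₀ e₁ E L) (hL : 0 ≤ L) {K N : ℝ} (hK : 1 ≤ K)
    (hN : 0 ≤ N) : 2 * (∫ x in (-2 * K - N)..(-2 * K), a x) * K ≤ 5 * (L * E) + 2 * E * K := by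
  have hE := h.E_nonneg
  have hca := h.cont_a; have hcb := h.cont_b; have hcc := h.cont_c
  have hpig : ∀ u, ∃ x ∈ Icc u (u + K), (a x + b x + c x) * K ≤ L * E := fun u => by
    obtain ⟨x, hx, hle⟩ := exists_mul_le_integral (g := fun x => a x + b x + c x) (by fun_prop)
      (show u ≤ u + K by linarith)
    refine ⟨x, hx, ?_⟩
    have := hle.trans (h.integral_le _ _ (by linarith))
    rwa [add_sub_cancel_left] at this
  obtain ⟨x', hx', hle'⟩ := hpig (-2 * K)
  obtain ⟨x₁, hx₁, hle₁⟩ := hpig (-2 * K - N - K)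
  rw [sub_add_cancel] at hx₁
  have hxx : x₁ ≤ x' := by linarith [hx'.1, hx₁.2]
  have hx'K : x' ≤ -K := by linarith [hx'.2]
  choose D hDb hD using h.deriv_momentum
  have hce₀ := h.cont_e₀; have hce₁ := h.cont_e₁
  have hexpK : exp (-K) * K ≤ 1 := by
    have := add_one_le_exp K
    calc exp (-K) * K ≤ exp (-K) * exp K := by gcongr; linarith
      _ = 1 := by rw [← exp_add]; simp
  have hmain := le_add_integral_of_neg_le_deriv hxx (fun x _ => hD x)
    (g := fun x => (e₁ x + e₀ x) + exp (-K) * (a x + b x + c x) - 2 * a x) (by fun_prop)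
    fun x hx => by
      have h1 : exp x ≤ exp (-K) := exp_le_exp.2 (hx.2.trans hx'K)
      have h2 : exp (-K) ≤ 1 := exp_le_one_iff.2 (by linarith)
      have h3 := (abs_le.1 (hDb x)).1
      have h4 := abs_le.1 (h.abs_two_mul_m_le x)
      have := h.e₀_nonneg x; have := h.e₁_nonneg x; have := h.a_nonneg x
      have := h.b_nonneg x; have := h.c_nonneg x
      have := exp_pos x
      have g1 : exp x * (e₁ x + e₀ x) ≤ 1 * (e₁ x + e₀ x) := by
        have : 0 ≤ e₁ x + e₀ x := by positivity
        gcongr; linarith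
      have g2 : exp x * (a x + b x) ≤ exp (-K) * (a x + b x + c x) := by
        have : 0 ≤ a x + b x := by positivity
        have : a x + b x ≤ a x + b x + c x := by linarith
        gcongr
      have g3 : exp x * (-(a x + b x)) ≤ exp x * (2 * m x) := by
        gcongr; exact h4.1
      linarith
  rw [intervalIntegral.integral_sub (Continuous.intervalIntegrable (by fun_prop) _ _)
    (Continuous.intervalIntegrable (by fun_prop) _ _),
    intervalIntegral.integral_add (Continuous.intervalIntegrable (by fun_prop) _ _)
    (Continuous.intervalIntegrable (by fun_prop) _ _),
    intervalIntegral.integral_add (Continuous.intervalIntegrable (by fun_prop) _ _)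
    (Continuous.intervalIntegrable (by fun_prop) _ _), intervalIntegral.integral_const_mul,
    intervalIntegral.integral_const_mul] at hmain
  have hKE : ∀ x, (a x + b x + c x) * K ≤ L * E → x ≤ 0 →
      |a x + b x - c x + 2 * exp x * m x| * K ≤ 2 * (L * E) := by
    intro x hx hx0
    have h1 : exp x ≤ 1 := exp_le_one_iff.2 hx0
    have h4 := abs_le.1 (h.abs_two_mul_m_le x)
    have h5 := h.a_nonneg x; have h6 := h.b_nonneg x; have h7 := h.c_nonneg x
    have := exp_pos x
    have : |a x + b x - c x + 2 * exp x * m x| ≤ 2 * (a x + b x + c x) := by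
      rw [abs_le]; constructor <;> nlinarith
    nlinarith
  have k1 := hKE x' hle' (by linarith)
  have k2 := hKE x₁ hle₁ (by linarith)
  have i0 : ∫ x in x₁..x', e₀ x ≤ E := h.integral_e₀_le x₁ x' hxx
  have i1 : ∫ x in x₁..x', e₁ x ≤ E := h.integral_e₁_le x₁ x' hxx
  have i2 : ∫ x in x₁..x', (a x + b x + c x) ≤ L * E := h.integral_le x₁ x' hxx
  have i3 : exp (-K) * (∫ x in x₁..x', (a x + b x + c x)) ≤ exp (-K) * (L * E) := by gcongr
  have hsub : ∫ x in (-2 * K - N)..(-2 * K), a x ≤ ∫ x in x₁..x', a x := by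
    refine intervalIntegral.integral_mono_interval hx₁.2 (by linarith) hx'.1 ?_
      (hca.intervalIntegrable _ _)
    exact Eventually.of_forall fun x => h.a_nonneg x
  have j1 := neg_abs_le (a x₁ + b x₁ - c x₁ + 2 * exp x₁ * m x₁)
  have j2 := le_abs_self (a x' + b x' - c x' + 2 * exp x' * m x')
  set T := ∫ x in x₁..x', a x
  have hT : (2 * T) * K ≤ 5 * (L * E) + 2 * E * K := by
    have hLE : 0 ≤ L * E := by positivity
    have : exp (-K) * (L * E) * K ≤ L * E := by nlinarith
    nlinarith
  refine le_trans ?_ hT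
  gcongr

end SlabBounds

namespace SelfSimilarWave

variable {U p q px ps qx qs : ℝ → ℝ → ℝ} {E : ℝ}

lemma slabBounds (h : SelfSimilarWave U p q px ps qx qs E) {L : ℝ} (hL : 0 ≤ L) :
    SlabBounds (fun x => ∫ s in (0 : ℝ)..L, p s x ^ 2) (fun x => ∫ s in (0 : ℝ)..L, q s x ^ 2)
      (fun x => ∫ s in (0 : ℝ)..L, sin (U s x) ^ 2) (fun x => ∫ s in (0 : ℝ)..L, p s x * q s x)
      (fun x => ∫ s in (0 : ℝ)..L, potW (U s x))
      (fun x => p 0 x ^ 2 + q 0 x ^ 2 + sin (U 0 x) ^ 2)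
      (fun x => p L x ^ 2 + q L x ^ 2 + sin (U L x) ^ 2) E L := by
  have hcU := h.cont_U; have hcp := h.cont_p; have hcq := h.cont_q
  have hW := h.cont_potW
  have hl : ∀ x : ℝ, Continuous fun s : ℝ => (s, x) := fun x => by fun_prop
  have hpx : ∀ x, Continuous fun s => p s x := fun x => hcp.comp (hl x)
  have hqx : ∀ x, Continuous fun s => q s x := fun x => hcq.comp (hl x)
  have hUx : ∀ x, Continuous fun s => U s x := fun x => hcU.comp (hl x)
  have hWx : ∀ x, Continuous fun s => potW (U s x) := fun x => hW.comp (hl x)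
  have hsumE : ∀ x, (∫ s in (0 : ℝ)..L, p s x ^ 2) + (∫ s in (0 : ℝ)..L, q s x ^ 2)
      + (∫ s in (0 : ℝ)..L, sin (U s x) ^ 2) =
      ∫ s in (0 : ℝ)..L, (p s x ^ 2 + q s x ^ 2 + sin (U s x) ^ 2) := fun x => by
    have := hpx x; have := hqx x; have := hUx x
    rw [intervalIntegral.integral_add, intervalIntegral.integral_add] <;>
      exact Continuous.intervalIntegrable (by fun_prop) _ _
  have hquad : ∀ τ x, (∫ s in (0 : ℝ)..L, p s x ^ 2)
      + 2 * τ * (∫ s in (0 : ℝ)..L, p s x * q s x) + τ ^ 2 * (∫ s in (0 : ℝ)..L, q s x ^ 2) =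
      ∫ s in (0 : ℝ)..L, (p s x + τ * q s x) ^ 2 := fun τ x => by
    have := hpx x; have := hqx x
    rw [← intervalIntegral.integral_const_mul, ← intervalIntegral.integral_const_mul,
      ← intervalIntegral.integral_add, ← intervalIntegral.integral_add]
    · congr 1; ext s; ring
    all_goals exact Continuous.intervalIntegrable (by fun_prop) _ _
  have hquad1 : ∀ x, (∫ s in (0 : ℝ)..L, p s x ^ 2) + (∫ s in (0 : ℝ)..L, q s x ^ 2)
      + 2 * (∫ s in (0 : ℝ)..L, p s x * q s x) = ∫ s in (0 : ℝ)..L, (p s x + q s x) ^ 2 :=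
    fun x => by have := hquad 1 x; simp only [one_mul, one_pow, mul_one] at this; linarith
  refine
    { cont_a := continuous_integral_param (g := fun s x => p s x ^ 2) (by fun_prop) 0 L
      cont_b := continuous_integral_param (g := fun s x => q s x ^ 2) (by fun_prop) 0 L
      cont_c := continuous_integral_param (g := fun s x => sin (U s x) ^ 2) (by fun_prop) 0 L
      cont_e₀ := h.cont_energy_slice 0
      cont_e₁ := h.cont_energy_slice L
      quad_nonneg := fun τ x => by
        rw [hquad]; exact intervalIntegral.integral_nonneg hL fun _ _ => sq_nonneg _
      b_nonneg := fun x => intervalIntegral.integral_nonneg hL fun _ _ => sq_nonneg _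
      c_nonneg := fun x => intervalIntegral.integral_nonneg hL fun _ _ => sq_nonneg _
      H_nonneg := fun x => intervalIntegral.integral_nonneg hL fun _ _ => potW_nonneg _
      e₀_nonneg := fun x => by positivity
      e₁_nonneg := fun x => by positivity
      c_le := fun x => ?_
      integral_le := fun u v huv => by
        simp only [hsumE]; exact h.integral_integral_energy_le hL huv
      integral_e₀_le := h.energy_le 0
      integral_e₁_le := h.energy_le L
      deriv_flux := fun x => ?_
      deriv_momentum := fun x => ?_
      deriv_outgoing := fun x => ?_
      deriv_H := fun x => ?_ }
  · rw [← intervalIntegral.integral_const_mul]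
    have := hUx x; have := hWx x
    exact intervalIntegral.integral_mono_on hL (Continuous.intervalIntegrable (by fun_prop) _ _)
      (Continuous.intervalIntegrable (by fun_prop) _ _) fun s _ => sq_sin_le_potW _
  · refine (h.hasDerivAt_flux L x).congr_of_eventuallyEq (Eventually.of_forall fun x => ?_)
    have := hpx x; have := hqx x; have := hUx x
    simp only [hsumE]
    rw [← intervalIntegral.integral_const_mul, ← intervalIntegral.integral_add] <;>
      exact Continuous.intervalIntegrable (by fun_prop) _ _
  · refine ⟨2 * exp x * (p L x * q L x) - 2 * exp x * (p 0 x * q 0 x), ?_, ?_⟩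
    · have h1 : ∀ s, |2 * (p s x * q s x)| ≤ p s x ^ 2 + q s x ^ 2 + sin (U s x) ^ 2 := fun s => by
        rw [abs_le]
        constructor <;> nlinarith [sq_nonneg (p s x - q s x), sq_nonneg (p s x + q s x),
          sq_nonneg (sin (U s x))]
      calc _ = exp x * |2 * (p L x * q L x) - 2 * (p 0 x * q 0 x)| := by
            rw [← abs_of_pos (exp_pos x), ← abs_mul, abs_of_pos (exp_pos x)]; ring_nf
        _ ≤ _ := by
            gcongr
            exact (abs_sub _ _).trans (add_le_add (h1 L) (h1 0))
    · refine ((h.hasDerivAt_momentum L x).congr_deriv ?_).congr_of_eventuallyEq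
        (Eventually.of_forall fun x => ?_)
      · have := hpx x; have := hqx x
        rw [add_assoc, ← intervalIntegral.integral_const_mul, ← intervalIntegral.integral_const_mul,
          ← intervalIntegral.integral_add]
        · congr 2; ext s; ring
        all_goals exact Continuous.intervalIntegrable (by fun_prop) _ _
      · have := hpx x; have := hqx x; have := hUx x
        simp only
        rw [← intervalIntegral.integral_const_mul, ← intervalIntegral.integral_add,
          ← intervalIntegral.integral_sub, ← intervalIntegral.integral_add] <;>
          exact Continuous.intervalIntegrable (by fun_prop) _ _
  · have := hpx x; have := hqx x; have := hUx x
    refine ⟨_, (h.hasDerivAt_outgoing L x).congr_of_eventuallyEq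
      (Eventually.of_forall fun x => hquad1 x), fun τ hτ => ?_⟩
    rw [hquad1, hsumE]
    have hy := exp_pos x
    have hk0 : 0 < exp x / (1 + exp x) := by positivity
    have hk1 : exp x / (1 + exp x) ≤ 1 := (div_le_one (by positivity)).2 (by linarith)
    have h1 : -(2 * (p 0 x ^ 2 + q 0 x ^ 2 + sin (U 0 x) ^ 2)) ≤
        exp x / (1 + exp x) * (p L x + q L x) ^ 2
          - exp x / (1 + exp x) * (p 0 x + q 0 x) ^ 2 := by
      have h2 : exp x / (1 + exp x) * (p 0 x + q 0 x) ^ 2 ≤ 1 * (p 0 x + q 0 x) ^ 2 := by gcongr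
      have h3 : 0 ≤ exp x / (1 + exp x) * (p L x + q L x) ^ 2 := by positivity
      nlinarith [sq_nonneg (p 0 x - q 0 x), sq_nonneg (sin (U 0 x))]
    have h2 : ∫ s in (0 : ℝ)..L, -(τ * (p s x + q s x) ^ 2
        + 2 / τ * (p s x ^ 2 + q s x ^ 2 + sin (U s x) ^ 2)) ≤
        ∫ s in (0 : ℝ)..L, 2 / (1 + exp x) *
          ((p s x + q s x) * (p s x + sin (U s x) * cos (U s x))) := by
      refine intervalIntegral.integral_mono_on hL (Continuous.intervalIntegrable (by fun_prop) _ _)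
        (Continuous.intervalIntegrable (by fun_prop) _ _) fun s _ => ?_
      set A := p s x + q s x
      set G := p s x + sin (U s x) * cos (U s x)
      have hG : G ^ 2 ≤ 2 * (p s x ^ 2 + q s x ^ 2 + sin (U s x) ^ 2) := by
        have : (sin (U s x) * cos (U s x)) ^ 2 ≤ sin (U s x) ^ 2 := by
          rw [mul_pow]
          exact mul_le_of_le_one_right (sq_nonneg _) (cos_sq_le_one _)
        nlinarith [sq_nonneg (p s x - sin (U s x) * cos (U s x)), sq_nonneg (q s x)]
      have h3 : 2 * |A * G| ≤ τ * A ^ 2 + 1 / τ * G ^ 2 := by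
        rw [abs_mul, ← sq_abs A, ← sq_abs G]
        have : τ * |A| ^ 2 + 1 / τ * |G| ^ 2 - 2 * (|A| * |G|) = 1 / τ * (τ * |A| - |G|) ^ 2 := by
          field_simp; ring
        have : 0 ≤ 1 / τ * (τ * |A| - |G|) ^ 2 := by positivity
        linarith
      have h4 : 1 / τ * G ^ 2 ≤ 2 / τ * (p s x ^ 2 + q s x ^ 2 + sin (U s x) ^ 2) := by
        calc 1 / τ * G ^ 2 ≤ 1 / τ * (2 * (p s x ^ 2 + q s x ^ 2 + sin (U s x) ^ 2)) := by gcongr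
          _ = _ := by ring
      have h5 : 2 / (1 + exp x) * |A * G| ≤ 2 * |A * G| := by
        gcongr
        exact div_le_self two_pos.le (by linarith)
      have h6 : -(2 / (1 + exp x) * |A * G|) ≤ 2 / (1 + exp x) * (A * G) := by
        rw [← mul_neg]
        gcongr
        exact neg_abs_le _
      linarith
    rw [intervalIntegral.integral_neg, intervalIntegral.integral_add
      (Continuous.intervalIntegrable (by fun_prop) _ _)
      (Continuous.intervalIntegrable (by fun_prop) _ _), intervalIntegral.integral_const_mul,
      intervalIntegral.integral_const_mul] at h2
    linarith
  · have hc := hpx x; have hc' := hqx x; have hc'' := hUx x; have hc₃ := hWx x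
    have hd := hasDerivAt_integral_param (g := fun s x => potW (U s x))
      (g' := fun s x => -sin (max (U s x) 0) * q s x) hW (by fun_prop)
      (fun s x => (hasDerivAt_potW (U s x)).comp x (h.deriv_Ux s x)) x 0 L
    have hbd : ∀ f : ℝ → ℝ, Continuous f → (∀ s, |-sin (max (U s x) 0) * q s x| ≤ f s) →
        |∫ s in (0 : ℝ)..L, -sin (max (U s x) 0) * q s x| ≤ ∫ s in (0 : ℝ)..L, f s :=
      fun f hf hle => (intervalIntegral.abs_integral_le_integral_abs hL).trans
        (intervalIntegral.integral_mono_on hL (Continuous.intervalIntegrable (by fun_prop) _ _)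
          (hf.intervalIntegrable _ _) fun s _ => hle s)
    have key : ∀ α, 0 < α → ∀ s,
        |-sin (max (U s x) 0) * q s x| ≤ α / 2 * sin (max (U s x) 0) ^ 2 + (2 * α)⁻¹ * q s x ^ 2 := by
      intro α hα s
      rw [abs_mul, abs_neg, ← sq_abs (sin _), ← sq_abs (q s x)]
      have : α / 2 * |sin (max (U s x) 0)| ^ 2 + (2 * α)⁻¹ * |q s x| ^ 2
          - |sin (max (U s x) 0)| * |q s x| =
          (2 * α)⁻¹ * (α * |sin (max (U s x) 0)| - |q s x|) ^ 2 := by field_simp; ring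
      have : 0 ≤ (2 * α)⁻¹ * (α * |sin (max (U s x) 0)| - |q s x|) ^ 2 := by positivity
      linarith
    refine ⟨_, hd, fun α hα => ⟨?_, ?_⟩⟩
    · have := hbd (fun s => α * potW (U s x) + (2 * α)⁻¹ * q s x ^ 2) (by fun_prop) fun s => by
        have := mul_le_mul_of_nonneg_left (sq_sin_max_le (U s x)) hα.le
        linarith [key α hα s]
      rw [intervalIntegral.integral_add (Continuous.intervalIntegrable (by fun_prop) _ _)
        (Continuous.intervalIntegrable (by fun_prop) _ _), intervalIntegral.integral_const_mul,
        intervalIntegral.integral_const_mul] at this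
      rw [div_eq_inv_mul]
      exact this
    · have := hbd (fun s => α / 2 + (2 * α)⁻¹ * q s x ^ 2) (by fun_prop) fun s => by
        have := mul_le_mul_of_nonneg_left (sin_sq_le_one (max (U s x) 0)) hα.le
        linarith [key α hα s]
      rw [intervalIntegral.integral_add (Continuous.intervalIntegrable (by fun_prop) _ _)
        (Continuous.intervalIntegrable (by fun_prop) _ _),
        intervalIntegral.integral_const_mul] at this
      simp only [intervalIntegral.integral_const, smul_eq_mul, sub_zero] at this
      refine this.trans (le_of_eq ?_)
      field_simp

/-- The averaged potential does not concentrate: it is `o(L)` at each fixed self-similar radius. -/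
theorem exists_integral_potW_le (h : SelfSimilarWave U p q px ps qx qs E) {x₀ ε : ℝ} (hx₀ : x₀ < 0)
    (hε : 0 < ε) : ∃ L₀, 0 < L₀ ∧ ∀ L, L₀ ≤ L → ∫ s in (0 : ℝ)..L, potW (U s x₀) ≤ ε * L := by
  have hE := h.energy_nonneg
  set K := exp (6 * √(-x₀) / √(2 / (1 - 2 * x₀)))
  have hK : 0 < K := exp_pos _
  obtain ⟨η, hη0, hη1, hηx, hηε⟩ : ∃ η, 0 < η ∧ η ≤ 1 / 2 ∧ η ≤ -x₀ ∧
      K * (6 * η + 15 * η * E) ≤ ε / 4 := by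
    have hpos : 0 < ε / 4 / (K * (6 + 15 * E)) := by positivity
    refine ⟨min (min (1 / 2) (-x₀)) (ε / 4 / (K * (6 + 15 * E))), by
      simp only [lt_min_iff]; exact ⟨⟨by norm_num, by linarith⟩, hpos⟩,
      (min_le_left _ _).trans (min_le_left _ _), (min_le_left _ _).trans (min_le_right _ _), ?_⟩
    have := min_le_right (min (1 / 2) (-x₀)) (ε / 4 / (K * (6 + 15 * E)))
    rw [le_div_iff₀ (by positivity)] at this
    linarith
  set δ := η ^ 2 with hδdef
  have hδ : 0 < δ := by positivity
  have hδη : δ ≤ η / 2 := by rw [hδdef]; nlinarith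
  obtain ⟨X, hX1, htail⟩ := h.exists_tail_le (ε := ε / (24 * K)) (by positivity)
  set d := √(1 - exp (-δ) ^ 2) with hd
  have hdη : η ≤ d := by
    rw [hd]
    refine le_sqrt_of_sq_le ?_
    have h1 : exp (-δ) ^ 2 * (1 + 2 * δ) ≤ 1 := by
      have h2 : 1 + 2 * δ ≤ exp (2 * δ) := by linarith [add_one_le_exp (2 * δ)]
      calc exp (-δ) ^ 2 * (1 + 2 * δ) ≤ exp (-δ) ^ 2 * exp (2 * δ) := by gcongr
        _ = 1 := by rw [sq, ← exp_add, ← exp_add]; ring_nf; simp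
    rw [← hδdef]
    have h3 : 0 < exp (-δ) ^ 2 := by positivity
    have : (1 - δ) * (1 + 2 * δ) ≥ 1 := by nlinarith
    by_contra! hcon
    nlinarith
  have hd0 : 0 < d := hη0.trans_le hdη
  set C := 2 * E / (1 - exp (-δ))
  set C₃ := 6 * ((X - δ) * C) + 28 * E / d + (4 * E - 6 * E * x₀) / d ^ 3
  refine ⟨2 * K * |C₃| / ε + 1, by positivity, fun L hL => ?_⟩
  have hL0 : 0 < L := lt_of_lt_of_le (by positivity) hL
  have hb := h.slabBounds hL0.le
  have hHδ := h.integral_potW_le hL0.le (δ := δ) (X := X) (by linarith) htail (C := C)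
    fun x hx => by
      rw [intervalIntegral.integral_add, intervalIntegral.integral_add]
      · exact hb.integral_energy_le hL0 hδ hx
      all_goals
        have h1 : Continuous fun s => p s x := h.cont_p.comp (by fun_prop : Continuous fun s : ℝ => (s, x))
        have h2 : Continuous fun s => q s x := h.cont_q.comp (by fun_prop : Continuous fun s : ℝ => (s, x))
        have h3 : Continuous fun s => U s x := h.cont_U.comp (by fun_prop : Continuous fun s : ℝ => (s, x))
        exact Continuous.intervalIntegrable (by fun_prop) _ _
  have hneg := hb.H_neg_le hδ (α := η⁻¹) (inv_pos.2 hη0)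
  have h1 : δ * η⁻¹ = η := by rw [hδdef]; field_simp
  have h2 : L * E / (2 * η⁻¹) = η * L * E / 2 := by field_simp
  rw [h1, h2] at hneg
  set R := (28 * E + 12 * δ * L * E) / d + (4 * E - 6 * E * x₀) / d ^ 3
  have hR : 0 ≤ R := by
    have : 0 ≤ 4 * E - 6 * E * x₀ := by nlinarith
    positivity
  have hRle : R ≤ 12 * η * L * E + 28 * E / d + (4 * E - 6 * E * x₀) / d ^ 3 := by
    have : 12 * δ * L * E / d ≤ 12 * η * L * E := by
      rw [div_le_iff₀ hd0]
      have : 12 * δ * L * E = 12 * η * L * E * η := by rw [hδdef]; ring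
      rw [this]; gcongr
    simp only [R, add_div]
    linarith
  have hmain := hb.H_le_of_anisotropy_le hδ (x₀ := x₀) (R := R) (by linarith) hR fun x hx => by
    refine (hb.anisotropy_le hL0 hδ hx.2).trans ?_
    simp only [R]
    gcongr
    nlinarith [hx.1]
  change _ ≤ _ * K at hmain
  have hτ : 6 * (L * (ε / (24 * K))) * K = ε / 4 * L := by field_simp; norm_num
  have hC : K * C₃ ≤ ε / 2 * L := by
    have : K * |C₃| ≤ ε / 2 * L := by
      have : 2 * K * |C₃| / ε ≤ L := by linarith
      rw [div_le_iff₀ hε] at this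
      linarith
    exact (mul_le_mul_of_nonneg_left (le_abs_self _) hK.le).trans this
  have hsum : 6 * (∫ s in (0 : ℝ)..L, potW (U s (-δ))) + R ≤
      6 * (L * (ε / (24 * K))) + (6 * η + 15 * η * E) * L + C₃ := by
    simp only [C₃]
    linarith
  have hfin : (6 * (∫ s in (0 : ℝ)..L, potW (U s (-δ))) + R) * K ≤ ε * L := by
    calc _ ≤ (6 * (L * (ε / (24 * K))) + (6 * η + 15 * η * E) * L + C₃) * K := by
          gcongr
      _ = ε / 4 * L + K * (6 * η + 15 * η * E) * L + K * C₃ := by rw [add_mul, add_mul, hτ]; ring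
      _ ≤ ε / 4 * L + ε / 4 * L + ε / 2 * L := by gcongr
      _ = ε * L := by ring
  have := hb.H_nonneg x₀
  linarith

/-- The averaged kinetic energy well inside the light cone is `o(L)`. -/
theorem exists_integral_kinetic_le (h : SelfSimilarWave U p q px ps qx qs E) {ε : ℝ} (hε : 0 < ε) :
    ∃ x₂ < 0, ∃ L₀, 0 < L₀ ∧ ∀ L, L₀ ≤ L → ∀ N, 0 ≤ N →
      ∫ s in (0 : ℝ)..L, ∫ x in (x₂ - N)..x₂, p s x ^ 2 ≤ ε * L := by
  have hE := h.energy_nonneg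
  set K := 8 * E / ε + 4
  have hK : 1 ≤ K := by
    have : 0 ≤ 8 * E / ε := by positivity
    linarith
  refine ⟨-2 * K, by linarith, 2 * E / ε + 1, by positivity, fun L hL N hN => ?_⟩
  have hL0 : 0 < L := lt_of_lt_of_le (by positivity) hL
  have hT := (h.slabBounds hL0.le).integral_kinetic_le hL0.le hK hN
  rw [integral_swap_of_continuous (g := fun s x => p s x ^ 2)
    (by have := h.cont_p; fun_prop) (by linarith) hL0.le] at hT
  set T := ∫ s in (0 : ℝ)..L, ∫ x in (-2 * K - N)..(-2 * K), p s x ^ 2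
  have hK' : 8 * E ≤ K * ε := by
    simp only [K, add_mul, div_mul_cancel₀ _ hε.ne']; linarith
  have hL' : 2 * E ≤ ε * L := by
    have : 2 * E / ε ≤ L := by linarith
    rwa [div_le_iff₀ hε, mul_comm L ε] at this
  have h8 : 8 * (L * E) ≤ ε * L * K := by nlinarith
  have h5 : 2 * E * K ≤ ε * L * K := by gcongr
  have : (2 * T) * K ≤ (2 * (ε * L)) * K := by
    have : 0 ≤ ε * L * K := by positivity
    linarith
  have := le_of_mul_le_mul_right this (by linarith)
  linarith

end SelfSimilarWave

section Selection

/-- If every point of `[a, b]` starts a short interval on which the average of `f ≥ 0` is at least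
`c`, then the integral of `f` over a slightly larger interval is at least `c (b - a)`. -/
lemma mul_sub_le_integral_of_forall_exists {f : ℝ → ℝ} (hf : Continuous f) (hf0 : ∀ s, 0 ≤ f s)
    {a b c : ℝ} (hc : 0 ≤ c) (hab : a ≤ b)
    (h : ∀ s ∈ Icc a b, ∃ η, 0 < η ∧ η ≤ 1 ∧ c * η ≤ ∫ σ in s..(s + η), f σ) :
    c * (b - a) ≤ ∫ σ in a..(b + 1), f σ := by
  have hint : ∀ u v, IntervalIntegrable f volume u v := fun u v => hf.intervalIntegrable u v
  set S := {t ∈ Icc a (b + 1) | c * (t - a) ≤ ∫ σ in a..t, f σ}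
  have hcont : Continuous fun t => ∫ σ in a..t, f σ := intervalIntegral.continuous_primitive hint a
  have hS : IsCompact S := isCompact_Icc.inter_right (isClosed_le (by fun_prop) hcont)
  have hne : S.Nonempty := ⟨a, ⟨le_rfl, by linarith⟩, by simp⟩
  obtain ⟨⟨ht1, ht2⟩, ht⟩ := hS.sSup_mem hne
  set t := sSup S
  have hbt : b < t := by
    by_contra! hle
    obtain ⟨η, hη0, hη1, hη⟩ := h t ⟨ht1, hle⟩
    have hmem : t + η ∈ S := by
      refine ⟨⟨by linarith, by linarith⟩, ?_⟩
      rw [← intervalIntegral.integral_add_adjacent_intervals (hint a t) (hint t (t + η))]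
      linarith
    linarith [le_csSup hS.bddAbove hmem]
  calc c * (b - a) ≤ c * (t - a) := by gcongr
    _ ≤ ∫ σ in a..t, f σ := ht
    _ ≤ ∫ σ in a..(b + 1), f σ := intervalIntegral.integral_mono_interval le_rfl ht1 ht2
        (Eventually.of_forall hf0) (hint _ _)

lemma continuous_integral_add {f : ℝ → ℝ} (hf : Continuous f) (η : ℝ) :
    Continuous fun s => ∫ σ in s..(s + η), f σ := by
  have h1 := intervalIntegral.continuous_primitive (fun u v => hf.intervalIntegrable (μ := volume) u v) 0
  have h2 : (fun s => ∫ σ in s..(s + η), f σ) =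
      fun s => (∫ σ in (0 : ℝ)..(s + η), f σ) - ∫ σ in (0 : ℝ)..s, f σ := by
    ext s
    rw [intervalIntegral.integral_interval_sub_left] <;> exact hf.intervalIntegrable _ _
  rw [h2]
  exact (h1.comp (continuous_add_const η)).sub h1

lemma le_of_forall_integral_le {f : ℝ → ℝ} (hf : Continuous f) {s c : ℝ}
    (h : ∀ η ∈ Icc (0 : ℝ) 1, ∫ σ in s..(s + η), f σ ≤ c * η) : f s ≤ c := by
  by_contra! hlt
  obtain ⟨δ, hδ, hball⟩ := Metric.eventually_nhds_iff.1 ((hf.continuousAt (x := s)).eventually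
    (lt_mem_nhds hlt))
  have hη : 0 < min (δ / 2) 1 := lt_min (by linarith) one_pos
  obtain ⟨x, hx, hle⟩ := exists_mul_le_integral hf (le_add_of_nonneg_right (a := s) hη.le)
  have h1 := hle.trans (h _ ⟨hη.le, min_le_right _ _⟩)
  rw [add_sub_cancel_left] at h1
  have h2 : c < f x := hball (by
    rw [Real.dist_eq, abs_of_nonneg (by linarith [hx.1])]
    linarith [hx.2, min_le_left (δ / 2) 1])
  linarith [le_of_mul_le_mul_right h1 hη]

/-- A simultaneous maximal function bound for an increasing sequence of functions. -/
lemma exists_forall_integral_le {f : ℕ → ℝ → ℝ} (hf : ∀ n, Continuous (f n))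
    (hf0 : ∀ n s, 0 ≤ f n s) (hmono : ∀ n s, f n s ≤ f (n + 1) s) {a b c : ℝ} (hc : 0 ≤ c)
    (hab : a ≤ b) (h : ∀ n, ∫ σ in a..(b + 1), f n σ < c * (b - a)) :
    ∃ s ∈ Icc a b, ∀ n, ∀ η ∈ Icc (0 : ℝ) 1, ∫ σ in s..(s + η), f n σ ≤ c * η := by
  set S : ℕ → Set ℝ := fun n =>
    Icc a b ∩ {s | ∀ η ∈ Icc (0 : ℝ) 1, ∫ σ in s..(s + η), f n σ ≤ c * η}
  have hcl : ∀ n, IsCompact (S n) := fun n => isCompact_Icc.inter_right (by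
    simp only [Set.ofPred_forall]
    exact isClosed_iInter fun η => isClosed_iInter fun _ =>
      isClosed_le (continuous_integral_add (hf n) η) continuous_const)
  obtain ⟨s, hs⟩ := IsCompact.nonempty_iInter_of_sequence_nonempty_isCompact_isClosed S
    (fun n s hs => ⟨hs.1, fun η hη => (intervalIntegral.integral_mono_on (by linarith [hη.1])
      ((hf n).intervalIntegrable _ _) ((hf (n + 1)).intervalIntegrable _ _)
      fun σ _ => hmono n σ).trans (hs.2 η hη)⟩)
    (fun n => by
      by_contra hne
      refine (h n).not_ge (mul_sub_le_integral_of_forall_exists (hf n) (hf0 n) hc hab fun s hs => ?_)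
      have : ¬ ∀ η ∈ Icc (0 : ℝ) 1, ∫ σ in s..(s + η), f n σ ≤ c * η := fun hcon => hne ⟨s, hs, hcon⟩
      push Not at this
      obtain ⟨η, hη, hlt⟩ := this
      refine ⟨η, lt_of_le_of_ne hη.1 ?_, hη.2, hlt.le⟩
      rintro rfl
      simp at hlt)
    (hcl 0) (fun n => (hcl n).isClosed)
  rw [mem_iInter] at hs
  exact ⟨s, (hs 0).1, fun n => (hs n).2⟩

end Selection

namespace SelfSimilarWave

variable {U p q px ps qx qs : ℝ → ℝ → ℝ} {E : ℝ}

/-- Existence of arbitrarily late times at which the solution reaches the neighbourhood of `π` well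
inside the light cone, while its kinetic energy inside is small on all subsequent scales. -/
theorem exists_good_time (h : SelfSimilarWave U p q px ps qx qs E) {c : ℝ} (hc : 0 < c) :
    ∃ x₂ < 0, ∀ x₃ < 0, ∀ T, ∃ s, T ≤ s ∧ potW (U s x₃) ≤ c ∧ ∀ N, 0 ≤ N → ∀ η ∈ Icc (0 : ℝ) 1,
      ∫ σ in s..(s + η), ∫ x in (x₂ - N)..x₂, p σ x ^ 2 ≤ c * η := by
  obtain ⟨x₂, hx₂, L₁, hL₁, hkin⟩ := h.exists_integral_kinetic_le (ε := c / 16) (by positivity)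
  refine ⟨x₂, hx₂, fun x₃ hx₃ T => ?_⟩
  obtain ⟨L₂, hL₂, hpot⟩ := h.exists_integral_potW_le (ε := c / 16) hx₃ (by positivity)
  obtain ⟨L, hLT, hL4, hLL₁, hLL₂⟩ : ∃ L, 2 * T ≤ L ∧ 4 ≤ L ∧ L₁ ≤ L ∧ L₂ ≤ L :=
    ⟨max (max (2 * T) 4) (max L₁ L₂), by simp, by simp, by simp, by simp⟩
  have hcp := h.cont_p
  have hpc : ∀ N : ℝ, Continuous fun σ => ∫ x in (x₂ - N)..x₂, p σ x ^ 2 := fun N =>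
    continuous_integral_param (g := fun x σ => p σ x ^ 2)
      ((hcp.comp continuous_swap).pow 2) (x₂ - N) x₂
  have hpint : ∀ σ u v, IntervalIntegrable (fun x => p σ x ^ 2) volume u v := fun σ u v => by
    have := continuous_slice hcp σ
    exact Continuous.intervalIntegrable (by fun_prop) _ _
  have hpmono : ∀ σ N N', N ≤ N' → 0 ≤ N →
      ∫ x in (x₂ - N)..x₂, p σ x ^ 2 ≤ ∫ x in (x₂ - N')..x₂, p σ x ^ 2 := fun σ N N' hN hN0 =>
    intervalIntegral.integral_mono_interval (by linarith) (by linarith) le_rfl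
      (Eventually.of_forall fun x => sq_nonneg _) (hpint σ _ _)
  have hp0 : ∀ σ N, 0 ≤ N → 0 ≤ ∫ x in (x₂ - N)..x₂, p σ x ^ 2 := fun σ N hN =>
    intervalIntegral.integral_nonneg (by linarith) fun x _ => sq_nonneg _
  have hwc : Continuous fun σ => potW (U σ x₃) :=
    h.cont_potW.comp (by fun_prop : Continuous fun s : ℝ => (s, x₃))
  obtain ⟨s, hs, hsmall⟩ := exists_forall_integral_le
    (f := fun n σ => (∫ x in (x₂ - (n : ℝ))..x₂, p σ x ^ 2) + potW (U σ x₃))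
    (fun n => (hpc n).add hwc) (fun n σ => add_nonneg (hp0 σ n n.cast_nonneg) (potW_nonneg _))
    (fun n σ => add_le_add_left (hpmono σ n (n + 1 : ℕ) (by simp) n.cast_nonneg) _)
    hc.le (show L / 2 ≤ L - 1 by linarith) fun n => by
      rw [sub_add_cancel]
      calc _ ≤ ∫ σ in (0 : ℝ)..L, ((∫ x in (x₂ - (n : ℝ))..x₂, p σ x ^ 2) + potW (U σ x₃)) :=
            intervalIntegral.integral_mono_interval (by linarith) (by linarith) le_rfl
              (Eventually.of_forall fun σ =>
                add_nonneg (hp0 σ n n.cast_nonneg) (potW_nonneg _))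
              (((hpc n).add hwc).intervalIntegrable _ _)
        _ = (∫ σ in (0 : ℝ)..L, ∫ x in (x₂ - (n : ℝ))..x₂, p σ x ^ 2)
            + ∫ σ in (0 : ℝ)..L, potW (U σ x₃) :=
            intervalIntegral.integral_add ((hpc n).intervalIntegrable _ _)
              (hwc.intervalIntegrable _ _)
        _ ≤ c / 16 * L + c / 16 * L := add_le_add (hkin L hLL₁ n n.cast_nonneg) (hpot L hLL₂)
        _ < c * (L - 1 - L / 2) := by nlinarith
  refine ⟨s, by linarith [hs.1], le_of_forall_integral_le hwc fun η hη => ?_, fun N hN η hη => ?_⟩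
  · refine (intervalIntegral.integral_mono_on (by linarith [hη.1]) (hwc.intervalIntegrable _ _)
      (((hpc (0 : ℕ)).add hwc).intervalIntegrable _ _) fun σ _ => ?_).trans (hsmall 0 η hη)
    simp
  · obtain ⟨n, hn⟩ := exists_nat_ge N
    refine (intervalIntegral.integral_mono_on (by linarith [hη.1]) ((hpc N).intervalIntegrable _ _)
      (((hpc n).add hwc).intervalIntegrable _ _) fun σ _ => ?_).trans (hsmall n η hη)
    exact (hpmono σ N n hn hN).trans (le_add_of_nonneg_right (potW_nonneg _))

end SelfSimilarWave

section SmoothInterior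

/-- Smoothness of a function of `(t, r)` on the open quadrant `t > 0`, `r > 0`. -/
def SmoothInterior (f : ℝ → ℝ → ℝ) : Prop :=
  ContDiffOn ℝ (⊤ : ℕ∞) (fun p : ℝ × ℝ => f p.1 p.2) (Ioi (0 : ℝ) ×ˢ Ioi (0 : ℝ))

lemma isOpen_quadrant : IsOpen (Ioi (0 : ℝ) ×ˢ Ioi (0 : ℝ)) := isOpen_Ioi.prod isOpen_Ioi

namespace SmoothInterior

variable {f : ℝ → ℝ → ℝ}

lemma contDiffAt (hf : SmoothInterior f) {p : ℝ × ℝ} (hp : p ∈ Ioi (0 : ℝ) ×ˢ Ioi (0 : ℝ)) :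
    ContDiffAt ℝ (⊤ : ℕ∞) (fun p : ℝ × ℝ => f p.1 p.2) p :=
  ContDiffOn.contDiffAt hf (isOpen_quadrant.mem_nhds hp)

lemma hasFDerivAt (hf : SmoothInterior f) {p : ℝ × ℝ} (hp : p ∈ Ioi (0 : ℝ) ×ˢ Ioi (0 : ℝ)) :
    HasFDerivAt (fun p : ℝ × ℝ => f p.1 p.2) (fderiv ℝ (fun p : ℝ × ℝ => f p.1 p.2) p) p :=
  ((hf.contDiffAt hp).differentiableAt (by simp)).hasFDerivAt

lemma pT_eq (hf : SmoothInterior f) {p : ℝ × ℝ} (hp : p ∈ Ioi (0 : ℝ) ×ˢ Ioi (0 : ℝ)) :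
    pT f p.1 p.2 = fderiv ℝ (fun p : ℝ × ℝ => f p.1 p.2) p (1, 0) :=
  ((hf.hasFDerivAt hp).comp_hasDerivAt (f := fun s => (s, p.2)) p.1
    ((hasDerivAt_id p.1).prodMk (hasDerivAt_const p.1 p.2))).deriv

lemma pR_eq (hf : SmoothInterior f) {p : ℝ × ℝ} (hp : p ∈ Ioi (0 : ℝ) ×ˢ Ioi (0 : ℝ)) :
    pR f p.1 p.2 = fderiv ℝ (fun p : ℝ × ℝ => f p.1 p.2) p (0, 1) :=
  ((hf.hasFDerivAt hp).comp_hasDerivAt (f := fun s => (p.1, s)) p.2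
    ((hasDerivAt_const p.2 p.1).prodMk (hasDerivAt_id p.2))).deriv

/-- The chain rule along a curve in the open quadrant. -/
lemma hasDerivAt_comp (hf : SmoothInterior f) {a b : ℝ → ℝ} {a' b' s : ℝ}
    (ha : HasDerivAt a a' s) (hb : HasDerivAt b b' s) (ha0 : 0 < a s) (hb0 : 0 < b s) :
    HasDerivAt (fun s => f (a s) (b s))
      (a' * pT f (a s) (b s) + b' * pR f (a s) (b s)) s := by
  have hp : (a s, b s) ∈ Ioi (0 : ℝ) ×ˢ Ioi (0 : ℝ) := ⟨ha0, hb0⟩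
  have h := (hf.hasFDerivAt hp).comp_hasDerivAt s (ha.prodMk hb)
  have hv : ((a', b') : ℝ × ℝ) = a' • ((1, 0) : ℝ × ℝ) + b' • ((0, 1) : ℝ × ℝ) := by simp
  rw [hv, map_add, map_smul, map_smul, ← hf.pT_eq hp, ← hf.pR_eq hp] at h
  exact h

lemma continuous_comp (hf : SmoothInterior f) {X : Type*} [TopologicalSpace X] {a b : X → ℝ}
    (ha : Continuous a) (hb : Continuous b) (ha0 : ∀ x, 0 < a x) (hb0 : ∀ x, 0 < b x) :
    Continuous fun x => f (a x) (b x) :=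
  hf.continuousOn.comp_continuous (ha.prodMk hb) fun x => ⟨ha0 x, hb0 x⟩

lemma contDiffOn_fderiv_apply (hf : SmoothInterior f) (v : ℝ × ℝ) :
    ContDiffOn ℝ (⊤ : ℕ∞) (fun p => fderiv ℝ (fun p : ℝ × ℝ => f p.1 p.2) p v)
      (Ioi (0 : ℝ) ×ˢ Ioi (0 : ℝ)) :=
  (hf.fderiv_of_isOpen isOpen_quadrant (by simp)).clm_apply contDiffOn_const

lemma time_deriv (hf : SmoothInterior f) : SmoothInterior (pT f) :=
  (hf.contDiffOn_fderiv_apply (1, 0)).congr fun _ hp => hf.pT_eq hp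

lemma radial_deriv (hf : SmoothInterior f) : SmoothInterior (pR f) :=
  (hf.contDiffOn_fderiv_apply (0, 1)).congr fun _ hp => hf.pR_eq hp

lemma pT_pR_eq (hf : SmoothInterior f) {t r : ℝ} (ht : 0 < t) (hr : 0 < r) :
    pT (pR f) t r = pR (pT f) t r := by
  have hp : (t, r) ∈ Ioi (0 : ℝ) ×ˢ Ioi (0 : ℝ) := ⟨ht, hr⟩
  have hd : DifferentiableAt ℝ (fderiv ℝ fun p : ℝ × ℝ => f p.1 p.2) (t, r) :=
    ((hf.fderiv_of_isOpen isOpen_quadrant (m := (⊤ : ℕ∞)) (by simp)).contDiffAt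
      (isOpen_quadrant.mem_nhds hp)).differentiableAt (by simp)
  have h1 := hf.radial_deriv.pT_eq hp
  have h2 := hf.time_deriv.pR_eq hp
  have key : ∀ {g : ℝ → ℝ → ℝ} (v w : ℝ × ℝ), (∀ p ∈ Ioi (0 : ℝ) ×ˢ Ioi (0 : ℝ),
      g p.1 p.2 = fderiv ℝ (fun p : ℝ × ℝ => f p.1 p.2) p v) →
      fderiv ℝ (fun p : ℝ × ℝ => g p.1 p.2) (t, r) w =
        fderiv ℝ (fderiv ℝ fun p : ℝ × ℝ => f p.1 p.2) (t, r) w v := by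
    intro g v w hg
    have he : (fun p : ℝ × ℝ => g p.1 p.2) =ᶠ[nhds (t, r)]
        fun p => fderiv ℝ (fun p : ℝ × ℝ => f p.1 p.2) p v := by
      filter_upwards [isOpen_quadrant.mem_nhds hp] with p hp using hg p hp
    rw [he.fderiv_eq, fderiv_clm_apply hd (by fun_prop)]
    simp
  simp only at h1 h2
  rw [h1, h2, key (0, 1) (1, 0) fun p hp => hf.pR_eq hp, key (1, 0) (0, 1) fun p hp => hf.pT_eq hp]
  exact (((hf.contDiffAt hp).isSymmSndFDerivAt
    (by rw [minSmoothness_of_isRCLikeNormedField]; exact WithTop.coe_le_coe.2 (le_top (a := (2 : ℕ∞))))).eq _ _)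

end SmoothInterior

end SmoothInterior

namespace IsWaveMap

variable {ψ : ℝ → ℝ → ℝ}

lemma smoothInterior (hψ : IsWaveMap ψ) : SmoothInterior ψ :=
  hψ.1.mono (prod_mono Ioi_subset_Ici_self le_rfl)

lemma radial_equation (hψ : IsWaveMap ψ) {t r : ℝ} (ht : 0 ≤ t) (hr : 0 < r) :
    r ^ 2 * pT (pT ψ) t r =
      r ^ 2 * pR (pR ψ) t r + r * pR ψ t r - sin (ψ t r) * cos (ψ t r) := by
  have h := hψ.2 t r ht hr
  change pT (pT ψ) t r - pR (pR ψ) t r - _ + _ = 0 at h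
  have h2 : pT (pT ψ) t r = pR (pR ψ) t r + 1 / r * pR ψ t r - sin (2 * ψ t r) / (2 * r ^ 2) := by
    linarith
  rw [h2, sin_two_mul]
  field_simp

end IsWaveMap

lemma eDen_nonneg {ψ : ℝ → ℝ → ℝ} {t r : ℝ} (hr : 0 ≤ r) : 0 ≤ eDen ψ t r := by
  unfold eDen; positivity

/-- The energy in the logarithmic radial variable. -/
lemma integral_log_energy_le {ψ : ℝ → ℝ → ℝ} (hψ : SmoothInterior ψ) (hfe : FiniteEnergy ψ)
    (hcons : EnergyConserved ψ) {t : ℝ} (ht : 0 < t) (c : ℝ) {a b : ℝ} (hab : a ≤ b) :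
    ∫ x in a..b, ((exp (c + x) * pT ψ t (exp (c + x))) ^ 2
      + (exp (c + x) * pR ψ t (exp (c + x))) ^ 2 + sin (ψ t (exp (c + x))) ^ 2) ≤ totE ψ 0 := by
  have h1 : ∀ x, (exp (c + x) * pT ψ t (exp (c + x))) ^ 2
      + (exp (c + x) * pR ψ t (exp (c + x))) ^ 2 + sin (ψ t (exp (c + x))) ^ 2 =
      (eDen ψ t ∘ fun x => exp (c + x)) x * exp (c + x) := fun x => by
    have := (exp_pos (c + x)).ne'
    simp only [Function.comp, eDen]
    field_simp
  have hcont : ContinuousOn (eDen ψ t) (Ioi 0) := by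
    have hm : MapsTo (fun r : ℝ => (t, r)) (Ioi 0) (Ioi (0 : ℝ) ×ˢ Ioi (0 : ℝ)) :=
      fun r hr => ⟨ht, hr⟩
    have hs : ∀ {f}, SmoothInterior f → ContinuousOn (f t) (Ioi 0) := fun hf =>
      hf.continuousOn.comp (by fun_prop : Continuous fun r : ℝ => (t, r)).continuousOn hm
    have h2 : ContinuousOn (fun r => sin (ψ t r)) (Ioi 0) := continuous_sin.comp_continuousOn (hs hψ)
    have h3 := hs hψ.time_deriv
    have h4 := hs hψ.radial_deriv
    refine ((((h3.pow 2).add (h4.pow 2)).add (ContinuousOn.div (h2.pow 2) (by fun_prop)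
      fun r hr => ?_))).mul continuousOn_id
    exact pow_ne_zero 2 (ne_of_gt hr)
  simp only [h1]
  have hle : exp (c + a) ≤ exp (c + b) := exp_le_exp.2 (by linarith)
  rw [intervalIntegral.integral_comp_mul_deriv' (f := fun x => exp (c + x))
    (fun x _ => by simpa using ((hasDerivAt_id x).const_add c).exp) (by fun_prop)
    (hcont.mono (by rintro _ ⟨x, -, rfl⟩; exact exp_pos _)),
    intervalIntegral.integral_of_le hle, ← hcons t ht.le, totE]
  exact setIntegral_mono_set (hfe t ht.le)
    ((ae_restrict_iff' measurableSet_Ioi).2 (.of_forall fun r hr => eDen_nonneg (le_of_lt hr)))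
    (.of_forall fun r hr => (exp_pos _).trans hr.1)

/-- A finite energy wave map in self-similar logarithmic coordinates. -/
theorem IsWaveMap.selfSimilarWave {ψ : ℝ → ℝ → ℝ} (hψ : IsWaveMap ψ) (hfe : FiniteEnergy ψ)
    (hcons : EnergyConserved ψ) (hbc : DegreeOneBC ψ) :
    SelfSimilarWave (fun s x => ψ (exp s) (exp (s + x)))
      (fun s x => exp (s + x) * pT ψ (exp s) (exp (s + x)))
      (fun s x => exp (s + x) * pR ψ (exp s) (exp (s + x)))
      (fun s x => exp (s + x) * pT ψ (exp s) (exp (s + x))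
        + exp (s + x) * (exp (s + x) * pR (pT ψ) (exp s) (exp (s + x))))
      (fun s x => exp (s + x) * pT ψ (exp s) (exp (s + x))
        + exp (s + x) * (exp s * pT (pT ψ) (exp s) (exp (s + x))
          + exp (s + x) * pR (pT ψ) (exp s) (exp (s + x))))
      (fun s x => exp (s + x) * pR ψ (exp s) (exp (s + x))
        + exp (s + x) * (exp (s + x) * pR (pR ψ) (exp s) (exp (s + x))))
      (fun s x => exp (s + x) * pR ψ (exp s) (exp (s + x))
        + exp (s + x) * (exp s * pT (pR ψ) (exp s) (exp (s + x))
          + exp (s + x) * pR (pR ψ) (exp s) (exp (s + x))))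
      (totE ψ 0) := by
  have hs := hψ.smoothInterior
  have hc : ∀ {f}, SmoothInterior f →
      Continuous fun z : ℝ × ℝ => f (exp z.1) (exp (z.1 + z.2)) := fun hf =>
    hf.continuous_comp (by fun_prop) (by fun_prop) (fun _ => exp_pos _) fun _ => exp_pos _
  have hes : ∀ s x : ℝ, HasDerivAt (fun s => exp (s + x)) (exp (s + x)) s := fun s x => by
    simpa using ((hasDerivAt_id s).add_const x).exp
  have hex : ∀ s x : ℝ, HasDerivAt (fun x => exp (s + x)) (exp (s + x)) x := fun s x => by
    simpa using ((hasDerivAt_id x).const_add s).exp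
  have hds : ∀ {f}, SmoothInterior f → ∀ s x, HasDerivAt (fun s => f (exp s) (exp (s + x)))
      (exp s * pT f (exp s) (exp (s + x)) + exp (s + x) * pR f (exp s) (exp (s + x))) s :=
    fun hf s x => hf.hasDerivAt_comp (hasDerivAt_exp s)
      (hes s x) (exp_pos _) (exp_pos _)
  have hdx : ∀ {f}, SmoothInterior f → ∀ s x, HasDerivAt (fun x => f (exp s) (exp (s + x)))
      (exp (s + x) * pR f (exp s) (exp (s + x))) x :=
    fun hf s x => by
      simpa using hf.hasDerivAt_comp (hasDerivAt_const x (exp s)) (hex s x) (exp_pos _) (exp_pos _)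
  have hmul : ∀ s x : ℝ, exp (-x) * exp (s + x) = exp s := fun s x => by
    rw [← exp_add]; congr 1; ring
  have h1 := hc hs
  have h2 := hc hs.time_deriv
  have h3 := hc hs.radial_deriv
  have h4 := hc hs.time_deriv.time_deriv
  have h5 := hc hs.time_deriv.radial_deriv
  have h6 := hc hs.radial_deriv.time_deriv
  have h7 := hc hs.radial_deriv.radial_deriv
  refine ⟨h1, by fun_prop, by fun_prop, by fun_prop, by fun_prop, by fun_prop, by fun_prop,
    fun s x => ?_, hdx hs, fun s x => (hes s x).fun_mul (hds hs.time_deriv s x),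
    fun s x => (hex s x).fun_mul (hdx hs.time_deriv s x),
    fun s x => (hes s x).fun_mul (hds hs.radial_deriv s x),
    fun s x => (hex s x).fun_mul (hdx hs.radial_deriv s x), fun s x => ?_, fun s x => ?_,
    fun s a b hab => integral_log_energy_le hs hfe hcons (exp_pos s) s hab, fun s => ?_⟩
  · rw [← mul_assoc, hmul]
    exact hds hs s x
  · have h := hψ.radial_equation (exp_pos s).le (exp_pos (s + x))
    have h' := hmul s x
    linear_combination exp (-x) * h - exp (s + x) * pT (pT ψ) (exp s) (exp (s + x)) * h'
  · have h := hs.pT_pR_eq (exp_pos s) (exp_pos (s + x))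
    have h' := hmul s x
    rw [h]
    linear_combination (- exp (s + x) * pR (pT ψ) (exp s) (exp (s + x))) * h'
  · exact (hbc _ (exp_pos s).le).2.comp (tendsto_exp_atTop.comp (tendsto_atTop_add_const_left _ s tendsto_id))

/-- A finite energy wave map on a time interval `[0, T]` in coordinates adapted to a concentration
scale: `v = ψ`, `P = r ∂ₜψ`, `R = r ∂ᵣψ` as functions of rescaled time and logarithmic rescaled
radius, together with the partial derivatives of `P` and `R`. Time derivatives are required only
at positive times. -/
structure CylinderWave (v P R Pt Px Rt Rx : ℝ → ℝ → ℝ) (E : ℝ) : Prop where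
  cont_v : Continuous fun z : ℝ × ℝ => v z.1 z.2
  cont_P : Continuous fun z : ℝ × ℝ => P z.1 z.2
  cont_R : Continuous fun z : ℝ × ℝ => R z.1 z.2
  cont_Pt : Continuous fun z : ℝ × ℝ => Pt z.1 z.2
  cont_Px : Continuous fun z : ℝ × ℝ => Px z.1 z.2
  cont_Rt : Continuous fun z : ℝ × ℝ => Rt z.1 z.2
  cont_Rx : Continuous fun z : ℝ × ℝ => Rx z.1 z.2
  deriv_vt : ∀ t x, 0 < t → HasDerivAt (fun t => v t x) (exp (-x) * P t x) t
  deriv_vx : ∀ t x, HasDerivAt (fun x => v t x) (R t x) x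
  deriv_Pt : ∀ t x, 0 < t → HasDerivAt (fun t => P t x) (Pt t x) t
  deriv_Px : ∀ t x, HasDerivAt (fun x => P t x) (Px t x) x
  deriv_Rt : ∀ t x, 0 < t → HasDerivAt (fun t => R t x) (Rt t x) t
  deriv_Rx : ∀ t x, HasDerivAt (fun x => R t x) (Rx t x) x
  eq_P : ∀ t x, exp x * Pt t x = Rx t x - sin (v t x) * cos (v t x)
  eq_R : ∀ t x, exp x * Rt t x = Px t x - P t x
  energy_le : ∀ t a b, a ≤ b →
    ∫ x in a..b, (P t x ^ 2 + R t x ^ 2 + sin (v t x) ^ 2) ≤ E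

/-- A finite energy wave map restarted at time `t₀ > 0` and rescaled by `exp z₀`. -/
theorem IsWaveMap.cylinderWave {ψ : ℝ → ℝ → ℝ} (hψ : IsWaveMap ψ) (hfe : FiniteEnergy ψ)
    (hcons : EnergyConserved ψ) {t₀ : ℝ} (ht₀ : 0 < t₀) (z₀ : ℝ) :
    CylinderWave (fun t x => ψ (t₀ + exp z₀ * max t 0) (exp (z₀ + x)))
      (fun t x => exp (z₀ + x) * pT ψ (t₀ + exp z₀ * max t 0) (exp (z₀ + x)))
      (fun t x => exp (z₀ + x) * pR ψ (t₀ + exp z₀ * max t 0) (exp (z₀ + x)))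
      (fun t x => exp (z₀ + x) * (exp z₀ * pT (pT ψ) (t₀ + exp z₀ * max t 0) (exp (z₀ + x))))
      (fun t x => exp (z₀ + x) * pT ψ (t₀ + exp z₀ * max t 0) (exp (z₀ + x))
        + exp (z₀ + x) * (exp (z₀ + x) * pR (pT ψ) (t₀ + exp z₀ * max t 0) (exp (z₀ + x))))
      (fun t x => exp (z₀ + x) * (exp z₀ * pT (pR ψ) (t₀ + exp z₀ * max t 0) (exp (z₀ + x))))
      (fun t x => exp (z₀ + x) * pR ψ (t₀ + exp z₀ * max t 0) (exp (z₀ + x))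
        + exp (z₀ + x) * (exp (z₀ + x) * pR (pR ψ) (t₀ + exp z₀ * max t 0) (exp (z₀ + x))))
      (totE ψ 0) := by
  have hs := hψ.smoothInterior
  have hpos : ∀ t : ℝ, 0 < t₀ + exp z₀ * max t 0 := fun t => by positivity
  have hc : ∀ {f}, SmoothInterior f →
      Continuous fun z : ℝ × ℝ => f (t₀ + exp z₀ * max z.1 0) (exp (z₀ + z.2)) := fun hf =>
    hf.continuous_comp (by fun_prop) (by fun_prop) (fun _ => hpos _) fun _ => exp_pos _
  have hτ : ∀ t : ℝ, 0 < t → HasDerivAt (fun t => t₀ + exp z₀ * max t 0) (exp z₀) t :=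
    fun t ht => by
      have h : HasDerivAt (fun t => t₀ + exp z₀ * t) (exp z₀) t := by
        simpa using ((hasDerivAt_id t).const_mul (exp z₀)).const_add t₀
      refine h.congr_of_eventuallyEq ?_
      filter_upwards [lt_mem_nhds ht] with a ha
      rw [max_eq_left (le_of_lt ha)]
  have hex : ∀ x : ℝ, HasDerivAt (fun x => exp (z₀ + x)) (exp (z₀ + x)) x := fun x => by
    simpa using ((hasDerivAt_id x).const_add z₀).exp
  have hdt : ∀ {f}, SmoothInterior f → ∀ t x, 0 < t →
      HasDerivAt (fun t => f (t₀ + exp z₀ * max t 0) (exp (z₀ + x)))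
        (exp z₀ * pT f (t₀ + exp z₀ * max t 0) (exp (z₀ + x))) t :=
    fun hf t x ht => by
      simpa using hf.hasDerivAt_comp (hτ t ht) (hasDerivAt_const t (exp (z₀ + x))) (hpos t)
        (exp_pos _)
  have hdx : ∀ {f}, SmoothInterior f → ∀ t x,
      HasDerivAt (fun x => f (t₀ + exp z₀ * max t 0) (exp (z₀ + x)))
        (exp (z₀ + x) * pR f (t₀ + exp z₀ * max t 0) (exp (z₀ + x))) x :=
    fun hf t x => by
      simpa using hf.hasDerivAt_comp (hasDerivAt_const x (t₀ + exp z₀ * max t 0)) (hex x) (hpos t)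
        (exp_pos _)
  have h1 := hc hs
  have h2 := hc hs.time_deriv
  have h3 := hc hs.radial_deriv
  have h4 := hc hs.time_deriv.time_deriv
  have h5 := hc hs.time_deriv.radial_deriv
  have h6 := hc hs.radial_deriv.time_deriv
  have h7 := hc hs.radial_deriv.radial_deriv
  refine ⟨h1, by fun_prop, by fun_prop, by fun_prop, by fun_prop, by fun_prop, by fun_prop,
    fun t x ht => ?_, hdx hs, fun t x ht => (hdt hs.time_deriv t x ht).const_mul _,
    fun t x => (hex x).fun_mul (hdx hs.time_deriv t x),
    fun t x ht => (hdt hs.radial_deriv t x ht).const_mul _,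
    fun t x => (hex x).fun_mul (hdx hs.radial_deriv t x), fun t x => ?_, fun t x => ?_,
    fun t a b hab => integral_log_energy_le hs hfe hcons (hpos t) z₀ hab⟩
  · have h := hdt hs t x ht
    have h' : exp (-x) * exp (z₀ + x) = exp z₀ := by rw [← exp_add]; congr 1; ring
    rwa [← mul_assoc, h']
  · have h := hψ.radial_equation (hpos t).le (exp_pos (z₀ + x))
    have h' : exp z₀ * exp x = exp (z₀ + x) := (exp_add _ _).symm
    linear_combination h + exp (z₀ + x) * pT (pT ψ) (t₀ + exp z₀ * max t 0) (exp (z₀ + x)) * h'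
  · have h := hs.pT_pR_eq (hpos t) (exp_pos (z₀ + x))
    have h' : exp z₀ * exp x = exp (z₀ + x) := (exp_add _ _).symm
    rw [h]
    linear_combination exp (z₀ + x) * pR (pT ψ) (t₀ + exp z₀ * max t 0) (exp (z₀ + x)) * h'

lemma exists_first_crossing {f : ℝ → ℝ} (hf : Continuous f) {l c a : ℝ}
    (hl : Tendsto f atBot (nhds l)) (hlc : l < c) (ha : c ≤ f a) :
    ∃ z ≤ a, f z = c ∧ ∀ y < z, f y < c := by
  obtain ⟨B, hB⟩ := eventually_atBot.1 (hl.eventually_lt_const hlc)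
  set S := {z | z ≤ a ∧ c ≤ f z}
  have hcl : IsClosed S := (isClosed_le continuous_id continuous_const).inter
    (isClosed_le continuous_const hf)
  have hbdd : BddBelow S := ⟨B, fun z hz => by
    by_contra! hlt
    exact (hB z hlt.le).not_ge hz.2⟩
  obtain ⟨hz1, hz2⟩ := hcl.csInf_mem ⟨a, le_rfl, ha⟩ hbdd
  have hlt : ∀ y < sInf S, f y < c := fun y hy => by
    by_contra! hle
    exact (csInf_le hbdd ⟨hy.le.trans hz1, hle⟩).not_gt hy
  refine ⟨sInf S, hz1, le_antisymm ?_ hz2, hlt⟩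
  refine le_of_tendsto (hf.continuousWithinAt (s := Iio (sInf S)) (x := sInf S)) ?_
  filter_upwards [self_mem_nhdsWithin] with y hy using (hlt y hy).le

/-- Comparison of time averages in linear and in logarithmic time. -/
lemma integral_comp_exp_le {g G : ℝ → ℝ} (hg : Continuous g) (hG : Continuous G) {s lam A c : ℝ}
    (hlam : 0 < lam) (h3 : 3 * lam ≤ exp s) (hA : 0 ≤ A) (hG0 : ∀ σ, 0 ≤ G σ)
    (hgG : ∀ σ, s ≤ σ → σ ≤ s + 1 → g ((exp σ - exp s) / lam) ≤ G σ)
    (hc : ∀ η ∈ Icc (0 : ℝ) 1, ∫ σ in s..(s + η), G σ ≤ c * η) (hcA : 6 * c ≤ A) :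
    ∫ t in (0 : ℝ)..3, g t ≤ A := by
  have hs := exp_pos s
  have hratio : 0 < 3 * lam / exp s := by positivity
  have hone : 3 * lam / exp s ≤ 1 := (div_le_one hs).2 h3
  set h := log (1 + 3 * lam / exp s)
  have hexp : exp (s + h) = exp s + 3 * lam := by
    rw [exp_add, exp_log (by linarith)]
    field_simp
  have hh0 : 0 ≤ h := log_nonneg (by linarith)
  have hh1 : h ≤ 3 * lam / exp s := by
    have := log_le_sub_one_of_pos (show 0 < 1 + 3 * lam / exp s by linarith)
    linarith
  have key := intervalIntegral.integral_comp_mul_deriv (a := s) (b := s + h)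
    (f := fun σ => (exp σ - exp s) / lam) (f' := fun σ => exp σ / lam) (g := g)
    (fun σ _ => ((hasDerivAt_exp σ).sub_const _).div_const _) (by fun_prop) hg
  have e1 : (exp s - exp s) / lam = 0 := by simp
  have e2 : (exp (s + h) - exp s) / lam = 3 := by rw [hexp]; field_simp; ring
  rw [e1, e2] at key
  rw [← key]
  have hc0 : ∫ σ in s..(s + h), G σ ≤ c * h := hc h ⟨hh0, by linarith⟩
  have hnn : 0 ≤ ∫ σ in s..(s + h), G σ :=
    intervalIntegral.integral_nonneg (by linarith) fun σ _ => hG0 σ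
  calc _ ≤ ∫ σ in s..(s + h), 2 * exp s / lam * G σ := by
        refine intervalIntegral.integral_mono_on (by linarith)
          (Continuous.intervalIntegrable (by fun_prop) _ _)
          (Continuous.intervalIntegrable (by fun_prop) _ _) fun σ hσ => ?_
        have hσ2 : exp σ ≤ 2 * exp s := by
          have := exp_le_exp.2 hσ.2
          linarith
        have := hgG σ hσ.1 (by linarith [hσ.2])
        calc _ ≤ G σ * (exp σ / lam) := by
              simp only [Function.comp]
              gcongr
          _ ≤ G σ * (2 * exp s / lam) := by gcongr; exact hG0 σ
          _ = _ := mul_comm _ _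
    _ = 2 * exp s / lam * ∫ σ in s..(s + h), G σ := intervalIntegral.integral_const_mul _ _
    _ ≤ 2 * exp s / lam * (c * h) := by gcongr
    _ ≤ A := by
      rcases hh0.eq_or_lt with h0 | h0
      · simpa [← h0] using hA
      · have hc' : 0 ≤ c := nonneg_of_mul_nonneg_left (hnn.trans hc0) h0
        calc _ ≤ 2 * exp s / lam * (c * (3 * lam / exp s)) := by gcongr
          _ = 6 * c := by field_simp; ring
          _ ≤ A := hcA

/-- Selection of late times and much smaller scales at which the solution crosses `π / 2` for the
first time while it is nearly static. -/
theorem IsWaveMap.exists_concentration_scale {ψ : ℝ → ℝ → ℝ} (hψ : IsWaveMap ψ)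
    (hfe : FiniteEnergy ψ) (hcons : EnergyConserved ψ) (hbc : DegreeOneBC ψ) {ε : ℝ} (hε : 0 < ε)
    {X : ℝ} (hX : 0 ≤ X) (M : ℝ) :
    ∃ t₀ z₀ : ℝ, 0 < t₀ ∧ M ≤ t₀ ∧ M * exp z₀ ≤ t₀ ∧
      ψ t₀ (exp z₀) = π / 2 ∧ (∀ x < 0, ψ t₀ (exp (z₀ + x)) < π / 2) ∧
      ∫ t in (0 : ℝ)..3, ∫ x in (-X)..X,
        (exp (z₀ + x) * pT ψ (t₀ + exp z₀ * max t 0) (exp (z₀ + x))) ^ 2 ≤ ε := by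
  have hw := hψ.selfSimilarWave hfe hcons hbc
  obtain ⟨x₂, hx₂, hgood⟩ := hw.exists_good_time (c := min (ε / 6) (1 / 2)) (by positivity)
  set K := max M 3
  have hK : 3 ≤ K := le_max_right _ _
  set x₃ := min (x₂ - X) (-K)
  have hx₃ : x₃ ≤ x₂ - X := min_le_left _ _
  have hx₃' : x₃ ≤ -K := min_le_right _ _
  obtain ⟨s, hs, hpot, hkin⟩ := hgood x₃ (by linarith) M
  have hcont : Continuous fun z => ψ (exp s) (exp z) :=
    hψ.smoothInterior.continuous_comp continuous_const continuous_exp (fun _ => exp_pos _)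
      fun _ => exp_pos _
  have hlim : Tendsto (fun z => ψ (exp s) (exp z)) atBot (nhds 0) :=
    (hbc _ (exp_pos s).le).1.comp (tendsto_exp_atBot_nhdsGT)
  have hcross : π / 2 < ψ (exp s) (exp (s + x₃)) :=
    pi_div_two_lt_of_potW_lt_one (hpot.trans_lt (by
      have := min_le_right (ε / 6) (1 / 2 : ℝ)
      linarith))
  obtain ⟨z₀, hz₀, hz, hlt⟩ := exists_first_crossing hcont hlim (by positivity) hcross.le
  have hKz : K * exp z₀ ≤ exp s := by
    have h1 : exp z₀ ≤ exp s * exp (-K) := by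
      rw [← exp_add]
      exact exp_le_exp.2 (by linarith)
    have h2 : K * exp (-K) ≤ 1 := by
      rw [exp_neg, ← div_eq_mul_inv, div_le_one (exp_pos _)]
      linarith [add_one_le_exp K]
    nlinarith [exp_pos s]
  refine ⟨exp s, z₀, exp_pos s, by linarith [add_one_le_exp s],
    (mul_le_mul_of_nonneg_right (le_max_left _ _) (exp_pos _).le).trans hKz, hz,
    fun x hx => hlt _ (by linarith), ?_⟩
  have hpT := hψ.smoothInterior.time_deriv
  set N := x₂ + X + s + 1 - z₀
  have hN : 0 ≤ N := by
    simp only [N]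
    linarith
  have hp := hw.cont_p
  refine integral_comp_exp_le (lam := exp z₀) (s := s) (c := min (ε / 6) (1 / 2))
    (G := fun σ => ∫ x in (x₂ - N)..x₂, (exp (σ + x) * pT ψ (exp σ) (exp (σ + x))) ^ 2) ?_ ?_
    (exp_pos z₀) (by nlinarith [exp_pos z₀]) hε.le
    (fun σ => intervalIntegral.integral_nonneg (by linarith) fun x _ => sq_nonneg _)
    (fun σ hσ hσ' => ?_) (hkin N hN) (by linarith [min_le_left (ε / 6) (1 / 2 : ℝ)])
  · have := (hψ.cylinderWave hfe hcons (exp_pos s) z₀).cont_P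
    exact continuous_integral_param
      (g := fun x t => (exp (z₀ + x) * pT ψ (exp s + exp z₀ * max t 0) (exp (z₀ + x))) ^ 2)
      ((this.comp continuous_swap).pow 2) _ _
  · exact continuous_integral_param
      (g := fun x σ => (exp (σ + x) * pT ψ (exp σ) (exp (σ + x))) ^ 2)
      ((hp.comp continuous_swap).pow 2) _ _
  · have htime : exp s + exp z₀ * max ((exp σ - exp s) / exp z₀) 0 = exp σ := by
      rw [max_eq_left (div_nonneg (sub_nonneg.2 (exp_le_exp.2 hσ)) (exp_pos _).le)]
      field_simp
      ring
    have hshift : ∀ x, (exp (z₀ + x) * pT ψ (exp s + exp z₀ * max ((exp σ - exp s) / exp z₀) 0)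
        (exp (z₀ + x))) ^ 2 = (fun x => (exp (σ + x) * pT ψ (exp σ) (exp (σ + x))) ^ 2)
          (z₀ - σ + x) := fun x => by
      have : σ + (z₀ - σ + x) = z₀ + x := by ring
      simp only [htime, this]
    simp only [hshift]
    rw [intervalIntegral.integral_comp_add_left
      (fun x => (exp (σ + x) * pT ψ (exp σ) (exp (σ + x))) ^ 2)]
    have : Continuous fun x => exp (σ + x) * pT ψ (exp σ) (exp (σ + x)) :=
      hp.comp (by fun_prop : Continuous fun x : ℝ => (σ, x))
    refine intervalIntegral.integral_mono_interval ?_ (by linarith) (by linarith)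
      (Eventually.of_forall fun x => sq_nonneg _)
      (Continuous.intervalIntegrable (this.pow 2) _ _)
    simp only [N]
    linarith

/-- The quadratic time weight vanishing at the end points of `[0, 3]`. -/
def timeWeight (t : ℝ) : ℝ := t * (3 - t)

lemma continuous_timeWeight : Continuous timeWeight := by unfold timeWeight; fun_prop

lemma timeWeight_nonneg {t : ℝ} (ht : t ∈ Icc (0 : ℝ) 3) : 0 ≤ timeWeight t :=
  mul_nonneg ht.1 (sub_nonneg.2 ht.2)

lemma timeWeight_le (t : ℝ) : timeWeight t ≤ 9 / 4 := by
  unfold timeWeight; nlinarith [sq_nonneg (t - 3 / 2)]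

lemma two_le_timeWeight {t : ℝ} (ht : t ∈ Icc (1 : ℝ) 2) : 2 ≤ timeWeight t := by
  unfold timeWeight; nlinarith [ht.1, ht.2]

lemma hasDerivAt_timeWeight (t : ℝ) : HasDerivAt timeWeight (3 - 2 * t) t := by
  have := (hasDerivAt_id t).fun_mul ((hasDerivAt_id t).const_sub 3)
  simp only [id] at this
  exact this.congr_deriv (by ring)

lemma abs_timeWeight_deriv_le {t : ℝ} (ht : t ∈ Icc (0 : ℝ) 3) : |3 - 2 * t| ≤ 3 :=
  abs_le.2 ⟨by linarith [ht.2], by linarith [ht.1]⟩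

lemma integral_timeWeight : ∫ t in (0 : ℝ)..3, timeWeight t = 9 / 2 := by
  have h : ∀ t ∈ uIcc (0 : ℝ) 3, HasDerivAt (fun t : ℝ => 3 / 2 * t ^ 2 - t ^ 3 / 3)
      (timeWeight t) t := fun t _ => by
    have := ((hasDerivAt_pow 2 t).const_mul (3 / 2)).fun_sub ((hasDerivAt_pow 3 t).div_const 3)
    exact this.congr_deriv (by unfold timeWeight; norm_num; ring)
  rw [intervalIntegral.integral_eq_sub_of_hasDerivAt h
    (continuous_timeWeight.intervalIntegrable _ _)]
  norm_num

lemma integral_timeWeight_mul_deriv {f f' : ℝ → ℝ} (hf : Continuous f) (hf' : Continuous f')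
    (h : ∀ t, 0 < t → HasDerivAt f (f' t) t) :
    ∫ t in (0 : ℝ)..3, timeWeight t * f' t = -∫ t in (0 : ℝ)..3, (3 - 2 * t) * f t := by
  have hw := continuous_timeWeight
  have key := intervalIntegral.integral_eq_sub_of_hasDerivAt_of_le (a := (0 : ℝ)) (b := 3)
    (by norm_num) (hw.mul hf).continuousOn
    (fun t ht => (hasDerivAt_timeWeight t).mul (h t ht.1))
    (Continuous.intervalIntegrable (by fun_prop) _ _)
  rw [intervalIntegral.integral_add (Continuous.intervalIntegrable (by fun_prop) _ _)
    (Continuous.intervalIntegrable (by fun_prop) _ _)] at key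
  simp only [Pi.mul_apply, timeWeight] at key ⊢
  linarith

namespace CylinderWave

variable {v P R Pt Px Rt Rx : ℝ → ℝ → ℝ} {E : ℝ}

lemma add_pi (h : CylinderWave v P R Pt Px Rt Rx E) :
    CylinderWave (fun t x => v t x + π) P R Pt Px Rt Rx E where
  __ := h
  cont_v := h.cont_v.add_const π
  deriv_vt t x ht := (h.deriv_vt t x ht).add_const π
  deriv_vx t x := (h.deriv_vx t x).add_const π
  eq_P t x := by rw [h.eq_P, sin_add_pi, cos_add_pi]; ring
  energy_le t a b hab := by simpa [sin_add_pi] using h.energy_le t a b hab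

lemma integral_timeWeight_Pt (h : CylinderWave v P R Pt Px Rt Rx E) (x : ℝ) :
    ∫ t in (0 : ℝ)..3, timeWeight t * Pt t x = -∫ t in (0 : ℝ)..3, (3 - 2 * t) * P t x := by
  have hl : Continuous fun t : ℝ => (t, x) := by fun_prop
  exact integral_timeWeight_mul_deriv (h.cont_P.comp hl) (h.cont_Pt.comp hl)
    fun t ht => h.deriv_Pt t x ht

/-- The averaged solution. -/
lemma hasDerivAt_mean (h : CylinderWave v P R Pt Px Rt Rx E) (x : ℝ) :
    HasDerivAt (fun x => ∫ t in (0 : ℝ)..3, timeWeight t * v t x)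
      (∫ t in (0 : ℝ)..3, timeWeight t * R t x) x := by
  have h1 := h.cont_v; have h2 := h.cont_R
  have hw := continuous_timeWeight
  exact hasDerivAt_integral_param (g := fun t x => timeWeight t * v t x)
    (g' := fun t x => timeWeight t * R t x) (by fun_prop) (by fun_prop)
    (fun t x => (h.deriv_vx t x).const_mul _) x 0 3

lemma hasDerivAt_mean_deriv (h : CylinderWave v P R Pt Px Rt Rx E) (x : ℝ) :
    HasDerivAt (fun x => ∫ t in (0 : ℝ)..3, timeWeight t * R t x)
      (-exp x * (∫ t in (0 : ℝ)..3, (3 - 2 * t) * P t x)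
        + ∫ t in (0 : ℝ)..3, timeWeight t * (sin (v t x) * cos (v t x))) x := by
  have h1 := h.cont_v; have h2 := h.cont_R; have h3 := h.cont_Rx; have h4 := h.cont_Pt
  have hw := continuous_timeWeight
  have hl : Continuous fun t : ℝ => (t, x) := by fun_prop
  have h1' : Continuous fun t => v t x := h1.comp hl
  have h4' : Continuous fun t => Pt t x := h4.comp hl
  have key := hasDerivAt_integral_param (g := fun t x => timeWeight t * R t x)
    (g' := fun t x => timeWeight t * Rx t x) (by fun_prop) (by fun_prop)
    (fun t x => (h.deriv_Rx t x).const_mul _) x 0 3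
  convert key using 1
  rw [neg_mul, ← mul_neg, ← h.integral_timeWeight_Pt, ← intervalIntegral.integral_const_mul,
    ← intervalIntegral.integral_add (Continuous.intervalIntegrable (by fun_prop) _ _)
      (Continuous.intervalIntegrable (by fun_prop) _ _)]
  refine intervalIntegral.integral_congr fun t _ => ?_
  linear_combination timeWeight t * h.eq_P t x

/-- The averaged defect in the harmonic map equation `∂ₓv = sin v`. -/
lemma hasDerivAt_defect (h : CylinderWave v P R Pt Px Rt Rx E) (x : ℝ) :
    HasDerivAt (fun x => ∫ t in (0 : ℝ)..3, timeWeight t * (R t x - sin (v t x)))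
      (-exp x * (∫ t in (0 : ℝ)..3, (3 - 2 * t) * P t x)
        - ∫ t in (0 : ℝ)..3, timeWeight t * (cos (v t x) * (R t x - sin (v t x)))) x := by
  have h1 := h.cont_v; have h2 := h.cont_R; have h3 := h.cont_Rx; have h4 := h.cont_Pt
  have hw := continuous_timeWeight
  have hl : Continuous fun t : ℝ => (t, x) := by fun_prop
  have h1' : Continuous fun t => v t x := h1.comp hl
  have h2' : Continuous fun t => R t x := h2.comp hl
  have h4' : Continuous fun t => Pt t x := h4.comp hl
  have key := hasDerivAt_integral_param (g := fun t x => timeWeight t * (R t x - sin (v t x)))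
    (g' := fun t x => timeWeight t * (Rx t x - cos (v t x) * R t x)) (by fun_prop) (by fun_prop)
    (fun t x => ((h.deriv_Rx t x).fun_sub (h.deriv_vx t x).sin).const_mul _) x 0 3
  convert key using 1
  rw [neg_mul, ← mul_neg, ← h.integral_timeWeight_Pt, ← intervalIntegral.integral_const_mul,
    ← intervalIntegral.integral_sub (Continuous.intervalIntegrable (by fun_prop) _ _)
      (Continuous.intervalIntegrable (by fun_prop) _ _)]
  refine intervalIntegral.integral_congr fun t _ => ?_
  linear_combination timeWeight t * h.eq_P t x

/-- The averaged momentum identity. -/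
lemma hasDerivAt_momentum (h : CylinderWave v P R Pt Px Rt Rx E) (x : ℝ) :
    HasDerivAt (fun x => ∫ t in (0 : ℝ)..3, timeWeight t * (P t x ^ 2 + R t x ^ 2 - sin (v t x) ^ 2))
      (2 * (∫ t in (0 : ℝ)..3, timeWeight t * P t x ^ 2)
        - 2 * exp x * ∫ t in (0 : ℝ)..3, (3 - 2 * t) * (P t x * R t x)) x := by
  have h1 := h.cont_v; have h2 := h.cont_R; have h3 := h.cont_Rx; have h4 := h.cont_Pt
  have h5 := h.cont_P; have h6 := h.cont_Px; have h7 := h.cont_Rt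
  have hw := continuous_timeWeight
  have hl : Continuous fun t : ℝ => (t, x) := by fun_prop
  have h2' : Continuous fun t => R t x := h2.comp hl
  have h4' : Continuous fun t => Pt t x := h4.comp hl
  have h5' : Continuous fun t => P t x := h5.comp hl
  have h7' : Continuous fun t => Rt t x := h7.comp hl
  have key := hasDerivAt_integral_param
    (g := fun t x => timeWeight t * (P t x ^ 2 + R t x ^ 2 - sin (v t x) ^ 2))
    (g' := fun t x => timeWeight t * (2 * P t x * Px t x + 2 * R t x * Rx t x
      - 2 * sin (v t x) * (cos (v t x) * R t x))) (by fun_prop) (by fun_prop)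
    (fun t x => by
      simpa using ((((h.deriv_Px t x).fun_pow 2).fun_add ((h.deriv_Rx t x).fun_pow 2)).fun_sub
        ((h.deriv_vx t x).sin.fun_pow 2)).const_mul (timeWeight t)) x 0 3
  convert key using 1
  have hibp := integral_timeWeight_mul_deriv (f := fun t => P t x * R t x)
    (f' := fun t => Pt t x * R t x + P t x * Rt t x) (by fun_prop) (by fun_prop)
    fun t ht => (h.deriv_Pt t x ht).mul (h.deriv_Rt t x ht)
  rw [sub_eq_add_neg, ← mul_neg, ← hibp, ← intervalIntegral.integral_const_mul,
    ← intervalIntegral.integral_const_mul,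
    ← intervalIntegral.integral_add (Continuous.intervalIntegrable (by fun_prop) _ _)
      (Continuous.intervalIntegrable (by fun_prop) _ _)]
  refine intervalIntegral.integral_congr fun t _ => ?_
  linear_combination 2 * timeWeight t * (R t x * h.eq_P t x + P t x * h.eq_R t x)

end CylinderWave

lemma integral_integral_mono {f g : ℝ → ℝ → ℝ} (hf : Continuous fun z : ℝ × ℝ => f z.1 z.2)
    (hg : Continuous fun z : ℝ × ℝ => g z.1 z.2) {a b c d : ℝ} (hab : a ≤ b) (hcd : c ≤ d)
    (h : ∀ t x, f t x ≤ g t x) :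
    ∫ x in a..b, ∫ t in c..d, f t x ≤ ∫ x in a..b, ∫ t in c..d, g t x := by
  have hl : ∀ x : ℝ, Continuous fun t : ℝ => (t, x) := fun x => by fun_prop
  exact intervalIntegral.integral_mono_on hab
    ((continuous_integral_param hf c d).intervalIntegrable _ _)
    ((continuous_integral_param hg c d).intervalIntegrable _ _) fun x _ =>
    intervalIntegral.integral_mono_on hcd ((hf.comp (hl x)).intervalIntegrable _ _)
      ((hg.comp (hl x)).intervalIntegrable _ _) fun t _ => h t x

lemma abs_mul_le_add_sq (p r : ℝ) {b : ℝ} (hb : 0 < b) :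
    |p * r| ≤ b * r ^ 2 + 1 / (4 * b) * p ^ 2 := by
  have h1 : (b * r ^ 2 + 1 / (4 * b) * p ^ 2) - |p| * |r| = (2 * b * |r| - |p|) ^ 2 / (4 * b) := by
    rw [← sq_abs p, ← sq_abs r]
    field_simp
    ring
  rw [abs_mul]
  linarith [show 0 ≤ (2 * b * |r| - |p|) ^ 2 / (4 * b) by positivity]

lemma abs_le_add_sq (p : ℝ) {b : ℝ} (hb : 0 < b) : |p| ≤ b + 1 / (4 * b) * p ^ 2 := by
  simpa using abs_mul_le_add_sq p 1 hb

/-- A quantitative form of almost stationarity on `[0, 3] × [-X, X]`. -/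
structure IsNearlyStatic (v P R : ℝ → ℝ → ℝ) (X γ : ℝ) : Prop where
  close : ∀ t ∈ Icc (0 : ℝ) 3, ∀ x ∈ Icc (-X) (X - 1), |v t x - v 0 x| ≤ γ
  velocity : exp X * ∫ x in (-X)..X, ∫ t in (0 : ℝ)..3, |P t x| ≤ γ
  momentum : exp X * ∫ x in (-X)..X, ∫ t in (0 : ℝ)..3, |P t x * R t x| ≤ γ
  kinetic : ∫ x in (-X)..X, ∫ t in (0 : ℝ)..3, P t x ^ 2 ≤ γ

namespace CylinderWave

variable {v P R Pt Px Rt Rx : ℝ → ℝ → ℝ} {E : ℝ}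

lemma energy_nonneg (h : CylinderWave v P R Pt Px Rt Rx E) : 0 ≤ E := by
  simpa using h.energy_le 0 0 0 le_rfl

lemma cont_energy (h : CylinderWave v P R Pt Px Rt Rx E) :
    Continuous fun z : ℝ × ℝ => P z.1 z.2 ^ 2 + R z.1 z.2 ^ 2 + sin (v z.1 z.2) ^ 2 := by
  have := h.cont_v; have := h.cont_P; have := h.cont_R
  fun_prop

lemma integral_integral_energy_le (h : CylinderWave v P R Pt Px Rt Rx E) {a b : ℝ} (hab : a ≤ b) :
    ∫ x in a..b, ∫ t in (0 : ℝ)..3, (P t x ^ 2 + R t x ^ 2 + sin (v t x) ^ 2) ≤ 3 * E := by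
  rw [integral_swap_of_continuous (g := fun t x => P t x ^ 2 + R t x ^ 2 + sin (v t x) ^ 2)
    h.cont_energy hab (by norm_num)]
  refine (intervalIntegral.integral_mono_on (g := fun _ => E) (by norm_num) ?_ (by simp)
    fun t _ => h.energy_le t a b hab).trans (by simp)
  exact (continuous_integral_param (g := fun x t => P t x ^ 2 + R t x ^ 2 + sin (v t x) ^ 2)
    (h.cont_energy.comp continuous_swap) a b).intervalIntegrable _ _

lemma abs_sub_le (h : CylinderWave v P R Pt Px Rt Rx E) (t : ℝ) {x y b : ℝ} (hxy : x ≤ y)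
    (hb : 0 < b) : |v t y - v t x| ≤ b * (y - x) + 1 / (4 * b) * E := by
  have hl : Continuous fun x : ℝ => (t, x) := by fun_prop
  have hR : Continuous fun x => R t x := h.cont_R.comp hl
  have he : Continuous fun x => P t x ^ 2 + R t x ^ 2 + sin (v t x) ^ 2 := h.cont_energy.comp hl
  refine (abs_sub_le_integral_of_abs_deriv_le
    (g := fun x => b + 1 / (4 * b) * (P t x ^ 2 + R t x ^ 2 + sin (v t x) ^ 2)) hxy
    (fun x _ => h.deriv_vx t x) (by fun_prop)
    fun x _ => ?_).trans ?_
  · have h1 : 1 / (4 * b) * R t x ^ 2 ≤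
        1 / (4 * b) * (P t x ^ 2 + R t x ^ 2 + sin (v t x) ^ 2) := by
      gcongr
      linarith [sq_nonneg (P t x), sq_nonneg (sin (v t x))]
    linarith [abs_le_add_sq (R t x) hb]
  · rw [intervalIntegral.integral_add (by simp) (Continuous.intervalIntegrable
      (by fun_prop) _ _), intervalIntegral.integral_const_mul,
      intervalIntegral.integral_const, smul_eq_mul, mul_comm b]
    gcongr
    exact h.energy_le t x y hxy

lemma integral_integral_abs_velocity_le (h : CylinderWave v P R Pt Px Rt Rx E) {X b : ℝ}
    (hX : 0 ≤ X) (hb : 0 < b) (hκ : ∫ x in (-X)..X, ∫ t in (0 : ℝ)..3, P t x ^ 2 ≤ b ^ 2) :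
    ∫ x in (-X)..X, ∫ t in (0 : ℝ)..3, |P t x| ≤ b * (6 * X + 1) := by
  have hP := h.cont_P
  have hl : ∀ x, Continuous fun t => P t x := fun x =>
    hP.comp (by fun_prop : Continuous fun t : ℝ => (t, x))
  have hc : Continuous fun x => ∫ t in (0 : ℝ)..3, P t x ^ 2 :=
    continuous_integral_param (g := fun t x => P t x ^ 2) (by fun_prop) 0 3
  refine (integral_integral_mono (f := fun t x => |P t x|)
    (g := fun t x => b + 1 / (4 * b) * P t x ^ 2) (by fun_prop) (by fun_prop) (by linarith)
    (by norm_num) fun t x => abs_le_add_sq _ hb).trans ?_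
  have h1 : ∀ x, ∫ t in (0 : ℝ)..3, (b + 1 / (4 * b) * P t x ^ 2) =
      3 * b + 1 / (4 * b) * ∫ t in (0 : ℝ)..3, P t x ^ 2 := fun x => by
    have := hl x
    rw [intervalIntegral.integral_add (by simp) (Continuous.intervalIntegrable (by fun_prop) _ _),
      intervalIntegral.integral_const_mul]
    simp
  simp only [h1]
  rw [intervalIntegral.integral_add (by simp) (Continuous.intervalIntegrable (by fun_prop) _ _),
    intervalIntegral.integral_const, intervalIntegral.integral_const_mul, smul_eq_mul]
  calc _ ≤ (X - -X) * (3 * b) + 1 / (4 * b) * b ^ 2 := by gcongr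
    _ = b * (6 * X + 1 / 4) := by field_simp; ring
    _ ≤ _ := by gcongr; norm_num

lemma integral_integral_abs_momentum_le (h : CylinderWave v P R Pt Px Rt Rx E) {X b : ℝ}
    (hX : 0 ≤ X) (hb : 0 < b) (hκ : ∫ x in (-X)..X, ∫ t in (0 : ℝ)..3, P t x ^ 2 ≤ b ^ 2) :
    ∫ x in (-X)..X, ∫ t in (0 : ℝ)..3, |P t x * R t x| ≤ b * (3 * E + 1) := by
  have hP := h.cont_P; have hR := h.cont_R; have hv := h.cont_v
  have hl : ∀ x : ℝ, Continuous fun t : ℝ => (t, x) := fun x => by fun_prop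
  have hc : Continuous fun x => ∫ t in (0 : ℝ)..3, P t x ^ 2 :=
    continuous_integral_param (g := fun t x => P t x ^ 2) (by fun_prop) 0 3
  have hce : Continuous fun x => ∫ t in (0 : ℝ)..3, (P t x ^ 2 + R t x ^ 2 + sin (v t x) ^ 2) :=
    continuous_integral_param (g := fun t x => P t x ^ 2 + R t x ^ 2 + sin (v t x) ^ 2)
      h.cont_energy 0 3
  refine (integral_integral_mono (f := fun t x => |P t x * R t x|)
    (g := fun t x => b * (P t x ^ 2 + R t x ^ 2 + sin (v t x) ^ 2) + 1 / (4 * b) * P t x ^ 2)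
    (by fun_prop) (by fun_prop) (by linarith) (by norm_num) fun t x => ?_).trans ?_
  · have : b * R t x ^ 2 ≤ b * (P t x ^ 2 + R t x ^ 2 + sin (v t x) ^ 2) := by
      gcongr
      linarith [sq_nonneg (P t x), sq_nonneg (sin (v t x))]
    linarith [abs_mul_le_add_sq (P t x) (R t x) hb]
  have h1 : ∀ x, ∫ t in (0 : ℝ)..3, (b * (P t x ^ 2 + R t x ^ 2 + sin (v t x) ^ 2)
      + 1 / (4 * b) * P t x ^ 2) = b * (∫ t in (0 : ℝ)..3, (P t x ^ 2 + R t x ^ 2 + sin (v t x) ^ 2))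
        + 1 / (4 * b) * ∫ t in (0 : ℝ)..3, P t x ^ 2 := fun x => by
    have h2 : Continuous fun t => P t x := hP.comp (hl x)
    have h3 : Continuous fun t => P t x ^ 2 + R t x ^ 2 + sin (v t x) ^ 2 :=
      h.cont_energy.comp (hl x)
    rw [intervalIntegral.integral_add (Continuous.intervalIntegrable (by fun_prop) _ _)
      (Continuous.intervalIntegrable (by fun_prop) _ _), intervalIntegral.integral_const_mul,
      intervalIntegral.integral_const_mul]
  simp only [h1]
  rw [intervalIntegral.integral_add (Continuous.intervalIntegrable (by fun_prop) _ _)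
    (Continuous.intervalIntegrable (by fun_prop) _ _), intervalIntegral.integral_const_mul,
    intervalIntegral.integral_const_mul]
  have h4 := h.integral_integral_energy_le (show -X ≤ X by linarith)
  calc _ ≤ b * (3 * E) + 1 / (4 * b) * b ^ 2 := by gcongr
    _ = b * (3 * E + 1 / 4) := by field_simp
    _ ≤ _ := by gcongr; norm_num

lemma abs_sub_initial_le (h : CylinderWave v P R Pt Px Rt Rx E) {t : ℝ} (ht : t ∈ Icc (0 : ℝ) 3)
    (x : ℝ) : |v t x - v 0 x| ≤ exp (-x) * ∫ t in (0 : ℝ)..3, |P t x| := by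
  have hl : Continuous fun t : ℝ => (t, x) := by fun_prop
  have hP : Continuous fun t => P t x := h.cont_P.comp hl
  have hv : Continuous fun t => v t x := h.cont_v.comp hl
  rw [← intervalIntegral.integral_eq_sub_of_hasDerivAt_of_le ht.1 hv.continuousOn
    (fun s hs => h.deriv_vt s x hs.1) (Continuous.intervalIntegrable (by fun_prop) _ _),
    intervalIntegral.integral_const_mul, abs_mul, abs_of_pos (exp_pos _)]
  gcongr
  exact (intervalIntegral.abs_integral_le_integral_abs ht.1).trans
    (intervalIntegral.integral_mono_interval le_rfl ht.1 ht.2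
      (Eventually.of_forall fun s => abs_nonneg _) (hP.abs.intervalIntegrable _ _))

lemma abs_sub_initial_le_of_velocity (h : CylinderWave v P R Pt Px Rt Rx E) {t : ℝ}
    (ht : t ∈ Icc (0 : ℝ) 3) {X x ρ b k : ℝ} (hρ : 0 < ρ) (hρ1 : ρ ≤ 1) (hb : 0 < b)
    (hx : x ∈ Icc (-X) (X - 1))
    (hk : exp X * ∫ x in (-X)..X, ∫ t in (0 : ℝ)..3, |P t x| ≤ k * ρ) :
    |v t x - v 0 x| ≤ 2 * (b * ρ + 1 / (4 * b) * E) + k := by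
  have hP := h.cont_P
  have hc : Continuous fun x => ∫ t in (0 : ℝ)..3, |P t x| :=
    continuous_integral_param (g := fun t x => |P t x|) (by fun_prop) 0 3
  have hnn : ∀ x, 0 ≤ ∫ t in (0 : ℝ)..3, |P t x| := fun x =>
    intervalIntegral.integral_nonneg (by norm_num) fun _ _ => abs_nonneg _
  obtain ⟨y, hy, hle⟩ := exists_mul_le_integral hc (show x ≤ x + ρ by linarith)
  have h1 : ∫ x in x..(x + ρ), ∫ t in (0 : ℝ)..3, |P t x| ≤
      ∫ x in (-X)..X, ∫ t in (0 : ℝ)..3, |P t x| :=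
    intervalIntegral.integral_mono_interval hx.1 (by linarith) (by linarith [hx.2])
      (Eventually.of_forall hnn) (hc.intervalIntegrable _ _)
  have h2 : |v t y - v 0 y| ≤ k := by
    refine (h.abs_sub_initial_le ht y).trans (le_of_mul_le_mul_right ?_ hρ)
    have h3 : exp (-y) ≤ exp X := exp_le_exp.2 (by linarith [hx.1, hy.1])
    calc _ ≤ exp X * (∫ t in (0 : ℝ)..3, |P t y|) * ρ := by gcongr; exact hnn y
      _ = exp X * ((∫ t in (0 : ℝ)..3, |P t y|) * (x + ρ - x)) := by ring
      _ ≤ exp X * ∫ x in (-X)..X, ∫ t in (0 : ℝ)..3, |P t x| := by gcongr; linarith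
      _ ≤ _ := hk
  have hmono : b * (y - x) ≤ b * ρ := by gcongr; linarith [hy.2]
  have h3 := (abs_le.1 (h.abs_sub_le t hy.1 hb))
  have h4 := (abs_le.1 (h.abs_sub_le 0 hy.1 hb))
  have h5 := abs_le.1 h2
  exact abs_le.2 ⟨by linarith [h3.2, h4.1, h5.1], by linarith [h3.1, h4.2, h5.2]⟩

/-- Small kinetic energy forces almost stationarity. -/
theorem exists_isNearlyStatic {E X γ : ℝ} (hE : 0 ≤ E) (hX : 0 ≤ X) (hγ : 0 < γ) :
    ∃ ε > 0, ∀ {v P R Pt Px Rt Rx : ℝ → ℝ → ℝ}, CylinderWave v P R Pt Px Rt Rx E →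
      ∫ t in (0 : ℝ)..3, ∫ x in (-X)..X, P t x ^ 2 ≤ ε → IsNearlyStatic v P R X γ := by
  obtain ⟨b₁, hb₁, hb₁E⟩ : ∃ b > 0, 1 / (4 * b) * E ≤ γ / 8 := by
    refine ⟨2 * (E + 1) / γ, by positivity, ?_⟩
    have : 1 / (4 * (2 * (E + 1) / γ)) * E = γ / 8 * (E / (E + 1)) := by field_simp; norm_num; ring
    rw [this]
    exact mul_le_of_le_one_right (by positivity) ((div_le_one (by positivity)).2 (by linarith))
  set ρ := min 1 (γ / (8 * b₁))
  have hρ : 0 < ρ := by positivity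
  have hρ1 : ρ ≤ 1 := min_le_left _ _
  have hρb : b₁ * ρ ≤ γ / 8 := by
    calc b₁ * ρ ≤ b₁ * (γ / (8 * b₁)) := by gcongr; exact min_le_right _ _
      _ = γ / 8 := by field_simp
  set D := exp X * (6 * X + 3 * E + 2)
  have hD : 0 < D := by positivity
  set b := min (min γ 1) (γ / 2 * ρ / D)
  have hb : 0 < b := by positivity
  have hb1 : b ≤ 1 := (min_le_left _ _).trans (min_le_right _ _)
  have hbγ : b ≤ γ := (min_le_left _ _).trans (min_le_left _ _)
  have hbD : D * b ≤ γ / 2 * ρ := by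
    calc D * b ≤ D * (γ / 2 * ρ / D) := by gcongr; exact min_le_right _ _
      _ = _ := by field_simp
  refine ⟨b ^ 2, by positivity, fun {v P R Pt Px Rt Rx} h hκ => ?_⟩
  have hP := h.cont_P
  rw [← integral_swap_of_continuous (g := fun t x => P t x ^ 2) (by fun_prop) (by linarith)
    (by norm_num)] at hκ
  have hvel : exp X * ∫ x in (-X)..X, ∫ t in (0 : ℝ)..3, |P t x| ≤ γ / 2 * ρ := by
    calc _ ≤ exp X * (b * (6 * X + 1)) := by
          gcongr; exact h.integral_integral_abs_velocity_le hX hb hκ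
      _ = exp X * (6 * X + 1) * b := by ring
      _ ≤ D * b := by simp only [D]; gcongr <;> linarith
      _ ≤ _ := hbD
  refine ⟨fun t ht x hx => ?_, hvel.trans ?_, ?_, hκ.trans ?_⟩
  · linarith [h.abs_sub_initial_le_of_velocity ht hρ hρ1 hb₁ hx hvel]
  · nlinarith
  · calc _ ≤ exp X * (b * (3 * E + 1)) := by
          gcongr; exact h.integral_integral_abs_momentum_le hX hb hκ
      _ = exp X * (3 * E + 1) * b := by ring
      _ ≤ D * b := by simp only [D]; gcongr <;> linarith
      _ ≤ γ / 2 * ρ := hbD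
      _ ≤ γ := by nlinarith
  · nlinarith

end CylinderWave

/-- The time averaged defect in the first order harmonic map equation `∂ₓv = sin v`. -/
def defect (v R : ℝ → ℝ → ℝ) (x : ℝ) : ℝ :=
  ∫ t in (0 : ℝ)..3, timeWeight t * (R t x - sin (v t x))

/-- The time averaged radial momentum. -/
def meanMomentum (v P R : ℝ → ℝ → ℝ) (x : ℝ) : ℝ :=
  ∫ t in (0 : ℝ)..3, timeWeight t * (P t x ^ 2 + R t x ^ 2 - sin (v t x) ^ 2)

lemma abs_integral_timeWeight_mul_le {f g : ℝ → ℝ} (hg : Continuous g)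
    (h : ∀ t ∈ Icc (0 : ℝ) 3, |f t| ≤ g t) :
    |∫ t in (0 : ℝ)..3, timeWeight t * f t| ≤ ∫ t in (0 : ℝ)..3, 9 / 4 * g t := by
  rw [← Real.norm_eq_abs]
  refine intervalIntegral.norm_integral_le_of_norm_le (by norm_num)
    (.of_forall fun t ht => ?_) (Continuous.intervalIntegrable (by fun_prop) _ _)
  rw [norm_mul, Real.norm_eq_abs, Real.norm_eq_abs,
    abs_of_nonneg (timeWeight_nonneg ⟨ht.1.le, ht.2⟩)]
  exact mul_le_mul (timeWeight_le t) (h t ⟨ht.1.le, ht.2⟩) (abs_nonneg _) (by norm_num)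

lemma abs_integral_deriv_timeWeight_mul_le {f : ℝ → ℝ} (hf : Continuous f) :
    |∫ t in (0 : ℝ)..3, (3 - 2 * t) * f t| ≤ 3 * ∫ t in (0 : ℝ)..3, |f t| := by
  rw [← Real.norm_eq_abs, ← intervalIntegral.integral_const_mul]
  refine intervalIntegral.norm_integral_le_of_norm_le (by norm_num)
    (.of_forall fun t ht => ?_) (Continuous.intervalIntegrable (by fun_prop) _ _)
  rw [norm_mul, Real.norm_eq_abs, Real.norm_eq_abs]
  exact mul_le_mul_of_nonneg_right (abs_timeWeight_deriv_le ⟨ht.1.le, ht.2⟩) (abs_nonneg _)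

lemma IsNearlyStatic.add_pi {v P R : ℝ → ℝ → ℝ} {X γ : ℝ} (hn : IsNearlyStatic v P R X γ) :
    IsNearlyStatic (fun t x => v t x + π) P R X γ where
  __ := hn
  close t ht x hx := by simpa using hn.close t ht x hx

namespace CylinderWave

variable {v P R Pt Px Rt Rx : ℝ → ℝ → ℝ} {E : ℝ}

lemma cont_v_time (h : CylinderWave v P R Pt Px Rt Rx E) (x : ℝ) : Continuous fun t => v t x :=
  h.cont_v.comp (by fun_prop : Continuous fun t : ℝ => (t, x))

lemma cont_P_time (h : CylinderWave v P R Pt Px Rt Rx E) (x : ℝ) : Continuous fun t => P t x :=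
  h.cont_P.comp (by fun_prop : Continuous fun t : ℝ => (t, x))

lemma cont_R_time (h : CylinderWave v P R Pt Px Rt Rx E) (x : ℝ) : Continuous fun t => R t x :=
  h.cont_R.comp (by fun_prop : Continuous fun t : ℝ => (t, x))

lemma cont_integral_energy (h : CylinderWave v P R Pt Px Rt Rx E) :
    Continuous fun x => ∫ t in (0 : ℝ)..3, (P t x ^ 2 + R t x ^ 2 + sin (v t x) ^ 2) :=
  continuous_integral_param (g := fun t x => P t x ^ 2 + R t x ^ 2 + sin (v t x) ^ 2)
    h.cont_energy 0 3

lemma cont_integral_abs_velocity (h : CylinderWave v P R Pt Px Rt Rx E) :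
    Continuous fun x => ∫ t in (0 : ℝ)..3, |P t x| := by
  have := h.cont_P
  exact continuous_integral_param (g := fun t x => |P t x|) (by fun_prop) 0 3

lemma abs_meanMomentum_le (h : CylinderWave v P R Pt Px Rt Rx E) (x : ℝ) :
    |meanMomentum v P R x| ≤
      9 / 4 * ∫ t in (0 : ℝ)..3, (P t x ^ 2 + R t x ^ 2 + sin (v t x) ^ 2) := by
  have h1 := h.cont_v_time x; have h2 := h.cont_P_time x; have h3 := h.cont_R_time x
  rw [← intervalIntegral.integral_const_mul]
  refine abs_integral_timeWeight_mul_le (by fun_prop) fun t _ => abs_le.2 ⟨?_, ?_⟩ <;>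
  nlinarith [sq_nonneg (P t x), sq_nonneg (R t x), sq_nonneg (sin (v t x))]

lemma sq_defect_le (h : CylinderWave v P R Pt Px Rt Rx E) (x : ℝ) :
    defect v R x ^ 2 ≤ 32 * ∫ t in (0 : ℝ)..3, (P t x ^ 2 + R t x ^ 2 + sin (v t x) ^ 2) := by
  have h1 := h.cont_v_time x; have h2 := h.cont_P_time x; have h3 := h.cont_R_time x
  have hw := continuous_timeWeight
  have key := sq_integral_mul_le (f := timeWeight) (g := fun t => R t x - sin (v t x)) hw
    (by fun_prop) (show (0 : ℝ) ≤ 3 by norm_num)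
  have hθ : ∫ t in (0 : ℝ)..3, timeWeight t ^ 2 ≤ 16 := by
    refine (intervalIntegral.integral_mono_on (g := fun _ => 81 / 16) (by norm_num)
      (Continuous.intervalIntegrable (by fun_prop) _ _) (by simp) fun t ht => ?_).trans (by norm_num)
    nlinarith [timeWeight_nonneg ht, timeWeight_le t]
  have hR : ∫ t in (0 : ℝ)..3, (R t x - sin (v t x)) ^ 2 ≤
      2 * ∫ t in (0 : ℝ)..3, (P t x ^ 2 + R t x ^ 2 + sin (v t x) ^ 2) := by
    rw [← intervalIntegral.integral_const_mul]
    refine intervalIntegral.integral_mono_on (by norm_num)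
      (Continuous.intervalIntegrable (by fun_prop) _ _)
      (Continuous.intervalIntegrable (by fun_prop) _ _) fun t _ => ?_
    nlinarith [sq_nonneg (P t x), sq_nonneg (R t x + sin (v t x))]
  have hR0 : 0 ≤ ∫ t in (0 : ℝ)..3, (R t x - sin (v t x)) ^ 2 :=
    intervalIntegral.integral_nonneg (by norm_num) fun t _ => sq_nonneg _
  rw [defect]
  nlinarith

lemma abs_defect_le (h : CylinderWave v P R Pt Px Rt Rx E) {x : ℝ}
    (hN : |meanMomentum v P R x| ≤ 3) : |defect v R x| ≤ 16 := by
  have h1 := h.cont_v_time x; have h2 := h.cont_P_time x; have h3 := h.cont_R_time x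
  have hw := continuous_timeWeight
  have key : |defect v R x| ≤ ∫ t in (0 : ℝ)..3,
      (10 / 3 * timeWeight t
        + 1 / 6 * (timeWeight t * (P t x ^ 2 + R t x ^ 2 - sin (v t x) ^ 2))) := by
    rw [← Real.norm_eq_abs]
    refine intervalIntegral.norm_integral_le_of_norm_le (by norm_num)
      (.of_forall fun t ht => ?_) (Continuous.intervalIntegrable (by fun_prop) _ _)
    have hθ := timeWeight_nonneg ⟨ht.1.le, ht.2⟩
    have h4 := abs_le_add_sq (R t x - sin (v t x)) (show (0 : ℝ) < 3 by norm_num)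
    rw [norm_mul, Real.norm_eq_abs, Real.norm_eq_abs, abs_of_nonneg hθ]
    have h5 : |R t x - sin (v t x)| ≤
        10 / 3 + 1 / 6 * (P t x ^ 2 + R t x ^ 2 - sin (v t x) ^ 2) := by
      nlinarith [sq_nonneg (P t x), sq_nonneg (R t x + sin (v t x)), sin_sq_le_one (v t x)]
    nlinarith
  rw [intervalIntegral.integral_add (Continuous.intervalIntegrable (by fun_prop) _ _)
    (Continuous.intervalIntegrable (by fun_prop) _ _), intervalIntegral.integral_const_mul,
    intervalIntegral.integral_const_mul, integral_timeWeight] at key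
  change _ ≤ _ + 1 / 6 * meanMomentum v P R x at key
  linarith [le_abs_self (meanMomentum v P R x)]

lemma abs_meanMomentum_sub_le (h : CylinderWave v P R Pt Px Rt Rx E) {X γ x y : ℝ}
    (hn : IsNearlyStatic v P R X γ) (hx : -X ≤ x) (hxy : x ≤ y) (hy : y ≤ X) :
    |meanMomentum v P R y - meanMomentum v P R x| ≤ 11 * γ := by
  have hP := h.cont_P; have hR := h.cont_R
  have hc1 : Continuous fun x => ∫ t in (0 : ℝ)..3, P t x ^ 2 :=
    continuous_integral_param (g := fun t x => P t x ^ 2) (by fun_prop) 0 3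
  have hc2 : Continuous fun x => ∫ t in (0 : ℝ)..3, |P t x * R t x| :=
    continuous_integral_param (g := fun t x => |P t x * R t x|) (by fun_prop) 0 3
  have hk1 : ∀ x, 0 ≤ ∫ t in (0 : ℝ)..3, P t x ^ 2 := fun x =>
    intervalIntegral.integral_nonneg (by norm_num) fun _ _ => sq_nonneg _
  have hk2 : ∀ x, 0 ≤ ∫ t in (0 : ℝ)..3, |P t x * R t x| := fun x =>
    intervalIntegral.integral_nonneg (by norm_num) fun _ _ => abs_nonneg _
  refine (abs_sub_le_integral_of_abs_deriv_le
    (g := fun x => 9 / 2 * (∫ t in (0 : ℝ)..3, P t x ^ 2)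
      + 6 * exp X * ∫ t in (0 : ℝ)..3, |P t x * R t x|) hxy
    (fun z _ => h.hasDerivAt_momentum z) (by fun_prop) fun z hz => ?_).trans ?_
  · have h2 := h.cont_P_time z; have h3 := h.cont_R_time z
    have e1 : |∫ t in (0 : ℝ)..3, timeWeight t * P t z ^ 2| ≤
        9 / 4 * ∫ t in (0 : ℝ)..3, P t z ^ 2 := by
      rw [← intervalIntegral.integral_const_mul]
      exact abs_integral_timeWeight_mul_le (by fun_prop) fun t _ => by rw [abs_of_nonneg (sq_nonneg _)]
    have e2 := abs_integral_deriv_timeWeight_mul_le (h2.mul h3)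
    have e3 : exp z ≤ exp X := exp_le_exp.2 (by linarith [hz.2])
    refine (_root_.abs_sub _ _).trans ?_
    rw [abs_mul, abs_mul, abs_mul, abs_of_pos (exp_pos z), abs_two]
    have e4 : exp z * |∫ t in (0 : ℝ)..3, (3 - 2 * t) * (P t z * R t z)| ≤
        exp X * (3 * ∫ t in (0 : ℝ)..3, |P t z * R t z|) := by gcongr; exact e2
    linarith
  · refine (intervalIntegral.integral_mono_interval (c := -X) (d := X) hx hxy hy
      (Eventually.of_forall fun z => add_nonneg (mul_nonneg (by norm_num) (hk1 z))
        (mul_nonneg (by positivity) (hk2 z)))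
      (Continuous.intervalIntegrable (by fun_prop) _ _)).trans ?_
    rw [intervalIntegral.integral_add (Continuous.intervalIntegrable (by fun_prop) _ _)
      (Continuous.intervalIntegrable (by fun_prop) _ _), intervalIntegral.integral_const_mul,
      intervalIntegral.integral_const_mul]
    have hγ : 0 ≤ γ := (intervalIntegral.integral_nonneg (by linarith) fun z _ => hk1 z).trans
      hn.kinetic
    linarith [hn.kinetic, hn.momentum]

/-- A majorant for the error terms in the evolution of the defect. -/
def errorBound (v P R : ℝ → ℝ → ℝ) (X γ x : ℝ) : ℝ :=
  3 * (exp X * ∫ t in (0 : ℝ)..3, |P t x|)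
    + 9 / 4 * γ * (3 + ∫ t in (0 : ℝ)..3, (P t x ^ 2 + R t x ^ 2 + sin (v t x) ^ 2))

lemma errorBound_add_pi (v P R : ℝ → ℝ → ℝ) (X γ x : ℝ) :
    errorBound (fun t x => v t x + π) P R X γ x = errorBound v P R X γ x := by
  simp [errorBound, sin_add_pi]

lemma continuous_errorBound (h : CylinderWave v P R Pt Px Rt Rx E) (X γ : ℝ) :
    Continuous (errorBound v P R X γ) := by
  have h1 := h.cont_integral_energy; have h2 := h.cont_integral_abs_velocity
  unfold errorBound
  fun_prop

lemma errorBound_nonneg {X γ : ℝ} (hγ : 0 ≤ γ) (x : ℝ) : 0 ≤ errorBound v P R X γ x := by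
  have h1 : 0 ≤ ∫ t in (0 : ℝ)..3, |P t x| :=
    intervalIntegral.integral_nonneg (by norm_num) fun _ _ => abs_nonneg _
  have h2 : 0 ≤ ∫ t in (0 : ℝ)..3, (P t x ^ 2 + R t x ^ 2 + sin (v t x) ^ 2) :=
    intervalIntegral.integral_nonneg (by norm_num) fun _ _ => by positivity
  unfold errorBound
  positivity

lemma integral_errorBound_le (h : CylinderWave v P R Pt Px Rt Rx E) {X γ x y : ℝ} (hγ : 0 ≤ γ)
    (hn : IsNearlyStatic v P R X γ) (hx : -X ≤ x) (hxy : x ≤ y) (hy : y ≤ X) :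
    ∫ z in x..y, errorBound v P R X γ z ≤ γ * (14 * X + 7 * E + 3) := by
  have h1 := h.cont_integral_energy; have h2 := h.cont_integral_abs_velocity
  have hE := h.energy_nonneg
  have h3 := h.integral_integral_energy_le (show -X ≤ X by linarith)
  have h4 := hn.velocity
  refine (intervalIntegral.integral_mono_interval (c := -X) (d := X) hx hxy hy
      (Eventually.of_forall fun z => errorBound_nonneg hγ z)
      ((h.continuous_errorBound X γ).intervalIntegrable _ _)).trans ?_
  unfold errorBound
  rw [intervalIntegral.integral_add (Continuous.intervalIntegrable (by fun_prop) _ _)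
      (Continuous.intervalIntegrable (by fun_prop) _ _), intervalIntegral.integral_const_mul,
      intervalIntegral.integral_const_mul, intervalIntegral.integral_const_mul,
      intervalIntegral.integral_add (by simp) (Continuous.intervalIntegrable (by fun_prop) _ _),
      intervalIntegral.integral_const, smul_eq_mul]
  have h5 : γ * (∫ x in (-X)..X, ∫ t in (0 : ℝ)..3, (P t x ^ 2 + R t x ^ 2 + sin (v t x) ^ 2)) ≤
      γ * (3 * E) := by gcongr
  have hX : 0 ≤ X := by linarith
  nlinarith [mul_nonneg hγ hX, mul_nonneg hγ hE]

/-- The defect solves a linear equation up to a small error. -/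
lemma exists_hasDerivAt_defect (h : CylinderWave v P R Pt Px Rt Rx E) {X γ x : ℝ}
    (hn : IsNearlyStatic v P R X γ) (hx : x ∈ Icc (-X) (X - 1)) :
    ∃ e, |e| ≤ errorBound v P R X γ x ∧
      HasDerivAt (defect v R) (e - cos (v 0 x) * defect v R x) x := by
  have h1 := h.cont_v_time x; have h2 := h.cont_P_time x; have h3 := h.cont_R_time x
  have hw := continuous_timeWeight
  refine ⟨-exp x * (∫ t in (0 : ℝ)..3, (3 - 2 * t) * P t x)
    - ∫ t in (0 : ℝ)..3, timeWeight t * ((cos (v t x) - cos (v 0 x)) * (R t x - sin (v t x))),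
    ?_, ?_⟩
  · have e1 := abs_integral_deriv_timeWeight_mul_le h2
    have e2 : |∫ t in (0 : ℝ)..3, timeWeight t *
        ((cos (v t x) - cos (v 0 x)) * (R t x - sin (v t x)))| ≤ 9 / 4 * γ * (3 +
          ∫ t in (0 : ℝ)..3, (P t x ^ 2 + R t x ^ 2 + sin (v t x) ^ 2)) := by
      refine (abs_integral_timeWeight_mul_le
        (g := fun t => γ * (1 + (P t x ^ 2 + R t x ^ 2 + sin (v t x) ^ 2))) (by fun_prop)
        fun t ht => ?_).trans_eq ?_
      · rw [abs_mul]
        have hclose := hn.close t ht x hx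
        have hcos : |cos (v t x) - cos (v 0 x)| ≤ γ := by
          refine le_trans ?_ hclose
          simpa using (abs_cos_sub_cos_le (v t x) (v 0 x))
        have hb := abs_le_add_sq (R t x - sin (v t x)) one_pos
        refine mul_le_mul hcos ?_ (abs_nonneg _) ((abs_nonneg _).trans hclose)
        nlinarith [sq_nonneg (P t x), sq_nonneg (R t x), sq_nonneg (sin (v t x)),
          sq_nonneg (R t x + sin (v t x))]
      · rw [intervalIntegral.integral_const_mul, intervalIntegral.integral_const_mul,
          intervalIntegral.integral_add (by simp) (Continuous.intervalIntegrable (by fun_prop) _ _),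
          intervalIntegral.integral_const, smul_eq_mul]
        ring
    have e3 : exp x ≤ exp X := exp_le_exp.2 (by linarith [hx.2])
    refine (_root_.abs_sub _ _).trans ?_
    rw [abs_mul, abs_neg, abs_of_pos (exp_pos x), errorBound]
    have e4 : exp x * |∫ t in (0 : ℝ)..3, (3 - 2 * t) * P t x| ≤
        exp X * (3 * ∫ t in (0 : ℝ)..3, |P t x|) := by gcongr
    linarith
  · refine (h.hasDerivAt_defect x).congr_deriv ?_
    rw [sub_sub, sub_right_inj, defect, ← intervalIntegral.integral_const_mul,
      ← intervalIntegral.integral_add (Continuous.intervalIntegrable (by fun_prop) _ _)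
      (Continuous.intervalIntegrable (by fun_prop) _ _)]
    refine intervalIntegral.integral_congr fun t _ => ?_
    ring

end CylinderWave

namespace CylinderWave

variable {v P R Pt Px Rt Rx : ℝ → ℝ → ℝ} {E : ℝ}

lemma exists_integral_energy_mul_le (h : CylinderWave v P R Pt Px Rt Rx E) {X : ℝ} (hX : 0 ≤ X) :
    ∃ x ∈ Icc (-X) 0,
      (∫ t in (0 : ℝ)..3, (P t x ^ 2 + R t x ^ 2 + sin (v t x) ^ 2)) * X ≤ 3 * E := by
  obtain ⟨x, hx, hle⟩ := exists_mul_le_integral h.cont_integral_energy (show -X ≤ 0 by linarith)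
  rw [sub_neg_eq_add, zero_add] at hle
  exact ⟨x, hx, hle.trans (h.integral_integral_energy_le (by linarith))⟩

lemma abs_meanMomentum_le_of_isNearlyStatic (h : CylinderWave v P R Pt Px Rt Rx E) {X γ y : ℝ}
    (hX : 0 < X) (hn : IsNearlyStatic v P R X γ) (hy : y ∈ Icc (-X) X) :
    |meanMomentum v P R y| ≤ 7 * E / X + 11 * γ := by
  have hE := h.energy_nonneg
  obtain ⟨x, hx, hle⟩ := h.exists_integral_energy_mul_le hX.le
  have h1 : |meanMomentum v P R x| ≤ 7 * E / X := by
    rw [le_div_iff₀ hX]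
    have := mul_le_mul_of_nonneg_right (h.abs_meanMomentum_le x) hX.le
    linarith
  have h2 : |meanMomentum v P R y - meanMomentum v P R x| ≤ 11 * γ := by
    rcases le_total x y with hxy | hxy
    · exact h.abs_meanMomentum_sub_le hn hx.1 hxy hy.2
    · rw [abs_sub_comm]
      exact h.abs_meanMomentum_sub_le hn hy.1 hxy (by linarith [hx.2])
  have h3 := abs_sub_abs_le_abs_sub (meanMomentum v P R y) (meanMomentum v P R x)
  linarith

lemma abs_defect_mul_defect_sub_le (h : CylinderWave v P R Pt Px Rt Rx E) {X γ x y : ℝ}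
    (hX : 0 < X) (hγ : 0 ≤ γ) (hn : IsNearlyStatic v P R X γ) (hN : 7 * E / X + 11 * γ ≤ 3)
    (hx : -X ≤ x) (hxy : x ≤ y) (hy : y ≤ X - 1) :
    |defect v R y * defect (fun t x => v t x + π) R y
      - defect v R x * defect (fun t x => v t x + π) R x|
      ≤ 32 * (γ * (14 * X + 7 * E + 3)) := by
  have hd : ∀ z ∈ Icc x y, ∃ D, |D| ≤ 32 * errorBound v P R X γ z ∧
      HasDerivAt (fun x => defect v R x * defect (fun t x => v t x + π) R x) D z := by
    intro z hz
    have hzX : z ∈ Icc (-X) (X - 1) := ⟨hx.trans hz.1, hz.2.trans hy⟩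
    obtain ⟨e, he, hde⟩ := h.exists_hasDerivAt_defect hn hzX
    obtain ⟨e', he', hde'⟩ := h.add_pi.exists_hasDerivAt_defect hn.add_pi hzX
    rw [errorBound_add_pi] at he'
    have hNz := (h.abs_meanMomentum_le_of_isNearlyStatic hX hn
      ⟨hzX.1, hzX.2.trans (by linarith)⟩).trans hN
    have b1 := h.abs_defect_le hNz
    have b2 := h.add_pi.abs_defect_le (x := z) (by simpa [meanMomentum, sin_add_pi] using hNz)
    refine ⟨e * defect (fun t x => v t x + π) R z + defect v R z * e', ?_,
      (hde.mul hde').congr_deriv (by rw [cos_add_pi]; ring)⟩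
    refine (abs_add_le _ _).trans ?_
    rw [abs_mul, abs_mul]
    have := mul_le_mul he b2 (abs_nonneg _) (errorBound_nonneg hγ z)
    have := mul_le_mul b1 he' (abs_nonneg _) (by norm_num)
    linarith
  have hc := h.continuous_errorBound X γ
  refine (abs_sub_le_integral_of_abs_deriv_le (g := fun z => 32 * errorBound v P R X γ z)
    (f := fun x => defect v R x * defect (fun t x => v t x + π) R x)
    (f' := deriv fun x => defect v R x * defect (fun t x => v t x + π) R x) hxy
    (fun z hz => ?_) (by fun_prop) fun z hz => ?_).trans ?_
  · obtain ⟨D, -, hD⟩ := hd z hz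
    exact hD.differentiableAt.hasDerivAt
  · obtain ⟨D, hle, hD⟩ := hd z hz
    rwa [hD.deriv]
  · rw [intervalIntegral.integral_const_mul]
    gcongr
    exact h.integral_errorBound_le hγ hn hx hxy (by linarith)

lemma abs_defect_mul_defect_le (h : CylinderWave v P R Pt Px Rt Rx E) {X γ y : ℝ}
    (hX : 0 < X) (hγ : 0 ≤ γ) (hn : IsNearlyStatic v P R X γ) (hN : 7 * E / X + 11 * γ ≤ 3)
    (hy : y ∈ Icc 0 (X - 1)) :
    |defect v R y * defect (fun t x => v t x + π) R y|
      ≤ 96 * E / X + 32 * (γ * (14 * X + 7 * E + 3)) := by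
  obtain ⟨x, hx, hle⟩ := h.exists_integral_energy_mul_le hX.le
  have h1 : |defect v R x * defect (fun t x => v t x + π) R x| ≤ 96 * E / X := by
    have s1 := h.sq_defect_le x
    have s2 := h.add_pi.sq_defect_le x
    simp only [sin_add_pi, neg_sq] at s2
    rw [le_div_iff₀ hX]
    have s3 : |defect v R x * defect (fun t x => v t x + π) R x| ≤
        32 * ∫ t in (0 : ℝ)..3, (P t x ^ 2 + R t x ^ 2 + sin (v t x) ^ 2) := by
      rw [abs_le]
      constructor <;>
      nlinarith [sq_nonneg (defect v R x + defect (fun t x => v t x + π) R x),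
        sq_nonneg (defect v R x - defect (fun t x => v t x + π) R x)]
    have := mul_le_mul_of_nonneg_right s3 hX.le
    linarith
  have h2 := h.abs_defect_mul_defect_sub_le hX hγ hn hN hx.1 (hx.2.trans hy.1) hy.2
  have h3 := abs_sub_abs_le_abs_sub (defect v R y * defect (fun t x => v t x + π) R y)
    (defect v R x * defect (fun t x => v t x + π) R x)
  linarith

lemma defect_eq (h : CylinderWave v P R Pt Px Rt Rx E) (x : ℝ) :
    defect v R x = (∫ t in (0 : ℝ)..3, timeWeight t * R t x)
      - ∫ t in (0 : ℝ)..3, timeWeight t * sin (v t x) := by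
  have h1 := h.cont_v_time x; have h3 := h.cont_R_time x; have hw := continuous_timeWeight
  rw [defect, ← intervalIntegral.integral_sub (Continuous.intervalIntegrable (by fun_prop) _ _)
    (Continuous.intervalIntegrable (by fun_prop) _ _)]
  exact intervalIntegral.integral_congr fun t _ => by ring

lemma defect_add_pi_eq (h : CylinderWave v P R Pt Px Rt Rx E) (x : ℝ) :
    defect (fun t x => v t x + π) R x = (∫ t in (0 : ℝ)..3, timeWeight t * R t x)
      + ∫ t in (0 : ℝ)..3, timeWeight t * sin (v t x) := by
  rw [h.add_pi.defect_eq]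
  simp [sin_add_pi]

lemma abs_integral_timeWeight_comp_sub_le (h : CylinderWave v P R Pt Px Rt Rx E) {X γ x : ℝ}
    (hn : IsNearlyStatic v P R X γ) (hx : x ∈ Icc (-X) (X - 1)) {F : ℝ → ℝ} (hF : Continuous F)
    (hL : ∀ a b, |F a - F b| ≤ |a - b|) :
    |(∫ t in (0 : ℝ)..3, timeWeight t * F (v t x)) - 9 / 2 * F (v 0 x)| ≤ 7 * γ := by
  have h1 := h.cont_v_time x; have hw := continuous_timeWeight
  have hγ : 0 ≤ γ := (abs_nonneg _).trans (hn.close 0 ⟨le_rfl, by norm_num⟩ x hx)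
  have key := abs_integral_timeWeight_mul_le (f := fun t => F (v t x) - F (v 0 x))
    (g := fun _ => γ) (by fun_prop) fun t ht => (hL _ _).trans (hn.close t ht x hx)
  simp only [mul_sub] at key
  rw [intervalIntegral.integral_sub (Continuous.intervalIntegrable (by fun_prop) _ _)
    (Continuous.intervalIntegrable (by fun_prop) _ _), intervalIntegral.integral_mul_const,
    integral_timeWeight, intervalIntegral.integral_const, smul_eq_mul] at key
  linarith

lemma mean_deriv_le (h : CylinderWave v P R Pt Px Rt Rx E) {X γ x : ℝ} (hX : 1 ≤ X)
    (hn : IsNearlyStatic v P R X γ) (hx : x ∈ Icc (-(1 / 9)) 0) :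
    ∫ t in (0 : ℝ)..3, timeWeight t * R t x ≤
      (∫ t in (0 : ℝ)..3, timeWeight t * R t 0) + 3 * γ + 3 / 4 := by
  have hc := h.cont_integral_abs_velocity
  have key := abs_sub_le_integral_of_abs_deriv_le
    (g := fun x => 3 * (∫ t in (0 : ℝ)..3, |P t x|) + 27 / 4) hx.2
    (fun z _ => h.hasDerivAt_mean_deriv z) (by fun_prop) fun z hz => by
      have h1 := h.cont_v_time z; have h2 := h.cont_P_time z
      have e1 := abs_integral_deriv_timeWeight_mul_le h2
      have e2 : |∫ t in (0 : ℝ)..3, timeWeight t * (sin (v t z) * cos (v t z))| ≤ 27 / 4 := by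
        refine (abs_integral_timeWeight_mul_le (g := fun _ => 1) (by fun_prop)
          fun t _ => ?_).trans (by simp; norm_num)
        rw [abs_mul]
        exact mul_le_one₀ (abs_sin_le_one _) (abs_nonneg _) (abs_cos_le_one _)
      have e3 : exp z ≤ 1 := exp_le_one_iff.2 hz.2
      refine (abs_add_le _ _).trans (add_le_add ?_ e2)
      rw [abs_mul, abs_neg, abs_of_pos (exp_pos z)]
      exact (mul_le_of_le_one_left (abs_nonneg _) e3).trans e1
  rw [intervalIntegral.integral_add (Continuous.intervalIntegrable (by fun_prop) _ _)
    (by simp), intervalIntegral.integral_const_mul, intervalIntegral.integral_const,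
    smul_eq_mul] at key
  have hk : ∀ z, 0 ≤ ∫ t in (0 : ℝ)..3, |P t z| := fun z =>
    intervalIntegral.integral_nonneg (by norm_num) fun _ _ => abs_nonneg _
  have h3 : ∫ z in x..0, ∫ t in (0 : ℝ)..3, |P t z| ≤ γ := by
    refine (intervalIntegral.integral_mono_interval (c := -X) (d := X) (by linarith [hx.1]) hx.2
      (by linarith) (Eventually.of_forall hk) (hc.intervalIntegrable _ _)).trans ?_
    refine le_trans ?_ hn.velocity
    exact le_mul_of_one_le_left (intervalIntegral.integral_nonneg (by linarith) fun z _ => hk z)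
      (one_le_exp (by linarith))
  linarith [(abs_le.1 key).1, hx.1]

/-- At the first crossing of `π / 2` the defect of the decreasing equation is large. -/
lemma four_lt_defect_add_pi (h : CylinderWave v P R Pt Px Rt Rx E) {X γ δ : ℝ} (hX : 1 ≤ X)
    (hγ : γ ≤ 1 / 100) (hn : IsNearlyStatic v P R X γ) (h0 : v 0 0 = π / 2)
    (hlt : ∀ x < 0, v 0 x < π / 2) (hδ : δ ≤ 1)
    (hZ : |defect v R 0 * defect (fun t x => v t x + π) R 0| ≤ δ) :
    4 < defect (fun t x => v t x + π) R 0 := by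
  by_contra! hle
  have m0 : (0 : ℝ) ∈ Icc (-X) (X - 1) := ⟨by linarith, by linarith⟩
  have m1 : (-(1 / 9) : ℝ) ∈ Icc (-X) (X - 1) := ⟨by linarith, by linarith⟩
  have hs := h.abs_integral_timeWeight_comp_sub_le hn m0 continuous_sin
    fun a b => abs_sin_sub_sin_le a b
  have hv0 := h.abs_integral_timeWeight_comp_sub_le hn m0 (F := fun a => a) continuous_id
    fun a b => le_rfl
  have hv1 := h.abs_integral_timeWeight_comp_sub_le hn m1 (F := fun a => a) continuous_id
    fun a b => le_rfl
  simp only [h0, sin_pi_div_two] at hs hv0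
  have e1 := h.defect_eq 0
  have e2 := h.defect_add_pi_eq 0
  have hZ4 : defect v R 0 ≤ -4 := by linarith [(abs_le.1 hs).1]
  have hZp : |defect (fun t x => v t x + π) R 0| ≤ 1 / 4 := by
    rw [abs_mul, abs_of_neg (by linarith)] at hZ
    nlinarith [abs_nonneg (defect (fun t x => v t x + π) R 0)]
  have hS : ∫ t in (0 : ℝ)..3, timeWeight t * R t 0 ≤ -3 := by
    linarith [(abs_le.1 hZp).2, (abs_le.1 hs).1]
  have key := le_add_integral_of_neg_le_deriv (f := fun x => -∫ t in (0 : ℝ)..3, timeWeight t * v t x)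
    (g := fun _ => -2) (show (-(1 / 9) : ℝ) ≤ 0 by norm_num)
    (fun x _ => (h.hasDerivAt_mean x).neg) continuous_const fun x hx => by
      linarith [h.mean_deriv_le hX hn hx]
  rw [intervalIntegral.integral_const, smul_eq_mul] at key
  linarith [hlt (-(1 / 9)) (by norm_num), (abs_le.1 hv0).1, (abs_le.1 hv1).2]

end CylinderWave

lemma sin_sub_sin_eq_mul_sinc (a b : ℝ) :
    sin a - sin b = (a - b) * (sinc ((a - b) / 2) * cos ((a + b) / 2)) := by
  rcases eq_or_ne a b with rfl | hab
  · simp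
  · have : a - b ≠ 0 := sub_ne_zero.2 hab
    rw [sinc_of_ne_zero (by positivity), sin_sub_sin]
    field_simp

/-- A two sided Gronwall estimate for a scalar linear equation. -/
lemma abs_le_exp_mul_of_hasDerivAt {f a g : ℝ → ℝ} {Y : ℝ} (ha : Continuous a)
    (ha1 : ∀ x, |a x| ≤ 1) (hg : Continuous g) (hg0 : ∀ x, 0 ≤ g x)
    (hf : ∀ x ∈ Icc (-Y) Y, ∃ e, |e| ≤ g x ∧ HasDerivAt f (e - a x * f x) x)
    {x : ℝ} (hx : x ∈ Icc (-Y) Y) :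
    |f x| ≤ exp Y * (|f 0| + exp Y * ∫ z in (-Y)..Y, g z) := by
  have hY : 0 ≤ Y := by linarith [hx.1, hx.2]
  set A : ℝ → ℝ := fun x => ∫ z in (0 : ℝ)..x, a z with hA
  have hAd : ∀ x, HasDerivAt A (a x) x := fun x =>
    intervalIntegral.integral_hasDerivAt_right (ha.intervalIntegrable _ _)
      (ha.stronglyMeasurableAtFilter _ _) ha.continuousAt
  have hA1 : ∀ x ∈ Icc (-Y) Y, |A x| ≤ Y := fun x hx => by
    have := intervalIntegral.norm_integral_le_of_norm_le_const (a := 0) (b := x) (f := a) (C := 1)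
      fun z _ => ha1 z
    rw [Real.norm_eq_abs, one_mul, sub_zero] at this
    exact this.trans (abs_le.2 hx)
  have hd : ∀ z ∈ Icc (-Y) Y, ∃ D, |D| ≤ exp Y * g z ∧
      HasDerivAt (fun x => exp (A x) * f x) D z := fun z hz => by
    obtain ⟨e, he, hde⟩ := hf z hz
    refine ⟨exp (A z) * e, ?_, ((hAd z).exp.mul hde).congr_deriv (by ring)⟩
    rw [abs_mul, abs_of_pos (exp_pos _)]
    exact mul_le_mul (exp_le_exp.2 ((le_abs_self _).trans (hA1 z hz))) he (abs_nonneg _)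
      (exp_pos _).le
  have key : ∀ b c, -Y ≤ b → b ≤ c → c ≤ Y →
      |exp (A c) * f c - exp (A b) * f b| ≤ exp Y * ∫ z in (-Y)..Y, g z := by
    intro b c hb hbc hc
    refine (abs_sub_le_integral_of_abs_deriv_le (f := fun x => exp (A x) * f x)
      (f' := deriv fun x => exp (A x) * f x) (g := fun z => exp Y * g z) hbc
      (fun z hz => ?_) (by fun_prop) fun z hz => ?_).trans ?_
    · obtain ⟨D, -, hD⟩ := hd z ⟨hb.trans hz.1, hz.2.trans hc⟩
      exact hD.differentiableAt.hasDerivAt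
    · obtain ⟨D, hle, hD⟩ := hd z ⟨hb.trans hz.1, hz.2.trans hc⟩
      rwa [hD.deriv]
    · rw [intervalIntegral.integral_const_mul]
      gcongr
      exact intervalIntegral.integral_mono_interval hb hbc hc (Eventually.of_forall hg0)
        (hg.intervalIntegrable _ _)
  have hA0 : A 0 = 0 := by simp [hA]
  have hx0 : |exp (A x) * f x - f 0| ≤ exp Y * ∫ z in (-Y)..Y, g z := by
    rcases le_total 0 x with h | h
    · simpa [hA0] using key 0 x (by linarith) h hx.2
    · rw [abs_sub_comm]
      simpa [hA0] using key x 0 hx.1 h hY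
  have hx1 : |exp (A x) * f x| ≤ |f 0| + exp Y * ∫ z in (-Y)..Y, g z := by
    linarith [abs_sub_abs_le_abs_sub (exp (A x) * f x) (f 0)]
  have hx2 : |f x| = exp (-A x) * |exp (A x) * f x| := by
    rw [abs_mul, abs_of_pos (exp_pos _), ← mul_assoc, ← exp_add]
    simp
  rw [hx2]
  exact mul_le_mul (exp_le_exp.2 ((neg_le_abs _).trans (hA1 x hx))) hx1 (abs_nonneg _)
    (exp_pos _).le

lemma hasDerivAt_Q (r : ℝ) : HasDerivAt Q (2 / (1 + r ^ 2)) r :=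
  ((hasDerivAt_arctan r).const_mul 2).congr_deriv (by ring)

lemma sin_Q (r : ℝ) : sin (Q r) = 2 * r / (1 + r ^ 2) := by
  have h1 := cos_arctan_pos r
  have h2 : sin (arctan r) = r * cos (arctan r) := by
    rw [← tan_mul_cos h1.ne', tan_arctan]
  rw [Q, sin_two_mul, h2, mul_div_assoc, ← mul_one_div r, ← cos_sq_arctan]
  ring

lemma Q_exp_zero : Q (exp 0) = π / 2 := by
  rw [Q, exp_zero, arctan_one]
  ring

lemma hasDerivAt_Q_exp (x : ℝ) : HasDerivAt (fun x => Q (exp x)) (sin (Q (exp x))) x :=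
  ((hasDerivAt_Q (exp x)).comp x (hasDerivAt_exp x)).congr_deriv (by rw [sin_Q]; ring)

namespace CylinderWave

variable {v P R Pt Px Rt Rx : ℝ → ℝ → ℝ} {E : ℝ}

lemma abs_defect_le_exp (h : CylinderWave v P R Pt Px Rt Rx E) {X Y γ x : ℝ} (hγ : 0 ≤ γ)
    (hn : IsNearlyStatic v P R X γ) (hYX : Y ≤ X - 1) (hx : x ∈ Icc (-Y) Y) :
    |defect v R x| ≤ exp Y * (|defect v R 0| + exp Y * (γ * (14 * X + 7 * E + 3))) := by
  have hv0 : Continuous fun x => v 0 x :=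
    h.cont_v.comp (by fun_prop : Continuous fun x : ℝ => ((0 : ℝ), x))
  refine (abs_le_exp_mul_of_hasDerivAt (a := fun x => cos (v 0 x)) (by fun_prop)
    (fun x => abs_cos_le_one _) (h.continuous_errorBound X γ) (errorBound_nonneg hγ)
    (fun z hz => h.exists_hasDerivAt_defect hn ⟨by linarith [hz.1], hz.2.trans hYX⟩) hx).trans ?_
  gcongr
  exact h.integral_errorBound_le hγ hn (by linarith) (by linarith [hx.1, hx.2]) (by linarith)

lemma abs_mean_sub_Q_le (h : CylinderWave v P R Pt Px Rt Rx E) {X Y γ ζ x : ℝ}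
    (hn : IsNearlyStatic v P R X γ) (hYX : Y ≤ X - 1) (h0 : v 0 0 = π / 2)
    (hζ : ∀ x ∈ Icc (-Y) Y, |defect v R x| ≤ ζ) (hx : x ∈ Icc (-Y) Y) :
    |2 / 9 * (∫ t in (0 : ℝ)..3, timeWeight t * v t x) - Q (exp x)|
      ≤ exp Y * (2 * γ + exp Y * (2 * Y * (ζ + 4 * γ))) := by
  have hY : 0 ≤ Y := by linarith [hx.1, hx.2]
  have m0 : (0 : ℝ) ∈ Icc (-X) (X - 1) := ⟨by linarith, by linarith⟩
  have hγ : 0 ≤ γ := (abs_nonneg _).trans (hn.close 0 ⟨le_rfl, by norm_num⟩ 0 m0)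
  have hζ0 : 0 ≤ ζ := (abs_nonneg _).trans (hζ x hx)
  set W : ℝ → ℝ := fun x => ∫ t in (0 : ℝ)..3, timeWeight t * v t x with hW
  have hWc : Continuous W := continuous_iff_continuousAt.2 fun z => (h.hasDerivAt_mean z).continuousAt
  have hQc : Continuous fun x => Q (exp x) :=
    continuous_iff_continuousAt.2 fun z => (hasDerivAt_Q_exp z).continuousAt
  have hcl : ∀ z ∈ Icc (-X) (X - 1), |2 / 9 * W z - v 0 z| ≤ 2 * γ := fun z hz => by
    have := h.abs_integral_timeWeight_comp_sub_le hn hz (F := fun a => a) continuous_id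
      fun a b => le_rfl
    rw [abs_le] at this ⊢
    constructor <;> linarith [this.1, this.2]
  have hs := continuous_sinc
  have key := abs_le_exp_mul_of_hasDerivAt (f := fun x => 2 / 9 * W x - Q (exp x))
    (a := fun x => -(sinc ((2 / 9 * W x - Q (exp x)) / 2) * cos ((2 / 9 * W x + Q (exp x)) / 2)))
    (g := fun _ => ζ + 4 * γ) (Y := Y) (by fun_prop)
    (fun z => by
      rw [abs_neg, abs_mul]
      exact mul_le_one₀ (abs_sinc_le_one _) (abs_nonneg _) (abs_cos_le_one _))
    continuous_const (fun _ => by positivity)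
    (fun z hz => by
      have hzX : z ∈ Icc (-X) (X - 1) := ⟨by linarith [hz.1], hz.2.trans hYX⟩
      have e1 := h.defect_eq z
      have e2 := h.abs_integral_timeWeight_comp_sub_le hn hzX continuous_sin
        fun a b => abs_sin_sub_sin_le a b
      have e3 := (abs_sin_sub_sin_le (2 / 9 * W z) (v 0 z)).trans (hcl z hzX)
      have e4 := hζ z hz
      refine ⟨2 / 9 * (∫ t in (0 : ℝ)..3, timeWeight t * R t z) - sin (2 / 9 * W z), ?_,
        (((h.hasDerivAt_mean z).const_mul (2 / 9)).fun_sub (hasDerivAt_Q_exp z)).congr_deriv ?_⟩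
      · rw [abs_le] at *
        constructor <;> linarith [e2.1, e2.2, e3.1, e3.2, e4.1, e4.2]
      · linear_combination sin_sub_sin_eq_mul_sinc (2 / 9 * W z) (Q (exp z))) hx
  refine key.trans ?_
  have e0 := hcl 0 m0
  rw [h0] at e0
  rw [intervalIntegral.integral_const, smul_eq_mul, Q_exp_zero]
  gcongr
  linarith

/-- The averaged first order energy is controlled by momentum and defect. -/
lemma integral_sq_defect_le (h : CylinderWave v P R Pt Px Rt Rx E) {X γ x : ℝ}
    (hn : IsNearlyStatic v P R X γ) (hγ : γ ≤ 1 / 2) (hx : x ∈ Icc (-X) (X - 1)) :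
    ∫ t in (0 : ℝ)..3, timeWeight t * (R t x - sin (v t x)) ^ 2 ≤
      2 * (|meanMomentum v P R x| + 2 * |defect v R x| + 9 / 2 * γ) := by
  have h1 := h.cont_v_time x; have h2 := h.cont_P_time x; have h3 := h.cont_R_time x
  have hw := continuous_timeWeight
  have hD0 : 0 ≤ ∫ t in (0 : ℝ)..3, timeWeight t * (R t x - sin (v t x)) ^ 2 :=
    intervalIntegral.integral_nonneg (by norm_num) fun t ht =>
      mul_nonneg (timeWeight_nonneg ht) (sq_nonneg _)
  have key : ∫ t in (0 : ℝ)..3, timeWeight t * (R t x - sin (v t x)) ^ 2 ≤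
      ∫ t in (0 : ℝ)..3, ((timeWeight t * (P t x ^ 2 + R t x ^ 2 - sin (v t x) ^ 2)
        - 2 * sin (v 0 x) * (timeWeight t * (R t x - sin (v t x))))
        + (γ * timeWeight t + γ * (timeWeight t * (R t x - sin (v t x)) ^ 2))) := by
    refine intervalIntegral.integral_mono_on (by norm_num)
      (Continuous.intervalIntegrable (by fun_prop) _ _)
      (Continuous.intervalIntegrable (by fun_prop) _ _) fun t ht => ?_
    have a1 := (abs_sin_sub_sin_le (v t x) (v 0 x)).trans (hn.close t ht x hx)
    have a2 : -(2 * ((sin (v t x) - sin (v 0 x)) * (R t x - sin (v t x)))) ≤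
        γ * (1 + (R t x - sin (v t x)) ^ 2) := by
      have b1 := mul_le_mul_of_nonneg_right a1 (abs_nonneg (R t x - sin (v t x)))
      rw [← abs_mul] at b1
      have b2 : 2 * |R t x - sin (v t x)| ≤ 1 + (R t x - sin (v t x)) ^ 2 := by
        rw [← sq_abs (R t x - sin (v t x))]
        nlinarith [sq_nonneg (|R t x - sin (v t x)| - 1)]
      have b3 := mul_le_mul_of_nonneg_left b2 ((abs_nonneg _).trans a1)
      linarith [neg_le_abs ((sin (v t x) - sin (v 0 x)) * (R t x - sin (v t x)))]
    have a3 : (R t x - sin (v t x)) ^ 2 ≤ (P t x ^ 2 + R t x ^ 2 - sin (v t x) ^ 2)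
        - 2 * sin (v 0 x) * (R t x - sin (v t x)) + γ * (1 + (R t x - sin (v t x)) ^ 2) := by
      linarith [sq_nonneg (P t x)]
    have := mul_le_mul_of_nonneg_left a3 (timeWeight_nonneg ht)
    linarith
  rw [intervalIntegral.integral_add (Continuous.intervalIntegrable (by fun_prop) _ _)
      (Continuous.intervalIntegrable (by fun_prop) _ _),
    intervalIntegral.integral_sub (Continuous.intervalIntegrable (by fun_prop) _ _)
      (Continuous.intervalIntegrable (by fun_prop) _ _),
    intervalIntegral.integral_add (Continuous.intervalIntegrable (by fun_prop) _ _)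
      (Continuous.intervalIntegrable (by fun_prop) _ _),
    intervalIntegral.integral_const_mul, intervalIntegral.integral_const_mul,
    intervalIntegral.integral_const_mul, integral_timeWeight] at key
  change _ ≤ meanMomentum v P R x - 2 * sin (v 0 x) * defect v R x + _ at key
  have hs : -(sin (v 0 x) * defect v R x) ≤ |defect v R x| := by
    refine (neg_le_abs _).trans ?_
    rw [abs_mul]
    exact mul_le_of_le_one_left (abs_nonneg _) (abs_sin_le_one _)
  have := mul_le_mul_of_nonneg_right hγ hD0
  linarith [le_abs_self (meanMomentum v P R x)]

lemma integral_sq_sub_le (h : CylinderWave v P R Pt Px Rt Rx E) {q σ x : ℝ}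
    (hσ : ∀ t ∈ Icc (0 : ℝ) 3, |v t x - q| ≤ σ) :
    ∫ t in (1 : ℝ)..2, ((R t x - sin q) ^ 2 + (v t x - q) ^ 2) ≤
      (∫ t in (0 : ℝ)..3, timeWeight t * (R t x - sin (v t x)) ^ 2) + 3 * σ ^ 2 := by
  have h1 := h.cont_v_time x; have h3 := h.cont_R_time x
  have hw := continuous_timeWeight
  have key : ∫ t in (1 : ℝ)..2, ((R t x - sin q) ^ 2 + (v t x - q) ^ 2) ≤
      (∫ t in (1 : ℝ)..2, timeWeight t * (R t x - sin (v t x)) ^ 2) + 3 * σ ^ 2 := by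
    have hc : ∫ _ in (1 : ℝ)..2, 3 * σ ^ 2 = 3 * σ ^ 2 := by
      rw [intervalIntegral.integral_const, smul_eq_mul]
      ring
    rw [← hc, ← intervalIntegral.integral_add (Continuous.intervalIntegrable (by fun_prop) _ _)
      (Continuous.intervalIntegrable (by fun_prop) _ _)]
    refine intervalIntegral.integral_mono_on (by norm_num)
      (Continuous.intervalIntegrable (by fun_prop) _ _)
      (Continuous.intervalIntegrable (by fun_prop) _ _) fun t ht => ?_
    have a1 : (v t x - q) ^ 2 ≤ σ ^ 2 :=
      sq_le_sq' (by linarith [(abs_le.1 (hσ t ⟨by linarith [ht.1], by linarith [ht.2]⟩)).1])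
        (abs_le.1 (hσ t ⟨by linarith [ht.1], by linarith [ht.2]⟩)).2
    have a2 : (sin (v t x) - sin q) ^ 2 ≤ (v t x - q) ^ 2 :=
      sq_le_sq.2 (abs_sin_sub_sin_le _ _)
    have a3 := mul_le_mul_of_nonneg_right (two_le_timeWeight ht) (sq_nonneg (R t x - sin (v t x)))
    nlinarith [sq_nonneg ((R t x - sin (v t x)) - (sin (v t x) - sin q))]
  have hmono := intervalIntegral.integral_mono_interval (c := 0) (a := 1) (b := 2) (d := 3)
    (μ := volume) (f := fun t => timeWeight t * (R t x - sin (v t x)) ^ 2)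
    (by norm_num) (by norm_num) (by norm_num)
    ((ae_restrict_mem measurableSet_Ioc).mono fun t ht =>
      mul_nonneg (timeWeight_nonneg ⟨ht.1.le, ht.2⟩) (sq_nonneg _))
    (Continuous.intervalIntegrable (by fun_prop) _ _)
  linarith

end CylinderWave

namespace CylinderWave

variable {v P R Pt Px Rt Rx : ℝ → ℝ → ℝ} {E : ℝ}

/-- The constant in `CylinderWave.integral_sq_sub_Q_le`. -/
def closenessConstant (Y : ℝ) : ℝ :=
  (45 + 132 * exp Y ^ 2)
    + 3 * (3 + exp Y * (2 + exp Y * (2 * Y * (33 * exp Y ^ 2 + 4)))) ^ 2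

lemma closenessConstant_pos (Y : ℝ) : 0 < closenessConstant Y := by
  unfold closenessConstant
  positivity

lemma abs_defect_le_of_isNearlyStatic (h : CylinderWave v P R Pt Px Rt Rx E) {X Y γ e : ℝ}
    (he0 : 0 < e) (he : e ≤ 1 / 200) (hY : 0 ≤ Y) (hYX : Y + 1 ≤ X) (hEX : E ≤ e * X)
    (hγ0 : 0 ≤ γ) (hγ : γ * (14 * X + 7 * E + 3) ≤ e) (hγe : γ ≤ e)
    (hn : IsNearlyStatic v P R X γ)
    (h0 : v 0 0 = π / 2) (hlt : ∀ x < 0, v 0 x < π / 2) {x : ℝ} (hx : x ∈ Icc (-Y) Y) :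
    |defect v R x| ≤ 33 * exp Y ^ 2 * e := by
  have hX : 0 < X := by linarith
  have hEX' : E / X ≤ e := (div_le_iff₀ hX).2 hEX
  have hprod := h.abs_defect_mul_defect_le hX hγ0 hn (by rw [mul_div_assoc]; linarith)
    (show (0 : ℝ) ∈ Icc 0 (X - 1) from ⟨le_rfl, by linarith⟩)
  rw [mul_div_assoc] at hprod
  have h4 := h.four_lt_defect_add_pi (by linarith) (by linarith) hn h0 hlt
    (show 96 * (E / X) + 32 * (γ * (14 * X + 7 * E + 3)) ≤ 1 by linarith) hprod
  have hZ0 : |defect v R 0| ≤ 32 * e := by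
    rw [abs_mul] at hprod
    have := mul_le_mul_of_nonneg_left (h4.le.trans (le_abs_self _)) (abs_nonneg (defect v R 0))
    linarith
  have hY1 : 1 ≤ exp Y := one_le_exp hY
  calc |defect v R x| ≤ exp Y * (|defect v R 0| + exp Y * (γ * (14 * X + 7 * E + 3))) :=
        h.abs_defect_le_exp hγ0 hn (by linarith) hx
    _ ≤ exp Y * (exp Y * (32 * e) + exp Y * e) := by
        gcongr
        exact hZ0.trans (le_mul_of_one_le_left (by positivity) hY1)
    _ = 33 * exp Y ^ 2 * e := by ring

lemma integral_sq_sub_Q_le (h : CylinderWave v P R Pt Px Rt Rx E) {X Y γ e : ℝ}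
    (he0 : 0 < e) (he : e ≤ 1 / 200) (hY : 0 ≤ Y) (hYX : Y + 1 ≤ X) (hEX : E ≤ e * X)
    (hγ0 : 0 ≤ γ) (hγ : γ * (14 * X + 7 * E + 3) ≤ e) (hγe : γ ≤ e)
    (hn : IsNearlyStatic v P R X γ)
    (h0 : v 0 0 = π / 2) (hlt : ∀ x < 0, v 0 x < π / 2) {x : ℝ} (hx : x ∈ Icc (-Y) Y) :
    ∫ t in (1 : ℝ)..2, ((R t x - sin (Q (exp x))) ^ 2 + (v t x - Q (exp x)) ^ 2) ≤
      closenessConstant Y * e := by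
  have hX : 0 < X := by linarith
  have hxX : x ∈ Icc (-X) (X - 1) := ⟨by linarith [hx.1], by linarith [hx.2]⟩
  have hζ : ∀ x ∈ Icc (-Y) Y, |defect v R x| ≤ 33 * exp Y ^ 2 * e := fun x hx =>
    h.abs_defect_le_of_isNearlyStatic he0 he hY hYX hEX hγ0 hγ hγe hn h0 hlt hx
  have hN : |meanMomentum v P R x| ≤ 18 * e := by
    have := h.abs_meanMomentum_le_of_isNearlyStatic hX hn ⟨hxX.1, by linarith [hxX.2]⟩
    rw [mul_div_assoc] at this
    linarith [(div_le_iff₀ hX).2 hEX]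
  have hD := h.integral_sq_defect_le hn (by linarith) hxX
  have hW := h.abs_mean_sub_Q_le hn (by linarith) h0 hζ hx
  have hWv := h.abs_integral_timeWeight_comp_sub_le hn hxX (F := fun a => a) continuous_id
      fun a b => le_rfl
  set c : ℝ := 3 + exp Y * (2 + exp Y * (2 * Y * (33 * exp Y ^ 2 + 4))) with hc
  have hc0 : 0 ≤ c := by positivity
  have hWc : |2 / 9 * (∫ t in (0 : ℝ)..3, timeWeight t * v t x) - Q (exp x)| ≤ (c - 3) * e := by
    refine hW.trans ?_
    calc _ ≤ exp Y * (2 * e + exp Y * (2 * Y * (33 * exp Y ^ 2 * e + 4 * e))) := by gcongr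
      _ = (c - 3) * e := by rw [hc]; ring
  have hσ : ∀ t ∈ Icc (0 : ℝ) 3, |v t x - Q (exp x)| ≤ c * e := fun t ht => by
    have := hn.close t ht x hxX
    rw [abs_le] at *
    constructor <;> linarith [this.1, this.2, hWv.1, hWv.2, hWc.1, hWc.2]
  refine (h.integral_sq_sub_le hσ).trans ?_
  have hce : 3 * (c * e) ^ 2 ≤ 3 * c ^ 2 * e := by
    have : e ^ 2 ≤ e := by nlinarith
    calc 3 * (c * e) ^ 2 = 3 * c ^ 2 * e ^ 2 := by ring
      _ ≤ _ := by gcongr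
  have hcl : closenessConstant Y * e = 45 * e + 4 * (33 * exp Y ^ 2 * e) + 3 * c ^ 2 * e := by
    rw [closenessConstant, hc]
    ring
  rw [hcl]
  linarith [hζ x hx]

end CylinderWave

/-- An almost static cylinder wave normalized by its first crossing of `π / 2` is close to the
ground state. -/
theorem CylinderWave.exists_integral_sq_sub_Q_le {E Y η : ℝ} (hE : 0 ≤ E) (hY : 0 ≤ Y)
    (hη : 0 < η) :
    ∃ X ε : ℝ, 0 ≤ X ∧ 0 < ε ∧ ∀ {v P R Pt Px Rt Rx : ℝ → ℝ → ℝ},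
      CylinderWave v P R Pt Px Rt Rx E →
      ∫ t in (0 : ℝ)..3, ∫ x in (-X)..X, P t x ^ 2 ≤ ε →
      v 0 0 = π / 2 → (∀ x < 0, v 0 x < π / 2) → ∀ x ∈ Icc (-Y) Y,
      ∫ t in (1 : ℝ)..2, ((R t x - sin (Q (exp x))) ^ 2 + (v t x - Q (exp x)) ^ 2) ≤ η := by
  have hC := CylinderWave.closenessConstant_pos Y
  obtain ⟨e, he0, he, heη⟩ : ∃ e > 0, e ≤ 1 / 200 ∧ CylinderWave.closenessConstant Y * e ≤ η :=
    ⟨min (1 / 200) (η / CylinderWave.closenessConstant Y), by positivity, min_le_left _ _, by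
      rw [← le_div_iff₀' hC]
      exact min_le_right _ _⟩
  set X : ℝ := E / e + Y + 1 with hX
  have hX1 : Y + 1 ≤ X := by linarith [show 0 ≤ E / e by positivity]
  have hEX : E ≤ e * X := by
    rw [hX, add_assoc, mul_add, mul_div_cancel₀ _ he0.ne']
    linarith [show 0 ≤ e * (Y + 1) by positivity]
  have hpos : 1 ≤ 14 * X + 7 * E + 3 := by linarith
  obtain ⟨ε, hε, H⟩ := CylinderWave.exists_isNearlyStatic hE (show 0 ≤ X by linarith)
    (show 0 < e / (14 * X + 7 * E + 3) by positivity)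
  exact ⟨X, ε, by linarith, hε, fun h hκ h0 hlt x hx =>
    (h.integral_sq_sub_Q_le he0 he hY hX1 hEX (by positivity)
      (div_mul_cancel₀ _ (by positivity)).le (div_le_self he0.le hpos) (H h hκ) h0 hlt hx).trans heη⟩

lemma integral_integral_eq_log {K J : ℝ → ℝ → ℝ} (hK : Continuous fun z : ℝ × ℝ => K z.1 z.2)
    {r₁ r₂ : ℝ} (hr₁ : 0 < r₁) (hr : r₁ ≤ r₂)
    (hJ : ∀ t ∈ Ioc (0 : ℝ) 1, ∀ r ∈ Ioc r₁ r₂, J t r = K (1 + t) (log r) * r⁻¹) :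
    ∫ t in Ioc (0 : ℝ) 1, ∫ r in Ioc r₁ r₂, J t r =
      ∫ x in log r₁..log r₂, ∫ t in (1 : ℝ)..2, K t x := by
  have h1 : ∀ t ∈ Ioc (0 : ℝ) 1, ∫ r in Ioc r₁ r₂, J t r =
      ∫ x in log r₁..log r₂, K (1 + t) x := fun t ht => by
    have hKt : Continuous fun x => K (1 + t) x :=
      hK.comp (by fun_prop : Continuous fun x : ℝ => (1 + t, x))
    have hpos : ∀ r ∈ uIcc r₁ r₂, r ≠ 0 := fun r hr' => by
      rw [uIcc_of_le hr] at hr'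
      linarith [hr'.1]
    rw [setIntegral_congr_fun measurableSet_Ioc (hJ t ht), ← intervalIntegral.integral_of_le hr]
    exact intervalIntegral.integral_comp_mul_deriv' (f := log) (f' := fun r => r⁻¹)
      (g := fun x => K (1 + t) x) (fun r hr' => hasDerivAt_log (hpos r hr'))
      (continuousOn_inv₀.mono fun r hr' => hpos r hr') hKt.continuousOn
  rw [setIntegral_congr_fun measurableSet_Ioc h1,
    ← intervalIntegral.integral_of_le zero_le_one,
    ← integral_swap_of_continuous (g := fun t x => K (1 + t) x)
      (hK.comp (by fun_prop : Continuous fun z : ℝ × ℝ => (1 + z.1, z.2)))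
      (log_le_log hr₁ hr) zero_le_one]
  refine intervalIntegral.integral_congr fun x _ => ?_
  norm_num [intervalIntegral.integral_comp_add_left (fun t => K t x) 1]

/-- Rescalings of a degree one wave map, at late times and at scales small compared with the light
cone, which are close to the ground state. -/
theorem IsWaveMap.exists_rescaling {ψ : ℝ → ℝ → ℝ} (hψ : IsWaveMap ψ) (hfe : FiniteEnergy ψ)
    (hcons : EnergyConserved ψ) (hbc : DegreeOneBC ψ) {Y η : ℝ} (hY : 0 ≤ Y) (hη : 0 < η) (M : ℝ) :
    ∃ T l : ℝ, 0 < l ∧ M ≤ T ∧ M * l ≤ T ∧ 0 < T ∧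
      ∀ r₁ r₂ : ℝ, exp (-Y) ≤ r₁ → r₁ ≤ r₂ → r₂ ≤ exp Y →
        ∫ t in Ioc (0 : ℝ) 1, ∫ r in Ioc r₁ r₂,
          ((l * pR ψ (T + l * t) (l * r) - deriv Q r) ^ 2
            + (ψ (T + l * t) (l * r) - Q r) ^ 2 / r ^ 2) * r ≤ (log r₂ - log r₁) * η := by
  have hE : 0 ≤ totE ψ 0 := (hψ.cylinderWave hfe hcons one_pos 0).energy_nonneg
  obtain ⟨X, ε, hX, hε, H⟩ := CylinderWave.exists_integral_sq_sub_Q_le hE hY hη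
  obtain ⟨t₀, z₀, ht₀, hM, hMz, h0, hlt, hκ⟩ :=
    hψ.exists_concentration_scale hfe hcons hbc hε hX M
  have hw := hψ.cylinderWave hfe hcons ht₀ z₀
  have hl := exp_pos z₀
  refine ⟨t₀ + exp z₀, exp z₀, hl, by linarith, by linarith, by linarith,
    fun r₁ r₂ hr₁ hr hr₂ => ?_⟩
  have hpos : 0 < r₁ := (exp_pos _).trans_le hr₁
  have hclose := H hw hκ (by simpa using h0) (by simpa using hlt)
  have hQc : Continuous fun x => Q (exp x) :=
    continuous_iff_continuousAt.2 fun z => (hasDerivAt_Q_exp z).continuousAt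
  set v : ℝ → ℝ → ℝ := fun t x => ψ (t₀ + exp z₀ * max t 0) (exp (z₀ + x)) with hv
  set R : ℝ → ℝ → ℝ :=
    fun t x => exp (z₀ + x) * pR ψ (t₀ + exp z₀ * max t 0) (exp (z₀ + x)) with hR
  have hvc : Continuous fun z : ℝ × ℝ => v z.1 z.2 := hw.cont_v
  have hRc : Continuous fun z : ℝ × ℝ => R z.1 z.2 := hw.cont_R
  have hK : Continuous fun z : ℝ × ℝ =>
      (R z.1 z.2 - sin (Q (exp z.2))) ^ 2 + (v z.1 z.2 - Q (exp z.2)) ^ 2 := by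
    have : Continuous fun z : ℝ × ℝ => Q (exp z.2) := hQc.comp continuous_snd
    fun_prop
  rw [integral_integral_eq_log
    (K := fun t x => (R t x - sin (Q (exp x))) ^ 2 + (v t x - Q (exp x)) ^ 2) hK hpos hr
    fun t ht r hr' => ?_]
  · have hlog := log_le_log hpos hr
    refine (intervalIntegral.integral_mono_on (g := fun _ => η) hlog
      ((continuous_integral_param hK 1 2).intervalIntegrable _ _) (by simp) fun x hx =>
      hclose x ⟨?_, ?_⟩).trans_eq (by simp)
    · exact ((le_log_iff_exp_le hpos).2 hr₁).trans hx.1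
    · exact hx.2.trans ((log_le_iff_le_exp (hpos.trans_le hr)).2 hr₂)
  · have hr0 : 0 < r := hpos.trans hr'.1
    have e1 : exp (z₀ + log r) = exp z₀ * r := by rw [exp_add, exp_log hr0]
    have e2 : max (1 + t) 0 = 1 + t := max_eq_left (by linarith [ht.1])
    have e3 : t₀ + exp z₀ * (1 + t) = t₀ + exp z₀ + exp z₀ * t := by ring
    simp only [hv, hR, e1, e2, e3, exp_log hr0, sin_Q, (hasDerivAt_Q r).deriv]
    field_simp

/-- for degree-one wave maps with energy below `3E(Q) = 12`, a rescaled sequence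
converges locally in `L²_t H` to the harmonic map `Q(·/λ₀)` (with the `+` sign). -/
theorem stmt9_degree_one_bubbling
    (ψ : ℝ → ℝ → ℝ)
    (hwm : IsWaveMap ψ) (hfe : FiniteEnergy ψ) (hcons : EnergyConserved ψ)
    (hbc : DegreeOneBC ψ)
    (hE3 : totE ψ 0 < 12) :
    ∃ tn lamn : ℕ → ℝ, ∃ lam0 : ℝ,
      Filter.Tendsto tn Filter.atTop Filter.atTop ∧
      (∀ n, 0 < lamn n) ∧
      Filter.Tendsto (fun n => lamn n / tn n) Filter.atTop (nhds 0) ∧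
      0 < lam0 ∧
      ∀ r₁ r₂ : ℝ, 0 < r₁ → r₁ < r₂ →
        Filter.Tendsto
          (fun n => ∫ t in Set.Ioc (0:ℝ) 1, ∫ r in Set.Ioc r₁ r₂,
            ((lamn n * pR ψ (tn n + lamn n * t) (lamn n * r)
                - (1 / lam0) * deriv Q (r / lam0)) ^ 2
              + (ψ (tn n + lamn n * t) (lamn n * r) - Q (r / lam0)) ^ 2 / r ^ 2) * r)
          Filter.atTop (nhds 0) := by
  have hη : ∀ n : ℕ, (0 : ℝ) < 1 / ((n : ℝ) + 1) := fun n => Nat.one_div_pos_of_nat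
  choose tn lamn hl hM hMl htn hclose using fun n : ℕ =>
    hwm.exists_rescaling hfe hcons hbc n.cast_nonneg (hη n) ((n : ℝ) + 1)
  refine ⟨tn, lamn, 1, tendsto_atTop_mono (fun n => (le_add_of_nonneg_right zero_le_one).trans
    (hM n)) tendsto_natCast_atTop_atTop, hl, ?_, one_pos, fun r₁ r₂ hr₁ hr => ?_⟩
  · refine squeeze_zero (fun n => (div_pos (hl n) (htn n)).le) (fun n => ?_)
      (tendsto_one_div_add_atTop_nhds_zero_nat (𝕜 := ℝ))
    have : (0 : ℝ) < (n : ℝ) + 1 := by positivity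
    rw [div_le_div_iff₀ (htn n) this, one_mul, mul_comm]
    exact hMl n
  · have hlim := (tendsto_one_div_add_atTop_nhds_zero_nat (𝕜 := ℝ)).const_mul (log r₂ - log r₁)
    rw [mul_zero] at hlim
    have hlarge := tendsto_natCast_atTop_atTop (R := ℝ) |>.eventually_ge_atTop
      (max (-log r₁) (log r₂))
    refine squeeze_zero' (.of_forall fun n => ?_) (hlarge.mono fun n hn => ?_) hlim
    · refine setIntegral_nonneg measurableSet_Ioc fun t _ =>
        setIntegral_nonneg measurableSet_Ioc fun r hr' => ?_
      have : 0 < r := hr₁.trans hr'.1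
      positivity
    · simp only [div_one, one_mul]
      refine hclose n r₁ r₂ ?_ hr.le ?_
      · rw [← le_log_iff_exp_le hr₁]
        linarith [(le_max_left _ _).trans hn]
      · rw [← log_le_iff_le_exp (hr₁.trans hr)]
        exact (le_max_right _ _).trans hn
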